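/- Let X be a complete locally compact metric tree without leaves and with no valency-2 vertices, and let ν₋, ν₊ be two antipodal Borel probability measures on ∂X. Then the following are equivalent: (1) there is a complete unit-speed geodesic of W₂(X) with ends ν₋ and ν₊; (2) the optimal transport problem inf over couplings Π of (ν₋,ν₊) of ∫ −D₀²(ξ,ζ) dΠ(ξ,ζ) is finite, where D₀(ξ,ζ) is the distance from the base point x₀ to the geodesic line with endpoints ξ, ζ; (3) the specific flow defined by ν₋ and ν₊ satisfies Σ_{x∈V} φ⁰(x) d(x,x₀)² < ∞. Moreover, when these hold, problem (2) has a minimizer Π₀, and pushing Π₀ forward by the map assigning to (ξ,ζ) the unit-speed geodesic from ξ to ζ parametrized so that its time-0 point is closest to x₀ yields a geodesic of W₂(X) with the prescribed ends; and the conditions are satisfied whenever ν₋ and ν₊ are uniformly antipodal (their supports are antipodal). -/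

import Mathlib

open MeasureTheory Filter Set Topology
open scoped NNReal ENNReal

noncomputable section


/-! ## Geodesics and Hadamard spaces -/

/-- `γ` is a geodesic on the set of parameters `s`, of speed `v`, with respect to the
distance function `d`. -/
def IsGeodesicOnWith {A : Type*} (d : A → A → ℝ) (γ : ℝ → A) (s : Set ℝ) (v : ℝ) : Prop :=
  ∀ t ∈ s, ∀ t' ∈ s, d (γ t) (γ t') = v * |t - t'|

/-- A metric space is geodesic if any two points are joined by a geodesic. -/
def IsGeodesicSpace (Y : Type*) [MetricSpace Y] : Prop :=
  ∀ x y : Y, ∃ γ : ℝ → Y, γ 0 = x ∧ γ 1 = y ∧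
    IsGeodesicOnWith dist γ (Set.Icc (0:ℝ) 1) (dist x y)

/-- Every geodesic segment extends to a complete geodesic (defined on all of `ℝ`). -/
def GeodesicallyComplete (Y : Type*) [MetricSpace Y] : Prop :=
  ∀ (γ : ℝ → Y) (a b v : ℝ), a < b → IsGeodesicOnWith dist γ (Set.Icc a b) v →
    ∃ g : ℝ → Y, IsGeodesicOnWith dist g Set.univ v ∧ ∀ t ∈ Set.Icc a b, g t = γ t

/-- A Hadamard space: complete, separable, locally compact, geodesic, globally CAT(0).
The CAT(0) comparison inequality is expressed through the explicit formula for the distance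
from a vertex to a point of the opposite side in the Euclidean comparison triangle. -/
structure IsHadamard (X : Type*) [MetricSpace X] : Prop where
  complete : CompleteSpace X
  separable : TopologicalSpace.SeparableSpace X
  locallyCompact : LocallyCompactSpace X
  geodesic : IsGeodesicSpace X
  cat0 : ∀ (x y z : X) (γ : ℝ → X), γ 0 = y → γ 1 = z →
    IsGeodesicOnWith dist γ (Set.Icc (0:ℝ) 1) (dist y z) →
    ∀ t ∈ Set.Icc (0:ℝ) 1,
      dist x (γ t) ^ 2 ≤ (1 - t) * dist x y ^ 2 + t * dist x z ^ 2 - t * (1 - t) * dist y z ^ 2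

/-- A space is non-branching if two geodesics coinciding on a nonempty open set of parameters
coincide on their whole common interval of definition. -/
def NonBranching (X : Type*) [MetricSpace X] : Prop :=
  ∀ (γ β : ℝ → X) (I : Set ℝ) (v w : ℝ),
    IsGeodesicOnWith dist γ I v → IsGeodesicOnWith dist β I w →
    (∃ U : Set ℝ, U ⊆ I ∧ IsOpen U ∧ U.Nonempty ∧ ∀ t ∈ U, γ t = β t) →
    ∀ t ∈ I, γ t = β t

/-! ## The Wasserstein space -/

/-- `π` is a coupling (transport plan) between `μ` and `ν`. -/
def IsCoupling {A B : Type*} [MeasurableSpace A] [MeasurableSpace B]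
    (π : Measure (A × B)) (μ : Measure A) (ν : Measure B) : Prop :=
  π.map Prod.fst = μ ∧ π.map Prod.snd = ν

/-- The quadratic Wasserstein space over `Y`: Borel probability measures with finite second
moment. -/
abbrev W2Space (Y : Type*) [MetricSpace Y] [MeasurableSpace Y] : Type _ :=
  {μ : Measure Y // IsProbabilityMeasure μ ∧
    ∃ x₀ : Y, (∫⁻ x, ENNReal.ofReal (dist x₀ x) ^ 2 ∂μ) < ⊤}

/-- The quadratic transport cost between two measures. -/
def W2cost {Y : Type*} [MetricSpace Y] [MeasurableSpace Y] (μ ν : Measure Y) : ℝ≥0∞ :=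
  ⨅ (π : Measure (Y × Y)) (_ : IsCoupling π μ ν),
    ∫⁻ p, ENNReal.ofReal (dist p.1 p.2) ^ 2 ∂π

/-- The quadratic Wasserstein distance. -/
def Wdist {Y : Type*} [MetricSpace Y] [MeasurableSpace Y] (μ ν : W2Space Y) : ℝ :=
  Real.sqrt (W2cost μ.1 ν.1).toReal


/-! ## Rays, complete geodesics, the boundary at infinity and the cone over it -/

/-- Geodesic rays of `X` (arbitrary nonnegative speed), parametrized by `ℝ≥0`.
The topology (of a subtype of a product) coincides on this set with the topology of
uniform convergence on compact sets. -/
abbrev RaySpace (X : Type*) [MetricSpace X] : Type _ :=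
  {γ : ℝ≥0 → X // ∃ v : ℝ, 0 ≤ v ∧ ∀ s t : ℝ≥0, dist (γ s) (γ t) = v * dist s t}

/-- Unit speed geodesic rays of `X`. -/
abbrev UnitRay (X : Type*) [MetricSpace X] : Type _ :=
  {γ : ℝ≥0 → X // ∀ s t : ℝ≥0, dist (γ s) (γ t) = dist s t}

/-- Complete geodesics of `X` (arbitrary nonnegative speed). -/
abbrev GeoLine (X : Type*) [MetricSpace X] : Type _ :=
  {γ : ℝ → X // ∃ v : ℝ, 0 ≤ v ∧ ∀ s t : ℝ, dist (γ s) (γ t) = v * |s - t|}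

/-- Complete unit speed geodesics of `X`. -/
abbrev UnitLine (X : Type*) [MetricSpace X] : Type _ :=
  {γ : ℝ → X // ∀ s t : ℝ, dist (γ s) (γ t) = |s - t|}

/-- Evaluation of a ray at time `t`. -/
def rayEval {X : Type*} [MetricSpace X] (t : ℝ≥0) : RaySpace X → X := fun γ => γ.1 t

/-- Two curves (w.r.t. a distance function `d`) are asymptotic if they stay at bounded
distance. -/
def AsymptoticMaps {A : Type*} (d : A → A → ℝ) (γ β : ℝ≥0 → A) : Prop :=
  ∃ C : ℝ, ∀ t, d (γ t) (β t) ≤ C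

/-- The asymptote relation on unit-speed rays. -/
def unitRaySetoid (X : Type*) [MetricSpace X] : Setoid (UnitRay X) where
  r γ β := AsymptoticMaps dist γ.1 β.1
  iseqv := by
    refine ⟨fun γ => ⟨0, fun t => by simp⟩, ?_, ?_⟩
    · rintro γ β ⟨C, h⟩
      exact ⟨C, fun t => by rw [dist_comm]; exact h t⟩
    · rintro γ β δ ⟨C, h⟩ ⟨C', h'⟩
      exact ⟨C + C', fun t => (dist_triangle _ _ _).trans (add_le_add (h t) (h' t))⟩

/-- The geodesic boundary of `X`: asymptote classes of unit-speed rays, with the quotient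
topology of the topology of uniform convergence on compact sets (the cone topology). -/
abbrev Boundary (X : Type*) [MetricSpace X] := Quotient (unitRaySetoid X)

/-- Apex-like points, to be collapsed when forming the cone over `B`. -/
def coneIsApex {B : Type*} : B × ℝ≥0 ⊕ Unit → Prop
  | Sum.inl p => p.2 = 0
  | Sum.inr _ => True

/-- The relation collapsing all apex-like points. -/
def coneSetoid (B : Type*) : Setoid (B × ℝ≥0 ⊕ Unit) where
  r p q := p = q ∨ (coneIsApex p ∧ coneIsApex q)
  iseqv := by
    refine ⟨fun p => Or.inl rfl, ?_, ?_⟩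
    · rintro p q (rfl | h)
      · exact Or.inl rfl
      · exact Or.inr ⟨h.2, h.1⟩
    · rintro p q r (rfl | h) (rfl | h')
      · exact Or.inl rfl
      · exact Or.inr h'
      · exact Or.inr h
      · exact Or.inr ⟨h.1, h'.2⟩

/-- The cone over a space `B`: the quotient of `B × [0,∞)` collapsing the zero level to the
apex, with the quotient topology. -/
abbrev Cone (B : Type*) := Quotient (coneSetoid B)

/-- The point of the cone over `b` at height (speed) `s`. -/
def coneMk {B : Type*} (b : B) (s : ℝ≥0) : Cone B :=
  Quotient.mk (coneSetoid B) (Sum.inl (b, s))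

/-- The apex of the cone. -/
def conePt (B : Type*) : Cone B := Quotient.mk (coneSetoid B) (Sum.inr ())

private def coneSpeedAux {B : Type*} : B × ℝ≥0 ⊕ Unit → ℝ≥0
  | Sum.inl p => p.2
  | Sum.inr _ => 0

/-- The speed (radial) coordinate of a point of the cone. -/
def coneSpeed {B : Type*} : Cone B → ℝ≥0 :=
  Quotient.lift coneSpeedAux (by
    rintro p q (rfl | ⟨h1, h2⟩)
    · rfl
    · cases p <;> cases q <;> simp_all [coneIsApex, coneSpeedAux])

/-- The speed of a geodesic ray. -/
def raySpeed {X : Type*} [MetricSpace X] (γ : RaySpace X) : ℝ≥0 :=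
  nndist (γ.1 0) (γ.1 1)

lemma raySpeed_eq {X : Type*} [MetricSpace X] (γ : RaySpace X) {v : ℝ} (hv0 : 0 ≤ v)
    (hv : ∀ s t : ℝ≥0, dist (γ.1 s) (γ.1 t) = v * dist s t) : (raySpeed γ : ℝ) = v := by
  have h1 := hv 0 1
  have h2 : dist (0 : ℝ≥0) (1 : ℝ≥0) = 1 := by rw [NNReal.dist_eq]; norm_num
  rw [h2, mul_one] at h1
  rw [show (raySpeed γ : ℝ) = dist (γ.1 0) (γ.1 1) from (dist_nndist _ _).symm, h1]

/-- The unit reparametrization of a nonconstant ray. -/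
def rayUnit {X : Type*} [MetricSpace X] (γ : RaySpace X) (h : raySpeed γ ≠ 0) : UnitRay X := by
  refine ⟨fun t => γ.1 (t / raySpeed γ), ?_⟩
  obtain ⟨v, hv0, hv⟩ := γ.2
  have hveq : (raySpeed γ : ℝ) = v := raySpeed_eq γ hv0 hv
  intro s t
  have hr : (raySpeed γ : ℝ) ≠ 0 := by
    simpa using h
  show dist (γ.1 (s / raySpeed γ)) (γ.1 (t / raySpeed γ)) = dist s t
  rw [hv, NNReal.dist_eq, NNReal.dist_eq, NNReal.coe_div, NNReal.coe_div,
    div_sub_div_same, abs_div, abs_of_nonneg (raySpeed γ).coe_nonneg, ← hveq]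
  field_simp

/-- The point at infinity (in the cone over the boundary) defined by a geodesic ray:
its asymptote class together with its speed; constant rays are sent to the apex. -/
def rayEnd {X : Type*} [MetricSpace X] (γ : RaySpace X) : Cone (Boundary X) :=
  if h : raySpeed γ = 0 then conePt (Boundary X)
  else coneMk (Quotient.mk (unitRaySetoid X) (rayUnit γ h)) (raySpeed γ)

/-! ## Asymptotic distance -/

def dInfty {X : Type*} [MetricSpace X] (γ β : ℝ≥0 → X) : ℝ :=
  Filter.limsup (fun t : ℝ≥0 => dist (γ t) (β t) / (t : ℝ)) Filter.atTop

/-- The asymptotic (angular) distance on the boundary, computed on representative rays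
(it does not depend on the choice of representatives). -/
def boundaryDist {X : Type*} [MetricSpace X] (ξ ζ : Boundary X) : ℝ :=
  dInfty (ξ.out).1 (ζ.out).1

def coneDistAux {X : Type*} [MetricSpace X] :
    Boundary X × ℝ≥0 ⊕ Unit → Boundary X × ℝ≥0 ⊕ Unit → ℝ
  | Sum.inl p, Sum.inl q =>
      Real.sqrt (((p.2 : ℝ) - (q.2 : ℝ)) ^ 2 + (p.2 : ℝ) * (q.2 : ℝ) * boundaryDist p.1 q.1 ^ 2)
  | Sum.inl p, Sum.inr _ => p.2
  | Sum.inr _, Sum.inl q => q.2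
  | Sum.inr _, Sum.inr _ => 0

/-- The asymptotic distance on the cone over the boundary (the cone metric). -/
def coneDist {X : Type*} [MetricSpace X] : Cone (Boundary X) → Cone (Boundary X) → ℝ :=
  Quotient.lift₂ coneDistAux (by
    rintro a₁ a₂ b₁ b₂ h12 h34
    rcases h12 with rfl | ⟨h1, h2⟩ <;> rcases h34 with rfl | ⟨h3, h4⟩
    · rfl
    · rcases a₁ with p | u <;> rcases a₂ with q | v <;> rcases b₂ with q' | w <;>
        simp_all [coneIsApex, coneDistAux, Real.sqrt_sq, NNReal.coe_nonneg]
    · rcases a₂ with q | u <;> rcases a₁ with p | v <;> rcases b₁ with p' | w <;>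
        simp_all [coneIsApex, coneDistAux, Real.sqrt_sq, NNReal.coe_nonneg]
    · rcases a₁ with p | u <;> rcases a₂ with q | v <;> rcases b₁ with p' | w <;>
        rcases b₂ with q' | w' <;>
        simp_all [coneIsApex, coneDistAux, Real.sqrt_sq, NNReal.coe_nonneg])


-- Borel measurable structure on the boundary and the cone over it.
instance (X : Type*) [MetricSpace X] : MeasurableSpace (Boundary X) := borel _
instance (X : Type*) [MetricSpace X] : BorelSpace (Boundary X) := ⟨rfl⟩
instance (X : Type*) [MetricSpace X] : MeasurableSpace (Cone (Boundary X)) := borel _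
instance (X : Type*) [MetricSpace X] : BorelSpace (Cone (Boundary X)) := ⟨rfl⟩

/-- The Wasserstein metric `W_∞` on measures on the cone over the boundary, built from the
cost `d_∞²`. -/
def Winfty {X : Type*} [MetricSpace X] (m m' : Measure (Cone (Boundary X))) : ℝ :=
  Real.sqrt (⨅ (π : Measure (Cone (Boundary X) × Cone (Boundary X)))
    (_ : IsCoupling π m m'),
      ∫⁻ p, ENNReal.ofReal (coneDist p.1 p.2) ^ 2 ∂π).toReal


/-! ## Visibility -/

/-- `X` is a visibility space: any two distinct boundary points are the two endpoints of a
complete geodesic. -/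
def IsVisibility (X : Type*) [MetricSpace X] : Prop :=
  ∀ α ω : UnitRay X, ¬ AsymptoticMaps dist α.1 ω.1 →
    ∃ g : ℝ → X, (∀ s t : ℝ, dist (g s) (g t) = |s - t|) ∧
      AsymptoticMaps dist (fun t : ℝ≥0 => g (-(t : ℝ))) α.1 ∧
      AsymptoticMaps dist (fun t : ℝ≥0 => g (t : ℝ)) ω.1

/-! ## Curves, length, rectifiability -/

/-- The length of a curve with respect to a distance function `d`, as a supremum over
finite monotone sequences of parameters in `[a,b]`. -/
def curveLengthWith {A : Type*} (d : A → A → ℝ) (c : ℝ → A) (a b : ℝ) : ℝ≥0∞ :=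
  ⨆ (n : ℕ) (t : Fin (n + 1) → ℝ) (_ : Monotone t) (_ : ∀ i, t i ∈ Set.Icc a b),
    ∑ i : Fin n, ENNReal.ofReal (d (c (t i.castSucc)) (c (t i.succ)))

/-- Continuity of a curve with respect to a distance function `d`, on a set of parameters. -/
def ContinuousWithRespect {A : Type*} (d : A → A → ℝ) (c : ℝ → A) (s : Set ℝ) : Prop :=
  ∀ t ∈ s, ∀ ε : ℝ, 0 < ε → ∃ δ : ℝ, 0 < δ ∧ ∀ u ∈ s, |u - t| < δ → d (c u) (c t) < ε

/-- `W_∞` between measures on the boundary, viewed as the level `{speed = 1}` of the cone,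
with cost `d_∞²`. -/
def WinftyLevel1 {X : Type*} [MetricSpace X] (m m' : Measure (Boundary X)) : ℝ :=
  Real.sqrt (⨅ (π : Measure (Boundary X × Boundary X)) (_ : IsCoupling π m m'),
    ∫⁻ p, ENNReal.ofReal (coneDist (coneMk p.1 1) (coneMk p.2 1)) ^ 2 ∂π).toReal

/-! ## Support of a measure -/

/-- The (topological) support of a measure. -/
def msupport {A : Type*} [TopologicalSpace A] [MeasurableSpace A] (μ : Measure A) : Set A :=
  {x | ∀ U : Set A, x ∈ U → IsOpen U → 0 < μ U}

/-! ## Cyclical monotonicity and antagonism -/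

/-- A set `Γ` is `c`-cyclically monotone if no cyclic permutation of the target points of a
finite family of pairs of `Γ` decreases the total cost. -/
def CyclicallyMonotone {A : Type*} (c : A → A → ℝ) (Γ : Set (A × A)) : Prop :=
  ∀ (m : ℕ) (p : Fin (m + 1) → A × A), (∀ i, p i ∈ Γ) →
    (∑ i, c (p i).1 (p i).2) ≤ ∑ i, c (p i).1 (p (i + 1)).2

/-- Two curves are antagonist if they pass through two distinct points in opposite orders. -/
def Antagonist {X : Type*} (γ β : ℝ → X) : Prop :=
  ∃ x y : X, x ≠ y ∧ (∃ s t : ℝ, s < t ∧ γ s = x ∧ γ t = y) ∧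
    (∃ s t : ℝ, s < t ∧ β s = y ∧ β t = x)

/-! ## Negative curvature, trees -/

/-- Three points lying on a common geodesic. -/
def Aligned {X : Type*} [MetricSpace X] (x y z : X) : Prop :=
  dist x y + dist y z = dist x z ∨ dist y x + dist x z = dist y z ∨
    dist x z + dist z y = dist x y

/-- `X` is negatively curved: it is not a line, and the CAT(0) comparison inequality is
strict except for aligned triangles. -/
def IsNegativelyCurved (X : Type*) [MetricSpace X] : Prop :=
  (¬ ∃ f : ℝ → X, Function.Surjective f ∧ ∀ s t : ℝ, dist (f s) (f t) = |s - t|) ∧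
  ∀ (x y z : X) (γ : ℝ → X), γ 0 = y → γ 1 = z →
    IsGeodesicOnWith dist γ (Set.Icc (0:ℝ) 1) (dist y z) → ¬ Aligned x y z →
    ∀ t ∈ Set.Ioo (0:ℝ) 1,
      dist x (γ t) ^ 2 < (1 - t) * dist x y ^ 2 + t * dist x z ^ 2 - t * (1 - t) * dist y z ^ 2

/-- A metric tree (real tree): a geodesic space satisfying the four-point 0-hyperbolicity
condition. -/
def IsRealTree (X : Type*) [MetricSpace X] : Prop :=
  IsGeodesicSpace X ∧ ∀ x y z w : X,
    dist x y + dist z w ≤ max (dist x z + dist y w) (dist x w + dist y z)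

/-! ## Ends of complete geodesics -/

/-- The forward ray of a complete geodesic. -/
def lineForward {X : Type*} [MetricSpace X] (γ : GeoLine X) : RaySpace X :=
  ⟨fun t : ℝ≥0 => γ.1 (t : ℝ), by
    obtain ⟨v, hv0, hv⟩ := γ.2
    exact ⟨v, hv0, fun s t => by rw [hv, NNReal.dist_eq]⟩⟩

/-- The backward ray of a complete geodesic. -/
def lineBackward {X : Type*} [MetricSpace X] (γ : GeoLine X) : RaySpace X :=
  ⟨fun t : ℝ≥0 => γ.1 (-(t : ℝ)), by
    obtain ⟨v, hv0, hv⟩ := γ.2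
    refine ⟨v, hv0, fun s t => ?_⟩
    rw [hv, NNReal.dist_eq]
    congr 1
    rw [abs_sub_comm]
    congr 1
    ring⟩

/-- The end at `+∞` of a complete geodesic, in the cone over the boundary. -/
def lineEndPlus {X : Type*} [MetricSpace X] (γ : GeoLine X) : Cone (Boundary X) :=
  rayEnd (lineForward γ)

/-- The end at `-∞` of a complete geodesic, in the cone over the boundary. -/
def lineEndMinus {X : Type*} [MetricSpace X] (γ : GeoLine X) : Cone (Boundary X) :=
  rayEnd (lineBackward γ)

/-- `g` is a unit complete geodesic with ends `ξ` (at `-∞`) and `ζ` (at `+∞`). -/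
def LineConnects {X : Type*} [MetricSpace X] (g : ℝ → X) (ξ ζ : Boundary X) : Prop :=
  (∀ s t : ℝ, dist (g s) (g t) = |s - t|) ∧
  (∃ γ : UnitRay X, Quotient.mk (unitRaySetoid X) γ = ξ ∧
    AsymptoticMaps dist (fun u : ℝ≥0 => g (-(u : ℝ))) γ.1) ∧
  (∃ γ : UnitRay X, Quotient.mk (unitRaySetoid X) γ = ζ ∧
    AsymptoticMaps dist (fun u : ℝ≥0 => g (u : ℝ)) γ.1)

/-- Two boundary points are antipodal if they are joined by a complete geodesic. -/
def Antipodal {X : Type*} [MetricSpace X] (ξ ζ : Boundary X) : Prop :=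
  ∃ g : ℝ → X, LineConnects g ξ ζ

/-- Two measures on the boundary are antipodal if they are concentrated on antipodal sets. -/
def AntipodalMeasures {X : Type*} [MetricSpace X] (νm νp : Measure (Boundary X)) : Prop :=
  ∃ A B : Set (Boundary X), MeasurableSet A ∧ MeasurableSet B ∧ νm A = 1 ∧ νp B = 1 ∧
    ∀ ξ ∈ A, ∀ ζ ∈ B, Antipodal ξ ζ

/-- Two measures on the boundary are uniformly antipodal if their supports are antipodal. -/
def UniformlyAntipodal {X : Type*} [MetricSpace X] (νm νp : Measure (Boundary X)) : Prop :=
  ∀ ξ ∈ msupport νm, ∀ ζ ∈ msupport νp, Antipodal ξ ζ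

/-- The distance from the base point `x₀` to the geodesic line joining two boundary points
(for trees, the Gromov product). -/
def D0 {X : Type*} [MetricSpace X] (x₀ : X) (ξ ζ : Boundary X) : ℝ :=
  sInf {r : ℝ | ∃ g : ℝ → X, LineConnects g ξ ζ ∧ ∃ t : ℝ, r = dist x₀ (g t)}

/-- The unit geodesic from `ξ` to `ζ`, parametrized so that its time-`0` point is closest to
the base point `x₀`. -/
def lineFrom {X : Type*} [MetricSpace X] (x₀ : X) (ξ ζ : Boundary X) : ℝ → X :=
  haveI : Nonempty X := ⟨x₀⟩
  Classical.epsilon fun g : ℝ → X =>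
    LineConnects g ξ ζ ∧ dist x₀ (g 0) = D0 x₀ ξ ζ

/-! ## Flows on trees -/

/-- The set of boundary points whose rays eventually lie in `C`. -/
def compBdry {X : Type*} [MetricSpace X] (C : Set X) : Set (Boundary X) :=
  {ξ | ∀ γ : UnitRay X, Quotient.mk (unitRaySetoid X) γ = ξ →
    ∃ T : ℝ≥0, ∀ t : ℝ≥0, T ≤ t → γ.1 t ∈ C}

/-- The connected components of the complement of a point. -/
def treeComps {X : Type*} [TopologicalSpace X] (x : X) : Set (Set X) :=
  {C | ∃ y : X, y ≠ x ∧ C = connectedComponentIn {x}ᶜ y}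

/-- A vertex (branch point) of a tree: the complement has at least three components. -/
def IsTreeVertex {X : Type*} [TopologicalSpace X] (x : X) : Prop :=
  ∃ C₁ C₂ C₃ : Set X, C₁ ∈ treeComps x ∧ C₂ ∈ treeComps x ∧ C₃ ∈ treeComps x ∧
    C₁ ≠ C₂ ∧ C₂ ≠ C₃ ∧ C₁ ≠ C₃

/-- The value of the signed measure `ν₊ - ν₋` on a set of boundary points. -/
def sflow {X : Type*} [MetricSpace X] (νm νp : Measure (Boundary X))
    (S : Set (Boundary X)) : ℝ :=
  (νp S).toReal - (νm S).toReal

/-- The boundary directions at `x` carrying positive flow. -/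
def posBdrySet {X : Type*} [MetricSpace X] (νm νp : Measure (Boundary X)) (x : X) :
    Set (Boundary X) :=
  ⋃ (C : Set X) (_ : C ∈ treeComps x) (_ : 0 < sflow νm νp (compBdry C)), compBdry C

/-- The boundary directions at `x` carrying negative flow. -/
def negBdrySet {X : Type*} [MetricSpace X] (νm νp : Measure (Boundary X)) (x : X) :
    Set (Boundary X) :=
  ⋃ (C : Set X) (_ : C ∈ treeComps x) (_ : sflow νm νp (compBdry C) < 0), compBdry C

/-- The flow through the point `x`. -/
def flowAt {X : Type*} [MetricSpace X] (νm νp : Measure (Boundary X)) (x : X) : ℝ :=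
  sflow νm νp (posBdrySet νm νp x)

open Classical in
/-- The specific flow through `x`: the flow through `x`, not counting the edge pointing
towards the base point `x₀` when the latter is positive (resp. negative). -/
def specificFlow {X : Type*} [MetricSpace X] (νm νp : Measure (Boundary X))
    (x₀ x : X) : ℝ :=
  if x = x₀ then flowAt νm νp x
  else if 0 < sflow νm νp (compBdry (connectedComponentIn {x}ᶜ x₀)) then
    sflow νm νp (posBdrySet νm νp x \ compBdry (connectedComponentIn {x}ᶜ x₀))
  else if sflow νm νp (compBdry (connectedComponentIn {x}ᶜ x₀)) < 0 then
    - sflow νm νp (negBdrySet νm νp x \ compBdry (connectedComponentIn {x}ᶜ x₀))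
  else flowAt νm νp x

/-- The pair `(ν₋, ν₊)` is realized as the pair of ends of a complete unit-speed geodesic of
the Wasserstein space, through a displacement interpolation `m`. -/
def RealizableEnds {X : Type*} [MetricSpace X] [MeasurableSpace X]
    (νm νp : Measure (Boundary X)) : Prop :=
  ∃ (μt : ℝ → W2Space X) (m : Measure (GeoLine X)), IsProbabilityMeasure m ∧
    (∀ s t : ℝ, Wdist (μt s) (μt t) = |s - t|) ∧
    (∀ t : ℝ, m.map (fun γ : GeoLine X => γ.1 t) = (μt t).1) ∧
    m.map lineEndMinus = νm.map (fun ξ : Boundary X => coneMk ξ 1) ∧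
    m.map lineEndPlus = νp.map (fun ξ : Boundary X => coneMk ξ 1)

/-- The cost `∫ D₀² dπ` of a transport plan (the optimal transport problem for the cost
`-D₀²` is finite iff the supremum of this quantity over all couplings is finite, and its
minimizers are the maximizers of this quantity). -/
def D0cost {X : Type*} [MetricSpace X] (x₀ : X)
    (π : Measure (Boundary X × Boundary X)) : ℝ≥0∞ :=
  ∫⁻ p, ENNReal.ofReal (D0 x₀ p.1 p.2) ^ 2 ∂π

/-- The supremum of `∫ D₀² dπ` over couplings of `(ν₋, ν₊)`. -/
def D0supCost {X : Type*} [MetricSpace X] (x₀ : X) (νm νp : Measure (Boundary X)) : ℝ≥0∞ :=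
  ⨆ (π : Measure (Boundary X × Boundary X)) (_ : IsCoupling π νm νp), D0cost x₀ π

/-! ## The geodesic boundary of the Wasserstein space -/

/-- The metric topology of the Wasserstein distance. -/
instance (Y : Type*) [MetricSpace Y] [MeasurableSpace Y] : TopologicalSpace (W2Space Y) :=
  TopologicalSpace.generateFrom
    {S | ∃ (μ : W2Space Y) (ε : ℝ), S = {ν : W2Space Y | Wdist μ ν < ε}}

/-- Unit-speed geodesic rays of the Wasserstein space. -/
abbrev W2UnitRay (X : Type*) [MetricSpace X] [MeasurableSpace X] : Type _ :=
  {f : ℝ≥0 → W2Space X // ∀ s t : ℝ≥0, Wdist (f s) (f t) = dist s t}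

/-- Probability measures on the cone over the boundary with `∫ v² dν = 1`, with the weak
topology. -/
abbrev P1Cone (X : Type*) [MetricSpace X] : Type _ :=
  {ν : ProbabilityMeasure (Cone (Boundary X)) //
    ∫⁻ c, (coneSpeed c : ℝ≥0∞) ^ 2 ∂(ν : Measure (Cone (Boundary X))) = 1}

/-- Probability measures (as plain measures) on the cone over the boundary with
`∫ v² dν = 1`. -/
abbrev P1ConeM (X : Type*) [MetricSpace X] : Type _ :=
  {ν : Measure (Cone (Boundary X)) // IsProbabilityMeasure ν ∧
    ∫⁻ c, (coneSpeed c : ℝ≥0∞) ^ 2 ∂ν = 1}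


/-! ## Locally Riemannian points -/

/-- The Riemannian length of a path `γ : [0,1] → ℝⁿ` for the metric tensor `g`. -/
def riemannianPathLength {n : ℕ}
    (g : EuclideanSpace ℝ (Fin n) → EuclideanSpace ℝ (Fin n) →L[ℝ] EuclideanSpace ℝ (Fin n))
    (γ : ℝ → EuclideanSpace ℝ (Fin n)) : ℝ :=
  ∫ t in (0:ℝ)..1, Real.sqrt (@inner ℝ _ _ (g (γ t) (deriv γ t)) (deriv γ t))

/-- The Riemannian distance in `U ⊆ ℝⁿ` for the metric tensor `g`: the infimum of
Riemannian lengths of `C¹` paths in `U` joining the two points. -/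
def riemannianDist {n : ℕ} (U : Set (EuclideanSpace ℝ (Fin n)))
    (g : EuclideanSpace ℝ (Fin n) → EuclideanSpace ℝ (Fin n) →L[ℝ] EuclideanSpace ℝ (Fin n))
    (p q : EuclideanSpace ℝ (Fin n)) : ℝ :=
  sInf {L : ℝ | ∃ γ : ℝ → EuclideanSpace ℝ (Fin n), ContDiffOn ℝ 1 γ (Set.Icc (0:ℝ) 1) ∧
    (∀ t ∈ Set.Icc (0:ℝ) 1, γ t ∈ U) ∧ γ 0 = p ∧ γ 1 = q ∧ L = riemannianPathLength g γ}

/-- `x` admits a neighborhood isometric to an open subset of a Riemannian manifold of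
dimension at least 2 (expressed in a chart: an open subset of `ℝⁿ`, `n ≥ 2`, equipped with
the distance induced by a smooth positive-definite symmetric metric tensor). -/
def IsLocallyRiemannian (X : Type*) [MetricSpace X] (x : X) : Prop :=
  ∃ n : ℕ, 2 ≤ n ∧
  ∃ (U : Set (EuclideanSpace ℝ (Fin n)))
    (g : EuclideanSpace ℝ (Fin n) → EuclideanSpace ℝ (Fin n) →L[ℝ] EuclideanSpace ℝ (Fin n))
    (V : Set X) (φ : X → EuclideanSpace ℝ (Fin n)),
    IsOpen U ∧ ContDiffOn ℝ (⊤ : ℕ∞) g U ∧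
    (∀ p ∈ U, ∀ v w : EuclideanSpace ℝ (Fin n),
      @inner ℝ _ _ (g p v) w = @inner ℝ _ _ v (g p w)) ∧
    (∀ p ∈ U, ∀ v : EuclideanSpace ℝ (Fin n), v ≠ 0 → 0 < @inner ℝ _ _ (g p v) v) ∧
    V ∈ nhds x ∧ Set.BijOn φ V U ∧
    ∀ a ∈ V, ∀ b ∈ V, dist a b = riemannianDist U g (φ a) (φ b)

/-! ## The combinatorial perpendicular Radon transform on a tree -/

/-- `y` and `z` lie in the same connected component of the graph `G` minus the vertex `x`. -/
def sameComp {V : Type*} (G : SimpleGraph V) (x y z : V) : Prop :=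
  ∃ (hy : y ≠ x) (hz : z ≠ x), (G.induce {w : V | w ≠ x}).Reachable ⟨y, hy⟩ ⟨z, hz⟩

/-- The perpendicular `⊥ˣ(ef)` of a flag: the union of `{x}` and of the components of
`G - x` containing none of the vertices of `p` (for a flag, `p = {e, f}` is a pair of
neighbors of `x`). -/
def perpSet {V : Type*} (G : SimpleGraph V) (x : V) (p : Finset V) : Set V :=
  {x} ∪ {y | ∀ e ∈ p, ¬ sameComp G x y e}

/-- The combinatorial perpendicular Radon transform of a summable function `h` on the
vertices, evaluated on a flag `(x, p)`. -/
def perpRadon {V : Type*} (G : SimpleGraph V) (h : V → ℝ) (x : V) (p : Finset V) : ℝ :=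
  ∑' y : perpSet G x p, h y


/-! ## Gromov products and segments in a real tree -/

/-- The Gromov product of `x` and `y` seen from `o`. -/
def gpr {X : Type*} [MetricSpace X] (o x y : X) : ℝ := (dist o x + dist o y - dist x y) / 2

/-- `p` lies on the segment from `o` to `z`. -/
def OnSeg {X : Type*} [MetricSpace X] (o p z : X) : Prop := dist o p + dist p z = dist o z

section Tree

variable {X : Type*} [MetricSpace X]

lemma gpr_comm (o x y : X) : gpr o x y = gpr o y x := by
  unfold gpr; rw [dist_comm x y]; ring

lemma gpr_nonneg (o x y : X) : 0 ≤ gpr o x y := by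
  unfold gpr; linarith [dist_triangle_left x y o]

lemma gpr_le_left (o x y : X) : gpr o x y ≤ dist o x := by
  unfold gpr; linarith [dist_triangle o x y]

lemma gpr_le_right (o x y : X) : gpr o x y ≤ dist o y := by
  rw [gpr_comm]; exact gpr_le_left o y x

lemma dist_eq_gpr (o x y : X) : dist x y = dist o x + dist o y - 2 * gpr o x y := by
  unfold gpr; ring

lemma OnSeg.gpr_eq {o p z : X} (h : OnSeg o p z) : gpr o p z = dist o p := by
  unfold OnSeg at h; unfold gpr; linarith

lemma OnSeg.dist_le {o p z : X} (h : OnSeg o p z) : dist o p ≤ dist o z := by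
  unfold OnSeg at h; linarith [dist_nonneg (x := p) (y := z)]

lemma onSeg_of_dist_le_gpr {o p z : X} (h : dist o p ≤ gpr o p z) : OnSeg o p z := by
  unfold gpr at h; unfold OnSeg; linarith [dist_triangle o p z]

lemma OnSeg.trans {o p q z : X} (h : OnSeg o p q) (h' : OnSeg o q z) : OnSeg o p z := by
  unfold OnSeg at *; linarith [dist_triangle o p z, dist_triangle p q z]

lemma IsRealTree.gpr_ultra (ht : IsRealTree X) (o x y z : X) :
    min (gpr o x y) (gpr o y z) ≤ gpr o x z := by
  have h := ht.2 x z y o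
  unfold gpr
  rw [dist_comm x o, dist_comm z y, dist_comm z o, dist_comm y o] at *
  rcases le_max_iff.1 h with h | h
  · exact (min_le_left _ _).trans (by linarith) |>.trans (le_refl _)
  · exact (min_le_right _ _).trans (by linarith)

lemma IsRealTree.gpr_ge (ht : IsRealTree X) {o x z : X} {r : ℝ} (y : X)
    (h1 : r ≤ gpr o x y) (h2 : r ≤ gpr o y z) : r ≤ gpr o x z :=
  (le_min h1 h2).trans (ht.gpr_ultra o x y z)

lemma IsRealTree.gpr_pos (ht : IsRealTree X) {o x z : X} (y : X)
    (h1 : 0 < gpr o x y) (h2 : 0 < gpr o y z) : 0 < gpr o x z :=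
  (lt_min h1 h2).trans_le (ht.gpr_ultra o x y z)

lemma IsRealTree.exists_onSeg (ht : IsRealTree X) (o z : X) {r : ℝ} (h0 : 0 ≤ r)
    (hr : r ≤ dist o z) : ∃ p, dist o p = r ∧ OnSeg o p z := by
  obtain ⟨γ, h1, h2, h⟩ := ht.1 o z
  rcases eq_or_lt_of_le (dist_nonneg (x := o) (y := z)) with h3 | h3
  · refine ⟨o, by rw [dist_self]; linarith, by simp [OnSeg]⟩
  · have hm : r / dist o z ∈ Icc (0 : ℝ) 1 := ⟨by positivity, by rw [div_le_one h3]; exact hr⟩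
    have e1 := h 0 (by simp) _ hm
    have e2 := h _ hm 1 (by simp)
    rw [h1, zero_sub, abs_neg, abs_of_nonneg hm.1, mul_div_cancel₀ _ h3.ne'] at e1
    rw [h2, abs_sub_comm, abs_of_nonneg (by linarith [hm.2]), mul_sub,
      mul_div_cancel₀ _ h3.ne'] at e2
    refine ⟨γ (r / dist o z), e1, ?_⟩
    unfold OnSeg; linarith

lemma IsRealTree.onSeg_of_dist_le (ht : IsRealTree X) {o p q z : X} (hp : OnSeg o p z)
    (hq : OnSeg o q z) (h : dist o p ≤ dist o q) : OnSeg o p q := by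
  apply onSeg_of_dist_le_gpr
  refine ht.gpr_ge z hp.gpr_eq.ge ?_
  rw [gpr_comm, hq.gpr_eq]; exact h

lemma IsRealTree.eq_of_onSeg (ht : IsRealTree X) {o p q z w : X} (hp : OnSeg o p z)
    (hq : OnSeg o q w) (h : dist o p = dist o q) (hg : dist o p ≤ gpr o z w) : p = q := by
  have : dist o p ≤ gpr o p q := by
    refine ht.gpr_ge z hp.gpr_eq.ge (ht.gpr_ge w hg ?_)
    rw [gpr_comm, hq.gpr_eq, h]
  have := onSeg_of_dist_le_gpr this
  unfold OnSeg at this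
  exact dist_eq_zero.1 (by linarith)

lemma IsRealTree.exists_treePt (ht : IsRealTree X) (o : X) (r : ℝ) (z : X) :
    ∃ p, dist o p = min (max r 0) (dist o z) ∧ OnSeg o p z :=
  ht.exists_onSeg o z (le_min (le_max_right _ _) dist_nonneg) (min_le_right _ _)

/-- The point of the segment from `o` to `z` at distance `r` from `o`, truncated to the ends of
the segment. -/
def treePt (ht : IsRealTree X) (o : X) (r : ℝ) (z : X) : X := (ht.exists_treePt o r z).choose

lemma dist_treePt (ht : IsRealTree X) (o : X) (r : ℝ) (z : X) :
    dist o (treePt ht o r z) = min (max r 0) (dist o z) :=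
  (ht.exists_treePt o r z).choose_spec.1

lemma onSeg_treePt (ht : IsRealTree X) (o : X) (r : ℝ) (z : X) :
    OnSeg o (treePt ht o r z) z :=
  (ht.exists_treePt o r z).choose_spec.2

lemma dist_treePt_of_le (ht : IsRealTree X) {o : X} {r : ℝ} {z : X} (h0 : 0 ≤ r)
    (h : r ≤ dist o z) : dist o (treePt ht o r z) = r := by
  rw [dist_treePt, max_eq_left h0, min_eq_left h]

lemma treePt_eq_of_onSeg (ht : IsRealTree X) {o p z : X} (h : OnSeg o p z) :
    treePt ht o (dist o p) z = p := by
  have e := dist_treePt_of_le ht dist_nonneg h.dist_le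
  refine ht.eq_of_onSeg (onSeg_treePt ht _ _ _) h e ?_
  rw [e]
  unfold gpr
  rw [dist_self]
  linarith [h.dist_le]

lemma treePt_congr (ht : IsRealTree X) {o : X} {r : ℝ} {z w : X} (h0 : 0 ≤ r)
    (h : r ≤ gpr o z w) : treePt ht o r z = treePt ht o r w := by
  have e1 := dist_treePt_of_le ht h0 (h.trans (gpr_le_left _ _ _))
  have e2 := dist_treePt_of_le ht h0 (h.trans (gpr_le_right _ _ _))
  exact ht.eq_of_onSeg (onSeg_treePt ht _ _ _) (onSeg_treePt ht _ _ _) (e1.trans e2.symm)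
    (by rw [e1]; exact h)

lemma dist_treePt_treePt_le (ht : IsRealTree X) (o : X) {r : ℝ} (h0 : 0 ≤ r) (z w : X) :
    dist (treePt ht o r z) (treePt ht o r w) ≤ dist z w := by
  rcases le_or_gt r (gpr o z w) with h | h
  · rw [treePt_congr ht h0 h, dist_self]; exact dist_nonneg
  · have hz := dist_treePt ht o r z
    have hw := dist_treePt ht o r w
    rw [max_eq_left h0] at hz hw
    have sz := onSeg_treePt ht o r z
    have sw := onSeg_treePt ht o r w
    have key : min (min r (dist o z)) (min r (dist o w)) ⊓ gpr o z w
        ≤ gpr o (treePt ht o r z) (treePt ht o r w) := by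
      refine ht.gpr_ge z ?_ (ht.gpr_ge w inf_le_right ?_)
      · rw [sz.gpr_eq, hz]; exact inf_le_left.trans (min_le_left _ _)
      · rw [gpr_comm o w (treePt ht o r w), sw.gpr_eq, hw]
        exact inf_le_left.trans (min_le_right _ _)
    have k1 := gpr_le_left o z w
    have k2 := gpr_le_right o z w
    have k3 : gpr o z w ≤ gpr o (treePt ht o r z) (treePt ht o r w) :=
      le_trans (le_inf (le_min (le_min h.le k1) (le_min h.le k2)) le_rfl) key
    rw [dist_eq_gpr o (treePt ht o r z), dist_eq_gpr o z w, hz, hw]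
    linarith [min_le_right r (dist o z), min_le_right r (dist o w)]

lemma continuous_treePt (ht : IsRealTree X) (o : X) {r : ℝ} (h0 : 0 ≤ r) :
    Continuous (treePt ht o r) :=
  (LipschitzWith.of_dist_le_mul (K := 1)
    (fun z w => by simpa using dist_treePt_treePt_le ht o h0 z w)).continuous

/-! ## Rays from a base point -/

lemma UnitRay.dist_eq (γ : UnitRay X) (s t : ℝ≥0) : dist (γ.1 s) (γ.1 t) = |(s : ℝ) - t| := by
  rw [γ.2, NNReal.dist_eq]

lemma IsRealTree.dist_tail (ht : IsRealTree X) (o : X) (γ : UnitRay X) {t t' : ℝ≥0}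
    (h : dist o (γ.1 0) ≤ t) (htt : t ≤ t') :
    dist o (γ.1 t') = dist o (γ.1 t) + (t' - t) := by
  have htt' : (t : ℝ) ≤ t' := htt
  have e1 : dist (γ.1 t) (γ.1 t') = t' - t := by
    rw [γ.dist_eq, abs_sub_comm, abs_of_nonneg (by linarith)]
  have e2 : dist (γ.1 0) (γ.1 t') = t' := by
    rw [γ.dist_eq]; simp
  have e3 : dist (γ.1 0) (γ.1 t) = t := by
    rw [γ.dist_eq]; simp
  have up := dist_triangle o (γ.1 t) (γ.1 t')
  have f := ht.2 o (γ.1 t) (γ.1 0) (γ.1 t')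
  rw [e2, e1, dist_comm (γ.1 t) (γ.1 0), e3] at f
  rcases le_max_iff.1 f with f | f
  · have := dist_triangle_left (γ.1 t) (γ.1 t') o
    have h0 := dist_nonneg (x := o) (y := γ.1 t)
    linarith
  · linarith

lemma UnitRay.le_dist (o : X) (γ : UnitRay X) (t : ℝ≥0) :
    (t : ℝ) - dist o (γ.1 0) ≤ dist o (γ.1 t) := by
  have := γ.dist_eq 0 t
  have h2 := dist_triangle_left (γ.1 0) (γ.1 t) o
  simp at this
  linarith

lemma UnitRay.dist_le (o : X) (γ : UnitRay X) (t : ℝ≥0) :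
    dist o (γ.1 t) ≤ t + dist o (γ.1 0) := by
  have := γ.dist_eq 0 t
  have h2 := dist_triangle o (γ.1 0) (γ.1 t)
  simp at this
  linarith

lemma IsRealTree.onSeg_tail (ht : IsRealTree X) (o : X) (γ : UnitRay X) {t t' : ℝ≥0}
    (h : dist o (γ.1 0) ≤ t) (htt : t ≤ t') : OnSeg o (γ.1 t) (γ.1 t') := by
  have htt' : (t : ℝ) ≤ t' := htt
  unfold OnSeg
  rw [ht.dist_tail o γ h htt, γ.dist_eq, abs_sub_comm, abs_of_nonneg (by linarith)]

lemma IsRealTree.treePt_tail (ht : IsRealTree X) (o : X) (γ : UnitRay X) {s : ℝ} (hs : 0 ≤ s)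
    {t t' : ℝ≥0} (h : s + dist o (γ.1 0) ≤ t) (h' : s + dist o (γ.1 0) ≤ t') :
    treePt ht o s (γ.1 t) = treePt ht o s (γ.1 t') := by
  wlog htt : t ≤ t' generalizing t t'
  · exact (this h' h (le_of_not_ge htt)).symm
  · apply treePt_congr ht hs
    rw [(ht.onSeg_tail o γ (by linarith) htt).gpr_eq]
    linarith [γ.le_dist o t]

/-- The point at distance `r` of the ray from `o` to the boundary point `ξ`. -/
def bray (ht : IsRealTree X) (o : X) (ξ : Boundary X) (r : ℝ) : X :=
  treePt ht o r (ξ.out.1 (Real.toNNReal (r + dist o (ξ.out.1 0))))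

lemma bray_eq_treePt (ht : IsRealTree X) (o : X) (γ : UnitRay X) {s : ℝ} (hs : 0 ≤ s)
    {t : ℝ≥0} (h : s + dist o (γ.1 0) ≤ t) :
    bray ht o (Quotient.mk (unitRaySetoid X) γ) s = treePt ht o s (γ.1 t) := by
  set β := (Quotient.mk (unitRaySetoid X) γ).out with hβ
  obtain ⟨C, hC⟩ : AsymptoticMaps dist β.1 γ.1 :=
    Quotient.exact (Quotient.out_eq (Quotient.mk (unitRaySetoid X) γ))
  have hC0 : 0 ≤ C := dist_nonneg.trans (hC 0)
  have d1 := dist_nonneg (x := o) (y := γ.1 0)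
  have d2 := dist_nonneg (x := o) (y := β.1 0)
  set u : ℝ≥0 := ⟨s + dist o (γ.1 0) + dist o (β.1 0) + C, by positivity⟩ with hu
  have hu' : (u : ℝ) = s + dist o (γ.1 0) + dist o (β.1 0) + C := rfl
  rw [ht.treePt_tail o γ hs h (t' := u) (by rw [hu']; linarith)]
  change treePt ht o s (β.1 _) = _
  rw [ht.treePt_tail o β hs (t := Real.toNNReal (s + dist o (β.1 0))) (t' := u)
    (by rw [Real.coe_toNNReal _ (by positivity)]) (by rw [hu']; linarith)]
  apply treePt_congr ht hs
  unfold gpr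
  linarith [γ.le_dist o u, β.le_dist o u, hC u]

lemma exists_rep (ξ : Boundary X) : ∃ γ : UnitRay X, Quotient.mk (unitRaySetoid X) γ = ξ :=
  ⟨ξ.out, Quotient.out_eq ξ⟩

lemma dist_bray (ht : IsRealTree X) (o : X) (ξ : Boundary X) {r : ℝ} (hr : 0 ≤ r) :
    dist o (bray ht o ξ r) = r := by
  obtain ⟨γ, rfl⟩ := exists_rep ξ
  set t : ℝ≥0 := ⟨r + dist o (γ.1 0), by positivity⟩ with hdt
  have h' : (t : ℝ) = r + dist o (γ.1 0) := rfl
  rw [bray_eq_treePt ht o γ hr (t := t) le_rfl]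
  exact dist_treePt_of_le ht hr (by linarith [γ.le_dist o t])

lemma bray_zero (ht : IsRealTree X) (o : X) (ξ : Boundary X) : bray ht o ξ 0 = o :=
  (dist_eq_zero.1 (dist_bray ht o ξ le_rfl)).symm

lemma onSeg_bray (ht : IsRealTree X) (o : X) (ξ : Boundary X) {r s : ℝ} (hr : 0 ≤ r)
    (hrs : r ≤ s) : OnSeg o (bray ht o ξ r) (bray ht o ξ s) := by
  obtain ⟨γ, hγ⟩ := exists_rep ξ
  have hs := hr.trans hrs
  have e1 := dist_bray ht o ξ hr
  have e2 := dist_bray ht o ξ hs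
  subst hγ
  set t : ℝ≥0 := ⟨s + dist o (γ.1 0), by positivity⟩ with hdt
  have h' : (t : ℝ) = s + dist o (γ.1 0) := rfl
  rw [bray_eq_treePt ht o γ hr (t := t) (by linarith)] at *
  rw [bray_eq_treePt ht o γ hs (t := t) (by linarith)] at *
  exact ht.onSeg_of_dist_le (onSeg_treePt ht _ _ _) (onSeg_treePt ht _ _ _)
    (by rw [e1, e2]; exact hrs)

lemma dist_bray_bray (ht : IsRealTree X) (o : X) (ξ : Boundary X) {r s : ℝ} (hr : 0 ≤ r)
    (hs : 0 ≤ s) : dist (bray ht o ξ r) (bray ht o ξ s) = |r - s| := by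
  wlog hrs : r ≤ s generalizing r s
  · rw [dist_comm, abs_sub_comm]; exact this hs hr (le_of_not_ge hrs)
  · have := onSeg_bray ht o ξ hr hrs
    unfold OnSeg at this
    rw [dist_bray ht o ξ hr, dist_bray ht o ξ hs] at this
    rw [abs_sub_comm, abs_of_nonneg (by linarith)]; linarith

/-- The unit ray from `o` to the boundary point `ξ`. -/
def baseRay (ht : IsRealTree X) (o : X) (ξ : Boundary X) : UnitRay X :=
  ⟨fun t => bray ht o ξ t, fun s t => by
    change dist (bray ht o ξ s) (bray ht o ξ t) = _
    rw [dist_bray_bray ht o ξ s.coe_nonneg t.coe_nonneg, NNReal.dist_eq]⟩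

lemma eq_bray_tail (ht : IsRealTree X) (o : X) (γ : UnitRay X) {t : ℝ≥0}
    (h : dist o (γ.1 0) ≤ t) :
    γ.1 t = bray ht o (Quotient.mk (unitRaySetoid X) γ) (dist o (γ.1 t)) := by
  set u : ℝ≥0 := ⟨t + (dist o (γ.1 0) + dist o (γ.1 0)), by positivity⟩ with hu
  have hu' : (u : ℝ) = t + (dist o (γ.1 0) + dist o (γ.1 0)) := rfl
  have d0 := dist_nonneg (x := o) (y := γ.1 0)
  have htu : t ≤ u := by rw [← NNReal.coe_le_coe, hu']; linarith
  rw [bray_eq_treePt ht o γ dist_nonneg (t := u) (by linarith [γ.dist_le o t]),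
    treePt_eq_of_onSeg ht (ht.onSeg_tail o γ h htu)]

lemma mk_baseRay (ht : IsRealTree X) (o : X) (ξ : Boundary X) :
    Quotient.mk (unitRaySetoid X) (baseRay ht o ξ) = ξ := by
  obtain ⟨γ, rfl⟩ := exists_rep ξ
  apply Quotient.sound
  refine ⟨dist o (γ.1 0) + (dist o (γ.1 0) + dist o (γ.1 0)), fun t => ?_⟩
  have d0 := dist_nonneg (x := o) (y := γ.1 0)
  change dist (bray ht o _ t) (γ.1 t) ≤ _
  rcases le_or_gt (dist o (γ.1 0)) t with h | h
  · conv_lhs => rw [eq_bray_tail ht o γ h]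
    rw [dist_bray_bray ht o _ t.coe_nonneg dist_nonneg, abs_le]
    constructor <;> linarith [γ.dist_le o t, γ.le_dist o t]
  · have := dist_triangle_left (bray ht o (Quotient.mk (unitRaySetoid X) γ) t) (γ.1 t) o
    rw [dist_bray ht o _ t.coe_nonneg] at this
    linarith [γ.dist_le o t]

lemma boundary_ext (ht : IsRealTree X) (o : X) {ξ ζ : Boundary X}
    (h : ∀ n : ℕ, bray ht o ξ n = bray ht o ζ n) : ξ = ζ := by
  rw [← mk_baseRay ht o ξ, ← mk_baseRay ht o ζ]
  apply Quotient.sound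
  refine ⟨2, fun t => ?_⟩
  change dist (bray ht o ξ t) (bray ht o ζ t) ≤ 2
  have e1 := dist_bray_bray ht o ξ t.coe_nonneg (Nat.cast_nonneg ⌊t⌋₊)
  have e2 := dist_bray_bray ht o ζ t.coe_nonneg (Nat.cast_nonneg ⌊t⌋₊)
  have b : |(t : ℝ) - ⌊t⌋₊| ≤ 1 := by
    have h1 : ((⌊t⌋₊ : ℝ≥0) : ℝ) ≤ t := NNReal.coe_le_coe.2 (Nat.floor_le t.2)
    have h2 : (t : ℝ) < ((⌊t⌋₊ + 1 : ℝ≥0) : ℝ) := NNReal.coe_lt_coe.2 (Nat.lt_floor_add_one t)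
    push_cast at h1 h2
    rw [abs_le]; constructor <;> linarith
  have := dist_triangle_right (bray ht o ξ t) (bray ht o ζ t) (bray ht o ξ ⌊t⌋₊)
  rw [h] at this
  rw [h] at e1
  calc _ ≤ _ := this
    _ ≤ 1 + 1 := add_le_add (e1.le.trans b) (e2.le.trans b)
    _ = 2 := by norm_num

/-! ## Gromov products of boundary points -/

lemma bray_eq_of_le_gpr (ht : IsRealTree X) (o : X) {ξ ζ : Boundary X} {r s t : ℝ} (hr : 0 ≤ r)
    (hs : 0 ≤ s) (hst : 0 ≤ t) (h : r ≤ gpr o (bray ht o ξ s) (bray ht o ζ t)) :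
    bray ht o ξ r = bray ht o ζ r := by
  have h1 := h.trans (gpr_le_left _ _ _)
  have h2 := h.trans (gpr_le_right _ _ _)
  rw [dist_bray _ _ _ hs] at h1
  rw [dist_bray _ _ _ hst] at h2
  refine ht.eq_of_onSeg (onSeg_bray ht o ξ hr h1) (onSeg_bray ht o ζ hr h2) ?_ ?_
  · rw [dist_bray _ _ _ hr, dist_bray _ _ _ hr]
  · rw [dist_bray _ _ _ hr]; exact h

lemma bray_eq_of_le (ht : IsRealTree X) (o : X) {ξ ζ : Boundary X} {r s : ℝ} (hr : 0 ≤ r)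
    (hrs : r ≤ s) (h : bray ht o ξ s = bray ht o ζ s) : bray ht o ξ r = bray ht o ζ r := by
  have hs := hr.trans hrs
  refine bray_eq_of_le_gpr ht o hr hs hs ?_
  rw [h]; unfold gpr; rw [dist_self, dist_bray _ _ _ hs]; linarith

lemma exists_bgp (ht : IsRealTree X) (o : X) {ξ ζ : Boundary X} (h : ξ ≠ ζ) :
    ∃ D : ℝ, 0 ≤ D ∧ ∀ s t, D ≤ s → D ≤ t →
      dist (bray ht o ξ s) (bray ht o ζ t) = s + t - 2 * D := by
  obtain ⟨n, hn⟩ : ∃ n : ℕ, bray ht o ξ n ≠ bray ht o ζ n := by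
    by_contra! h'; exact h (boundary_ext ht o h')
  have n0 : (0 : ℝ) ≤ n := n.cast_nonneg
  set D := gpr o (bray ht o ξ n) (bray ht o ζ n) with hD
  have hD0 : 0 ≤ D := gpr_nonneg _ _ _
  have hagree := bray_eq_of_le_gpr ht o hD0 n0 n0 hD.le
  refine ⟨D, hD0, fun s t hs hst => ?_⟩
  have s0 := hD0.trans hs
  have t0 := hD0.trans hst
  have up := dist_triangle (bray ht o ξ s) (bray ht o ξ D) (bray ht o ζ t)
  have e1 := dist_bray_bray ht o ξ s0 hD0
  have e2 := dist_bray_bray ht o ζ hD0 t0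
  rw [← hagree] at e2
  rw [e1, e2, abs_of_nonneg (by linarith), abs_sub_comm, abs_of_nonneg (by linarith)] at up
  refine le_antisymm (by linarith) ?_
  by_contra! hlt
  have hg : D < gpr o (bray ht o ξ s) (bray ht o ζ t) := by
    unfold gpr; rw [dist_bray _ _ _ s0, dist_bray _ _ _ t0]; linarith
  have hDn : D < n := by
    have : 0 < dist (bray ht o ξ n) (bray ht o ζ n) := dist_pos.2 hn
    rw [hD]; unfold gpr; rw [dist_bray _ _ _ n0, dist_bray _ _ _ n0]; linarith
  set u := min (gpr o (bray ht o ξ s) (bray ht o ζ t)) n with hu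
  have hDu : D < u := lt_min hg hDn
  have hu0 := hD0.trans hDu.le
  have hun : u ≤ n := min_le_right _ _
  have hagu := bray_eq_of_le_gpr ht o hu0 s0 t0 (min_le_left _ _)
  have : u ≤ D := by
    refine ht.gpr_ge (bray ht o ξ u) ?_ ?_
    · rw [gpr_comm, (onSeg_bray ht o ξ hu0 hun).gpr_eq, dist_bray _ _ _ hu0]
    · rw [hagu, (onSeg_bray ht o ζ hu0 hun).gpr_eq, dist_bray _ _ _ hu0]
  linarith

open Classical in
/-- The Gromov product of two distinct boundary points (and `0` on the diagonal). -/
def bgp (ht : IsRealTree X) (o : X) (ξ ζ : Boundary X) : ℝ :=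
  if h : ξ ≠ ζ then (exists_bgp ht o h).choose else 0

lemma bgp_nonneg (ht : IsRealTree X) (o : X) (ξ ζ : Boundary X) : 0 ≤ bgp ht o ξ ζ := by
  unfold bgp; split_ifs with h
  · exact (exists_bgp ht o h).choose_spec.1
  · exact le_rfl

lemma dist_bray_of_bgp_le (ht : IsRealTree X) (o : X) {ξ ζ : Boundary X} (h : ξ ≠ ζ) {s t : ℝ}
    (hs : bgp ht o ξ ζ ≤ s) (hst : bgp ht o ξ ζ ≤ t) :
    dist (bray ht o ξ s) (bray ht o ζ t) = s + t - 2 * bgp ht o ξ ζ := by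
  have e : bgp ht o ξ ζ = (exists_bgp ht o h).choose := by unfold bgp; rw [dif_pos h]
  rw [e] at hs hst ⊢
  exact (exists_bgp ht o h).choose_spec.2 s t hs hst

lemma bray_eq_iff (ht : IsRealTree X) (o : X) {ξ ζ : Boundary X} (h : ξ ≠ ζ) {s : ℝ}
    (hs : 0 ≤ s) : bray ht o ξ s = bray ht o ζ s ↔ s ≤ bgp ht o ξ ζ := by
  have hD := bgp_nonneg ht o ξ ζ
  constructor
  · intro e
    by_contra! hlt
    have := dist_bray_of_bgp_le ht o h hlt.le hlt.le
    rw [e, dist_self] at this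
    linarith
  · intro hle
    have := dist_bray_of_bgp_le ht o h le_rfl le_rfl
    exact bray_eq_of_le ht o hs hle (dist_eq_zero.1 (by linarith))

lemma bgp_comm (ht : IsRealTree X) (o : X) (ξ ζ : Boundary X) :
    bgp ht o ξ ζ = bgp ht o ζ ξ := by
  by_cases h : ξ = ζ
  · rw [h]
  · refine le_antisymm ?_ ?_
    · rw [← bray_eq_iff ht o (Ne.symm h) (bgp_nonneg ..), eq_comm,
        bray_eq_iff ht o h (bgp_nonneg ..)]
    · rw [← bray_eq_iff ht o h (bgp_nonneg ..), eq_comm,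
        bray_eq_iff ht o (Ne.symm h) (bgp_nonneg ..)]

lemma gpr_bray (ht : IsRealTree X) (o : X) {ξ ζ : Boundary X} (h : ξ ≠ ζ) {r : ℝ} (hr : 0 ≤ r) :
    gpr o (bray ht o ξ r) (bray ht o ζ r) = min r (bgp ht o ξ ζ) := by
  unfold gpr
  rw [dist_bray _ _ _ hr, dist_bray _ _ _ hr]
  rcases le_total r (bgp ht o ξ ζ) with h' | h'
  · rw [(bray_eq_iff ht o h hr).2 h', dist_self, min_eq_left h']; ring
  · rw [dist_bray_of_bgp_le ht o h h' h', min_eq_right h']; ring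

end Tree

section TreeLines

variable {X : Type*} [MetricSpace X]

/-! ## Lines of a tree, parametrized from the point closest to the base point -/

lemma exists_eq_bray_tail (ht : IsRealTree X) (o : X) (γ : UnitRay X) :
    ∃ a : ℝ, ∀ t : ℝ≥0, dist o (γ.1 0) ≤ t →
      0 ≤ t + a ∧ γ.1 t = bray ht o (Quotient.mk (unitRaySetoid X) γ) (t + a) := by
  set t₀ : ℝ≥0 := ⟨dist o (γ.1 0), dist_nonneg⟩ with h0
  have h0' : (t₀ : ℝ) = dist o (γ.1 0) := rfl
  refine ⟨dist o (γ.1 t₀) - t₀, fun t h => ?_⟩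
  have e : (t : ℝ) + (dist o (γ.1 t₀) - t₀) = dist o (γ.1 t) := by
    have htt : t₀ ≤ t := by rw [← NNReal.coe_le_coe]; exact h
    rw [ht.dist_tail o γ h0'.ge htt]; ring
  rw [e]
  exact ⟨dist_nonneg, eq_bray_tail ht o γ h⟩

/-- The line from `ξ` to `ζ`, parametrized so that it is closest to `o` at time `0`. -/
def bline (ht : IsRealTree X) (o : X) (ξ ζ : Boundary X) (t : ℝ) : X :=
  if 0 ≤ t then bray ht o ζ (bgp ht o ξ ζ + t) else bray ht o ξ (bgp ht o ξ ζ - t)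

lemma bline_of_nonneg (ht : IsRealTree X) (o : X) (ξ ζ : Boundary X) {t : ℝ} (h : 0 ≤ t) :
    bline ht o ξ ζ t = bray ht o ζ (bgp ht o ξ ζ + t) := if_pos h

lemma bray_bgp_eq (ht : IsRealTree X) (o : X) (ξ ζ : Boundary X) :
    bray ht o ξ (bgp ht o ξ ζ) = bray ht o ζ (bgp ht o ξ ζ) := by
  by_cases h : ξ = ζ
  · rw [h]
  · exact (bray_eq_iff ht o h (bgp_nonneg ..)).2 le_rfl

lemma bline_of_nonpos (ht : IsRealTree X) (o : X) (ξ ζ : Boundary X) {t : ℝ} (h : t ≤ 0) :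
    bline ht o ξ ζ t = bray ht o ξ (bgp ht o ξ ζ - t) := by
  rcases h.eq_or_lt with rfl | h
  · rw [bline_of_nonneg ht o ξ ζ le_rfl, sub_zero, add_zero, bray_bgp_eq]
  · exact if_neg (not_le.2 h)

lemma dist_bline (ht : IsRealTree X) (o : X) (ξ ζ : Boundary X) (t : ℝ) :
    dist o (bline ht o ξ ζ t) = bgp ht o ξ ζ + |t| := by
  have hD := bgp_nonneg ht o ξ ζ
  rcases le_total 0 t with h | h
  · rw [bline_of_nonneg ht o ξ ζ h, dist_bray ht o ζ (by linarith), abs_of_nonneg h]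
  · rw [bline_of_nonpos ht o ξ ζ h, dist_bray ht o ξ (by linarith), abs_of_nonpos h]; ring

lemma dist_bline_bline (ht : IsRealTree X) (o : X) {ξ ζ : Boundary X} (hne : ξ ≠ ζ) (s t : ℝ) :
    dist (bline ht o ξ ζ s) (bline ht o ξ ζ t) = |s - t| := by
  have hD := bgp_nonneg ht o ξ ζ
  wlog hst : s ≤ t generalizing s t
  · rw [dist_comm, abs_sub_comm]; exact this t s (le_of_not_ge hst)
  rcases le_total 0 s with h | h
  · rw [bline_of_nonneg ht o ξ ζ h, bline_of_nonneg ht o ξ ζ (h.trans hst),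
      dist_bray_bray ht o ζ (by linarith) (by linarith)]
    congr 1; ring
  · rcases le_total 0 t with h' | h'
    · rw [bline_of_nonpos ht o ξ ζ h, bline_of_nonneg ht o ξ ζ h',
        dist_bray_of_bgp_le ht o hne (by linarith) (by linarith), abs_of_nonpos (by linarith)]
      ring
    · rw [bline_of_nonpos ht o ξ ζ h, bline_of_nonpos ht o ξ ζ h',
        dist_bray_bray ht o ξ (by linarith) (by linarith), abs_sub_comm]
      congr 1; ring

lemma lineConnects_bline (ht : IsRealTree X) (o : X) {ξ ζ : Boundary X} (hne : ξ ≠ ζ) :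
    LineConnects (bline ht o ξ ζ) ξ ζ := by
  have hD := bgp_nonneg ht o ξ ζ
  refine ⟨dist_bline_bline ht o hne, ⟨baseRay ht o ξ, mk_baseRay ht o ξ, bgp ht o ξ ζ, fun t => ?_⟩,
    ⟨baseRay ht o ζ, mk_baseRay ht o ζ, bgp ht o ξ ζ, fun t => ?_⟩⟩
  · change dist (bline ht o ξ ζ (-t)) (bray ht o ξ t) ≤ _
    have := t.coe_nonneg
    rw [bline_of_nonpos ht o ξ ζ (by linarith), dist_bray_bray ht o ξ (by linarith) this]
    rw [abs_of_nonneg (by linarith)]; linarith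
  · change dist (bline ht o ξ ζ t) (bray ht o ζ t) ≤ _
    have := t.coe_nonneg
    rw [bline_of_nonneg ht o ξ ζ (by linarith), dist_bray_bray ht o ζ (by linarith) this]
    rw [abs_of_nonneg (by linarith)]; linarith

/-- The forward ray of a unit speed line. -/
def fwdRay (g : UnitLine X) : UnitRay X :=
  ⟨fun t => g.1 t, fun s t => by rw [g.2, NNReal.dist_eq]⟩

/-- The backward ray of a unit speed line. -/
def bwdRay (g : UnitLine X) : UnitRay X :=
  ⟨fun t => g.1 (-t), fun s t => by rw [g.2, NNReal.dist_eq, abs_sub_comm]; congr 1; ring⟩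

lemma LineConnects.mk_fwdRay {g : UnitLine X} {ξ ζ : Boundary X} (h : LineConnects g.1 ξ ζ) :
    Quotient.mk (unitRaySetoid X) (fwdRay g) = ζ := by
  obtain ⟨-, -, γ, rfl, hγ⟩ := h
  exact Quotient.sound hγ

lemma LineConnects.mk_bwdRay {g : UnitLine X} {ξ ζ : Boundary X} (h : LineConnects g.1 ξ ζ) :
    Quotient.mk (unitRaySetoid X) (bwdRay g) = ξ := by
  obtain ⟨-, ⟨γ, rfl, hγ⟩, -⟩ := h
  exact Quotient.sound hγ

lemma lineConnects_unitLine (g : UnitLine X) :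
    LineConnects g.1 (Quotient.mk (unitRaySetoid X) (bwdRay g))
      (Quotient.mk (unitRaySetoid X) (fwdRay g)) :=
  ⟨g.2, ⟨_, rfl, 0, fun t => by simp [bwdRay]⟩, ⟨_, rfl, 0, fun t => by simp [fwdRay]⟩⟩

lemma LineConnects.eq_bline (ht : IsRealTree X) (o : X) {g : ℝ → X} {ξ ζ : Boundary X}
    (h : LineConnects g ξ ζ) :
    ξ ≠ ζ ∧ ∃ t₀ : ℝ, ∀ t, g t = bline ht o ξ ζ (t - t₀) := by
  set l : UnitLine X := ⟨g, h.1⟩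
  have hl : LineConnects l.1 ξ ζ := h
  obtain ⟨a, ha⟩ := exists_eq_bray_tail ht o (fwdRay l)
  obtain ⟨b, hb⟩ := exists_eq_bray_tail ht o (bwdRay l)
  rw [hl.mk_fwdRay] at ha
  rw [hl.mk_bwdRay] at hb
  have d0 := dist_nonneg (x := o) (y := g 0)
  have ha' : ∀ t : ℝ, dist o (g 0) ≤ t → 0 ≤ t + a ∧ g t = bray ht o ζ (t + a) := fun t htt =>
    ha ⟨t, d0.trans htt⟩ (by change dist o (g ((0 : ℝ≥0) : ℝ)) ≤ t; rwa [NNReal.coe_zero])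
  have hb' : ∀ t : ℝ, dist o (g 0) ≤ t → 0 ≤ t + b ∧ g (-t) = bray ht o ξ (t + b) := fun t htt =>
    hb ⟨t, d0.trans htt⟩
      (by change dist o (g (-((0 : ℝ≥0) : ℝ))) ≤ t; rwa [NNReal.coe_zero, neg_zero])
  have hne : ξ ≠ ζ := by
    rintro rfl
    set t := dist o (g 0) + |a - b| + 1 with hdt
    have hab := abs_nonneg (a - b)
    have e := h.1 (-t) t
    obtain ⟨h1, e1⟩ := ha' t (by linarith)
    obtain ⟨h2, e2⟩ := hb' t (by linarith)
    rw [e1, e2, dist_bray_bray ht o _ h2 h1, abs_of_neg (by linarith : -t - t < 0)] at e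
    have : |t + b - (t + a)| = |a - b| := by rw [← abs_neg]; congr 1; ring
    rw [this] at e; linarith
  refine ⟨hne, ?_⟩
  set D := bgp ht o ξ ζ with hD
  have hD0 : 0 ≤ D := bgp_nonneg ht o ξ ζ
  have hab : a + b = 2 * D := by
    set t := dist o (g 0) + |a| + |b| + D with hdt
    have h1 := neg_abs_le a
    have h2 := neg_abs_le b
    have e := h.1 (-t) t
    rw [(ha' t (by linarith [abs_nonneg a, abs_nonneg b])).2,
      (hb' t (by linarith [abs_nonneg a, abs_nonneg b])).2,
      dist_bray_of_bgp_le ht o hne (by linarith [abs_nonneg a]) (by linarith [abs_nonneg b]),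
      abs_of_nonpos (by linarith [abs_nonneg a, abs_nonneg b])] at e
    linarith
  refine ⟨D - a, fun t => ?_⟩
  set M := dist o (g 0) + |t| + |D - a| with hM
  have hM1 : D - a ≤ M := by linarith [le_abs_self (D - a), abs_nonneg t]
  have hM2 : a - D ≤ M := by linarith [neg_abs_le (D - a), abs_nonneg t]
  have hM3 : dist o (g 0) ≤ M := by linarith [abs_nonneg (D - a), abs_nonneg t]
  have hM4 : |t| ≤ M := by linarith [abs_nonneg (D - a)]
  have ep : g M = bline ht o ξ ζ (M - (D - a)) := by
    rw [bline_of_nonneg ht o ξ ζ (by linarith), (ha' M hM3).2]; congr 1; ring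
  have em : g (-M) = bline ht o ξ ζ (-M - (D - a)) := by
    rw [bline_of_nonpos ht o ξ ζ (by linarith), (hb' M hM3).2]; congr 1; linarith
  obtain ⟨t1, t2⟩ := abs_le.1 hM4
  have f1 : dist (g (-M)) (g t) = t + M := by rw [h.1, abs_of_nonpos (by linarith)]; ring
  have f2 : dist (g t) (g M) = M - t := by rw [h.1, abs_of_nonpos (by linarith)]; ring
  have f3 : dist (g (-M)) (g M) = 2 * M := by rw [h.1, abs_of_nonpos (by linarith)]; ring
  have f4 : dist (g (-M)) (bline ht o ξ ζ (t - (D - a))) = t + M := by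
    rw [em, dist_bline_bline ht o hne, abs_of_nonpos (by linarith)]; ring
  have f5 : dist (bline ht o ξ ζ (t - (D - a))) (g M) = M - t := by
    rw [ep, dist_bline_bline ht o hne, abs_of_nonpos (by linarith)]; ring
  refine ht.eq_of_onSeg (o := g (-M)) (z := g M) (w := g M) ?_ ?_ (f1.trans f4.symm) ?_
  · unfold OnSeg; rw [f1, f2, f3]; ring
  · unfold OnSeg; rw [f4, f5, f3]; ring
  · unfold gpr; rw [dist_self, f1, f3]; linarith

lemma antipodal_iff (ht : IsRealTree X) (o : X) (ξ ζ : Boundary X) : Antipodal ξ ζ ↔ ξ ≠ ζ :=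
  ⟨fun ⟨_, h⟩ => (h.eq_bline ht o).1, fun h => ⟨_, lineConnects_bline ht o h⟩⟩

lemma D0_eq_bgp (ht : IsRealTree X) (o : X) (ξ ζ : Boundary X) : D0 o ξ ζ = bgp ht o ξ ζ := by
  unfold D0
  by_cases h : ξ = ζ
  · have e1 : bgp ht o ξ ζ = 0 := by unfold bgp; rw [dif_neg (not_not.2 h)]
    rw [e1]
    convert Real.sInf_empty
    rw [eq_empty_iff_forall_notMem]
    rintro r ⟨g, hg, -⟩
    exact (hg.eq_bline ht o).1 h
  · refine IsLeast.csInf_eq ⟨⟨_, lineConnects_bline ht o h, 0, ?_⟩, ?_⟩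
    · rw [dist_bline]; simp
    · rintro r ⟨g, hg, t, rfl⟩
      obtain ⟨-, t₀, e⟩ := hg.eq_bline ht o
      rw [e, dist_bline]
      linarith [abs_nonneg (t - t₀)]

lemma bgp_le_dist_of_lineConnects (ht : IsRealTree X) (o : X) {g : ℝ → X} {ξ ζ : Boundary X}
    (h : LineConnects g ξ ζ) (t : ℝ) : bgp ht o ξ ζ ≤ dist o (g t) := by
  obtain ⟨-, t₀, e⟩ := h.eq_bline ht o
  rw [e, dist_bline]
  linarith [abs_nonneg (t - t₀)]

lemma lineFrom_eq_bline (ht : IsRealTree X) (o : X) {ξ ζ : Boundary X} (h : ξ ≠ ζ) :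
    lineFrom o ξ ζ = bline ht o ξ ζ := by
  have : Nonempty X := ⟨o⟩
  have key : LineConnects (lineFrom o ξ ζ) ξ ζ ∧ dist o (lineFrom o ξ ζ 0) = D0 o ξ ζ := by
    unfold lineFrom
    exact Classical.epsilon_spec (p := fun g : ℝ → X => LineConnects g ξ ζ ∧
      dist o (g 0) = D0 o ξ ζ) ⟨bline ht o ξ ζ, lineConnects_bline ht o h, by
        rw [dist_bline, D0_eq_bgp ht]; simp⟩
  obtain ⟨-, t₀, e⟩ := key.1.eq_bline ht o
  have h0 := key.2
  rw [e, dist_bline, D0_eq_bgp ht, zero_sub, abs_neg, add_eq_left, abs_eq_zero] at h0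
  subst h0
  funext t
  rw [e, sub_zero]

end TreeLines

section TreeTopology

variable {X : Type*} [MetricSpace X]

/-! ## Closed balls are compact -/

lemma IsRealTree.dist_treePt_self (ht : IsRealTree X) (o : X) {r : ℝ} (hr : 0 ≤ r) (z : X) :
    dist z (treePt ht o r z) ≤ max 0 (dist o z - r) := by
  have h := onSeg_treePt ht o r z
  unfold OnSeg at h
  rw [dist_treePt, max_eq_left hr] at h
  rw [dist_comm]
  rcases le_total r (dist o z) with h' | h'
  · rw [min_eq_left h'] at h
    exact le_max_of_le_right (by linarith)
  · rw [min_eq_right h'] at h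
    exact le_max_of_le_left (by linarith)

lemma IsRealTree.closedBall_subset_cthickening (ht : IsRealTree X) (o : X) {r δ : ℝ} (hr : 0 ≤ r)
    (hδ : 0 ≤ δ) :
    Metric.closedBall o (r + δ) ⊆ Metric.cthickening δ (Metric.closedBall o r) := by
  intro z hz
  rw [Metric.mem_closedBall, dist_comm] at hz
  refine Metric.mem_cthickening_of_dist_le z (treePt ht o r z) δ _ ?_ ?_
  · rw [Metric.mem_closedBall, dist_comm, dist_treePt, max_eq_left hr]
    exact min_le_left _ _
  · exact (ht.dist_treePt_self o hr z).trans (max_le hδ (by linarith))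

lemma IsRealTree.isCompact_closedBall_of_lt [CompleteSpace X] (ht : IsRealTree X) (o : X) {R : ℝ}
    (hR : 0 < R) (h : ∀ r, 0 ≤ r → r < R → IsCompact (Metric.closedBall o r)) :
    IsCompact (Metric.closedBall o R) := by
  refine TotallyBounded.isCompact_of_isClosed ?_ Metric.isClosed_closedBall
  rw [Metric.totallyBounded_iff]
  intro ε hε
  set r := max 0 (R - ε / 4) with hr
  have hr0 : 0 ≤ r := le_max_left _ _
  have hrR : r < R := max_lt hR (by linarith)
  obtain ⟨t, htf, hcov⟩ :=
    Metric.totallyBounded_iff.1 (h r hr0 hrR).totallyBounded (ε / 2) (by linarith)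
  refine ⟨t, htf, fun z hz => ?_⟩
  rw [Metric.mem_closedBall, dist_comm] at hz
  have h1 : treePt ht o r z ∈ Metric.closedBall o r := by
    rw [Metric.mem_closedBall, dist_comm, dist_treePt, max_eq_left hr0]
    exact min_le_left _ _
  have h2 := ht.dist_treePt_self o hr0 z
  obtain ⟨y, hy, hy'⟩ := mem_iUnion₂.1 (hcov h1)
  refine mem_iUnion₂.2 ⟨y, hy, ?_⟩
  rw [Metric.mem_ball] at hy' ⊢
  have h3 : max 0 (dist o z - r) ≤ ε / 4 :=
    max_le (by linarith) (by linarith [le_max_right 0 (R - ε / 4)])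
  linarith [dist_triangle z (treePt ht o r z) y]

lemma IsRealTree.properSpace [CompleteSpace X] [LocallyCompactSpace X] (ht : IsRealTree X)
    (o : X) : ProperSpace X := by
  have key : ∀ r, 0 ≤ r → IsCompact (Metric.closedBall o r) := by
    by_contra! hbad
    set S : Set ℝ := {r | 0 ≤ r ∧ ¬ IsCompact (Metric.closedBall o r)} with hS
    have hne : S.Nonempty := hbad
    have hbdd : BddBelow S := ⟨0, fun r hr => hr.1⟩
    set R := sInf S with hR
    have hR0 : 0 ≤ R := le_csInf hne fun r hr => hr.1
    have hlt : ∀ r, 0 ≤ r → r < R → IsCompact (Metric.closedBall o r) := by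
      intro r h0 hr
      by_contra hc
      exact absurd (csInf_le hbdd (show r ∈ S from ⟨h0, hc⟩)) (not_le.2 hr)
    have hRc : IsCompact (Metric.closedBall o R) := by
      rcases hR0.eq_or_lt with h | h
      · rw [← h, Metric.closedBall_zero]; exact isCompact_singleton
      · exact ht.isCompact_closedBall_of_lt o h hlt
    obtain ⟨K, hK, hsub⟩ := exists_compact_superset hRc
    obtain ⟨δ, hδ, hδ'⟩ := hRc.exists_cthickening_subset_open isOpen_interior hsub
    have hc : IsCompact (Metric.closedBall o (R + δ)) :=
      hK.of_isClosed_subset Metric.isClosed_closedBall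
        ((ht.closedBall_subset_cthickening o hR0 hδ.le).trans (hδ'.trans interior_subset))
    have : R + δ ≤ R := by
      refine le_csInf hne fun r hr => ?_
      by_contra! hlt'
      exact hr.2 (hc.of_isClosed_subset Metric.isClosed_closedBall
        (Metric.closedBall_subset_closedBall hlt'.le))
    linarith
  exact .of_isCompact_closedBall_of_le 0 fun x r hr =>
    (key (dist x o + r) (by positivity)).of_isClosed_subset Metric.isClosed_closedBall
      (Metric.closedBall_subset_closedBall' (by linarith))

/-! ## The topology of the boundary -/

lemma continuous_bray (ht : IsRealTree X) (o : X) {s : ℝ} (hs : 0 ≤ s) :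
    Continuous fun ξ => bray ht o ξ s := by
  refine isQuotientMap_quotient_mk'.continuous_iff.2 (continuous_iff_continuousAt.2 fun γ₀ => ?_)
  set t : ℝ≥0 := ⟨s + (dist o (γ₀.1 0) + 1), by positivity⟩ with hdt
  have hcont : ∀ u : ℝ≥0, Continuous fun γ : UnitRay X => γ.1 u := fun u =>
    (continuous_apply u).comp continuous_subtype_val
  have hev : ∀ᶠ γ : UnitRay X in 𝓝 γ₀, dist o (γ.1 0) < dist o (γ₀.1 0) + 1 :=
    ((continuous_const.dist (hcont 0)).tendsto γ₀).eventually_lt_const (by linarith)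
  refine (((continuous_treePt ht o hs).comp (hcont t)).continuousAt (x := γ₀)).congr ?_
  filter_upwards [hev] with γ hγ
  refine (bray_eq_treePt ht o γ hs ?_).symm
  change _ ≤ s + (dist o (γ₀.1 0) + 1)
  linarith

lemma compactSpace_boundary [CompleteSpace X] [LocallyCompactSpace X] (ht : IsRealTree X)
    (o : X) : CompactSpace (Boundary X) := by
  have := ht.properSpace o
  set K : Set (UnitRay X) := {γ | γ.1 0 = o} with hK
  have hKc : IsCompact K := by
    rw [Subtype.isCompact_iff]
    have hcpt : IsCompact (Set.pi univ fun t : ℝ≥0 => Metric.closedBall o (t : ℝ)) :=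
      isCompact_univ_pi fun t => isCompact_closedBall _ _
    refine hcpt.of_isClosed_subset ?_ ?_
    · have : Subtype.val '' K = {γ : ℝ≥0 → X | γ 0 = o} ∩
          ⋂ (s : ℝ≥0) (t : ℝ≥0), {γ : ℝ≥0 → X | dist (γ s) (γ t) = dist s t} := by
        ext γ
        constructor
        · rintro ⟨γ', h, rfl⟩
          exact ⟨h, mem_iInter₂.2 fun s t => γ'.2 s t⟩
        · rintro ⟨h, h'⟩
          exact ⟨⟨γ, fun s t => mem_iInter₂.1 h' s t⟩, h, rfl⟩
      rw [this]
      refine (isClosed_eq (continuous_apply _) continuous_const).inter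
        (isClosed_iInter fun s => isClosed_iInter fun t => ?_)
      exact isClosed_eq ((continuous_apply s).dist (continuous_apply t)) continuous_const
    · rintro _ ⟨γ, h, rfl⟩ t -
      have h0 : γ.1 0 = o := h
      rw [Metric.mem_closedBall, ← h0, UnitRay.dist_eq γ]
      simp
  refine ⟨?_⟩
  have hu : Quotient.mk (unitRaySetoid X) '' K = univ :=
    eq_univ_of_forall fun ξ => ⟨baseRay ht o ξ, bray_zero ht o ξ, mk_baseRay ht o ξ⟩
  rw [← hu]
  exact hKc.image continuous_quotient_mk'

/-- The shadow of `y` seen from `o`: the endpoints of the rays from `o` through `y`. -/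
def shadow (ht : IsRealTree X) (o y : X) : Set (Boundary X) := {ξ | bray ht o ξ (dist o y) = y}

lemma mem_shadow_bray (ht : IsRealTree X) (o : X) {ξ ζ : Boundary X} {r : ℝ} (hr : 0 ≤ r) :
    ζ ∈ shadow ht o (bray ht o ξ r) ↔ bray ht o ζ r = bray ht o ξ r := by
  unfold shadow
  rw [mem_ofPred_eq, dist_bray _ _ _ hr]

lemma isOpen_shadow (ht : IsRealTree X) (o y : X) : IsOpen (shadow ht o y) := by
  rw [isOpen_iff_mem_nhds]
  intro ξ hξ
  set r := dist o y with hr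
  have hr0 : 0 ≤ r := dist_nonneg
  have hev : ∀ᶠ ζ in 𝓝 ξ, dist (bray ht o ζ (r + 1)) (bray ht o ξ (r + 1)) < 2 :=
    (((continuous_bray ht o (by positivity)).dist continuous_const).tendsto ξ).eventually_lt_const
      (by simp)
  filter_upwards [hev] with ζ hζ
  refine (bray_eq_of_le_gpr ht o hr0 (s := r + 1) (t := r + 1) (by positivity) (by positivity)
    ?_).trans (show bray ht o ξ r = y from hξ)
  unfold gpr
  rw [dist_bray _ _ _ (by positivity), dist_bray _ _ _ (by positivity)]
  linarith

lemma isClosed_shadow (ht : IsRealTree X) (o y : X) : IsClosed (shadow ht o y) :=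
  isClosed_eq (continuous_bray ht o dist_nonneg) continuous_const

lemma measurableSet_shadow (ht : IsRealTree X) (o y : X) : MeasurableSet (shadow ht o y) :=
  (isOpen_shadow ht o y).measurableSet

lemma t2Space_boundary (ht : IsRealTree X) (o : X) : T2Space (Boundary X) := by
  refine ⟨fun ξ ζ hne => ?_⟩
  obtain ⟨n, hn⟩ : ∃ n : ℕ, bray ht o ξ n ≠ bray ht o ζ n := by
    by_contra! h
    exact hne (boundary_ext ht o h)
  have hn0 : (0 : ℝ) ≤ n := n.cast_nonneg
  refine ⟨shadow ht o (bray ht o ξ n), (shadow ht o (bray ht o ξ n))ᶜ, isOpen_shadow ..,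
    (isClosed_shadow ..).isOpen_compl, (mem_shadow_bray ht o hn0).2 rfl, ?_, disjoint_compl_right⟩
  rw [mem_compl_iff, mem_shadow_bray ht o hn0]
  exact Ne.symm hn

lemma finite_range_bray [CompactSpace (Boundary X)] (ht : IsRealTree X) (o : X) {r : ℝ}
    (hr : 0 ≤ r) : (range fun ξ => bray ht o ξ r).Finite := by
  refine IsLocallyConstant.range_finite ((IsLocallyConstant.iff_exists_open _).2 fun ξ => ?_)
  exact ⟨shadow ht o (bray ht o ξ r), isOpen_shadow .., (mem_shadow_bray ht o hr).2 rfl,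
    fun ζ hζ => (mem_shadow_bray ht o hr).1 hζ⟩

lemma isTopologicalBasis_shadow [CompactSpace (Boundary X)] (ht : IsRealTree X) (o : X) :
    TopologicalSpace.IsTopologicalBasis
      (⋃ n : ℕ, shadow ht o '' range fun ξ => bray ht o ξ (n : ℝ)) := by
  refine TopologicalSpace.isTopologicalBasis_of_isOpen_of_nhds ?_ ?_
  · intro u hu
    obtain ⟨n, y, -, rfl⟩ := mem_iUnion.1 hu
    exact isOpen_shadow ..
  · intro ξ u hξ hu
    have hanti : Antitone fun n : ℕ => shadow ht o (bray ht o ξ (n : ℝ)) := by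
      intro m n hmn ζ hζ
      have hm : (0 : ℝ) ≤ m := m.cast_nonneg
      rw [mem_shadow_bray ht o n.cast_nonneg] at hζ
      rw [mem_shadow_bray ht o hm]
      exact bray_eq_of_le ht o hm (Nat.cast_le.2 hmn) hζ
    obtain ⟨n, hn⟩ := exists_subset_nhds_of_isCompact' (hanti.directed_ge)
      (fun n => (isClosed_shadow ht o (bray ht o ξ (n : ℝ))).isCompact)
      (fun n => isClosed_shadow ht o (bray ht o ξ (n : ℝ))) (U := u) (fun ζ hζ => by
        have : ζ = ξ := boundary_ext ht o fun n =>
          (mem_shadow_bray ht o n.cast_nonneg).1 (mem_iInter.1 hζ n)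
        rw [this]; exact hu.mem_nhds hξ)
    exact ⟨_, mem_iUnion.2 ⟨n, _, ⟨ξ, rfl⟩, rfl⟩, (mem_shadow_bray ht o n.cast_nonneg).2 rfl, hn⟩

lemma countable_shadow_basis [CompactSpace (Boundary X)] (ht : IsRealTree X) (o : X) :
    (⋃ n : ℕ, shadow ht o '' range fun ξ => bray ht o ξ (n : ℝ)).Countable :=
  countable_iUnion fun n => ((finite_range_bray ht o n.cast_nonneg).image _).countable

lemma secondCountable_boundary [CompactSpace (Boundary X)] (ht : IsRealTree X) (o : X) :
    SecondCountableTopology (Boundary X) :=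
  (isTopologicalBasis_shadow ht o).secondCountableTopology (countable_shadow_basis ht o)

lemma borel_boundary_eq_generateFrom [CompactSpace (Boundary X)] (ht : IsRealTree X) (o : X) :
    (inferInstance : MeasurableSpace (Boundary X)) = MeasurableSpace.generateFrom
      (⋃ n : ℕ, shadow ht o '' range fun ξ => bray ht o ξ (n : ℝ)) := by
  have := secondCountable_boundary ht o
  rw [← (isTopologicalBasis_shadow ht o).borel_eq_generateFrom]
  exact BorelSpace.measurable_eq

/-! ## An ultrametric cost on the boundary -/

open Classical in
/-- The ultrametric distance on the boundary seen from `o`. -/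
def bcost (ht : IsRealTree X) (o : X) (ξ ζ : Boundary X) : ℝ :=
  if ξ = ζ then 0 else Real.exp (-bgp ht o ξ ζ)

lemma bcost_self (ht : IsRealTree X) (o : X) (ξ : Boundary X) : bcost ht o ξ ξ = 0 := if_pos rfl

lemma bcost_of_ne (ht : IsRealTree X) (o : X) {ξ ζ : Boundary X} (h : ξ ≠ ζ) :
    bcost ht o ξ ζ = Real.exp (-bgp ht o ξ ζ) := if_neg h

lemma bcost_pos (ht : IsRealTree X) (o : X) {ξ ζ : Boundary X} (h : ξ ≠ ζ) :
    0 < bcost ht o ξ ζ := by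
  rw [bcost_of_ne ht o h]; exact Real.exp_pos _

lemma bcost_nonneg (ht : IsRealTree X) (o : X) (ξ ζ : Boundary X) : 0 ≤ bcost ht o ξ ζ := by
  by_cases h : ξ = ζ
  · rw [h, bcost_self]
  · exact (bcost_pos ht o h).le

lemma bcost_comm (ht : IsRealTree X) (o : X) (ξ ζ : Boundary X) :
    bcost ht o ξ ζ = bcost ht o ζ ξ := by
  by_cases h : ξ = ζ
  · rw [h]
  · rw [bcost_of_ne ht o h, bcost_of_ne ht o (Ne.symm h), bgp_comm]

lemma bcost_le_iff (ht : IsRealTree X) (o : X) {ξ ζ : Boundary X} {r : ℝ} (hr : 0 ≤ r) :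
    bcost ht o ξ ζ ≤ Real.exp (-r) ↔ bray ht o ξ r = bray ht o ζ r := by
  by_cases h : ξ = ζ
  · rw [h, bcost_self]; simp [Real.exp_nonneg]
  · rw [bcost_of_ne ht o h, Real.exp_le_exp, neg_le_neg_iff, bray_eq_iff ht o h hr]

lemma bgp_eq_neg_log (ht : IsRealTree X) (o : X) (ξ ζ : Boundary X) :
    bgp ht o ξ ζ = -Real.log (bcost ht o ξ ζ) := by
  by_cases h : ξ = ζ
  · rw [h, bcost_self, Real.log_zero, neg_zero]
    unfold bgp; rw [dif_neg (not_not.2 rfl)]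
  · rw [bcost_of_ne ht o h, Real.log_exp, neg_neg]

lemma bcost_ultra (ht : IsRealTree X) (o : X) (ξ η ζ : Boundary X) :
    bcost ht o ξ ζ ≤ max (bcost ht o ξ η) (bcost ht o η ζ) := by
  by_cases h1 : ξ = η
  · rw [h1]; exact le_max_right _ _
  by_cases h2 : η = ζ
  · rw [h2]; exact le_max_left _ _
  rw [bcost_of_ne ht o h1, bcost_of_ne ht o h2, ← Real.exp_monotone.map_max, max_neg_neg,
    bcost_le_iff ht o (le_min (bgp_nonneg ..) (bgp_nonneg ..))]
  rw [(bray_eq_iff ht o h1 (le_min (bgp_nonneg ..) (bgp_nonneg ..))).2 (min_le_left _ _)]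
  exact (bray_eq_iff ht o h2 (le_min (bgp_nonneg ..) (bgp_nonneg ..))).2 (min_le_right _ _)

lemma bgp_congr (ht : IsRealTree X) (o : X) {ξ ζ ξ' ζ' : Boundary X} {r : ℝ} (hne : ξ ≠ ζ)
    (h : bgp ht o ξ ζ < r) (h1 : bray ht o ξ' r = bray ht o ξ r)
    (h2 : bray ht o ζ' r = bray ht o ζ r) : ξ' ≠ ζ' ∧ bgp ht o ξ' ζ' = bgp ht o ξ ζ := by
  have hr : 0 ≤ r := (bgp_nonneg ..).trans h.le
  have hne' : ξ' ≠ ζ' := by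
    rintro rfl
    exact absurd ((bray_eq_iff ht o hne hr).1 (h1.symm.trans h2)) (not_le.2 h)
  refine ⟨hne', ?_⟩
  have e1 := gpr_bray ht o hne' hr
  rw [h1, h2, gpr_bray ht o hne hr, min_eq_right h.le] at e1
  rcases le_total r (bgp ht o ξ' ζ') with h' | h'
  · rw [min_eq_left h'] at e1; linarith
  · rw [min_eq_right h'] at e1; exact e1.symm

lemma continuous_bcost (ht : IsRealTree X) (o : X) :
    Continuous fun p : Boundary X × Boundary X => bcost ht o p.1 p.2 := by
  rw [continuous_iff_continuousAt]
  rintro ⟨ξ, ζ⟩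
  have hnhds : ∀ r : ℝ, 0 ≤ r → ∀ᶠ p : Boundary X × Boundary X in 𝓝 (ξ, ζ),
      bray ht o p.1 r = bray ht o ξ r ∧ bray ht o p.2 r = bray ht o ζ r := by
    intro r hr
    have h1 := (isOpen_shadow ht o (bray ht o ξ r)).mem_nhds ((mem_shadow_bray ht o hr).2 rfl)
    have h2 := (isOpen_shadow ht o (bray ht o ζ r)).mem_nhds ((mem_shadow_bray ht o hr).2 rfl)
    filter_upwards [prod_mem_nhds h1 h2] with p hp
    exact ⟨(mem_shadow_bray ht o hr).1 hp.1, (mem_shadow_bray ht o hr).1 hp.2⟩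
  by_cases h : ξ = ζ
  · subst h
    rw [Metric.continuousAt_iff']
    intro ε hε
    obtain ⟨r, hr0, hr⟩ : ∃ r : ℝ, 0 ≤ r ∧ Real.exp (-r) < ε := by
      have := (Real.tendsto_exp_neg_atTop_nhds_zero.eventually_lt_const hε).and
        (eventually_ge_atTop 0)
      obtain ⟨r, h1, h2⟩ := this.exists
      exact ⟨r, h2, h1⟩
    filter_upwards [hnhds r hr0] with p hp
    rw [bcost_self, Real.dist_eq, sub_zero, abs_of_nonneg (bcost_nonneg ..)]
    exact ((bcost_le_iff ht o hr0).2 (hp.1.trans hp.2.symm)).trans_lt hr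
  · refine (continuousAt_const (y := bcost ht o ξ ζ)).congr ?_
    filter_upwards [hnhds (bgp ht o ξ ζ + 1) (by linarith [bgp_nonneg ht o ξ ζ])] with p hp
    obtain ⟨h1, h2⟩ := bgp_congr ht o h (by linarith) hp.1 hp.2
    rw [bcost_of_ne ht o h, bcost_of_ne ht o h1, h2]

lemma measurable_bgp [SecondCountableTopology (Boundary X)] (ht : IsRealTree X) (o : X) :
    Measurable fun p : Boundary X × Boundary X => bgp ht o p.1 p.2 := by
  simp_rw [bgp_eq_neg_log]
  exact (Real.measurable_log.comp (continuous_bcost ht o).measurable).neg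

end TreeTopology

/-! ## Swapping the targets of two pieces of a coupling -/

section Swap

variable {A B : Type*} [MeasurableSpace A] [MeasurableSpace B]

/-- The measure obtained from `π` by exchanging the targets of a small part of its restrictions to
`L₁` and to `L₂`. -/
def swapMeasure (π : Measure (A × B)) (L₁ L₂ : Set (A × B)) : Measure (A × B) :=
  π.restrict (L₁ ∪ L₂)ᶜ + (1 - π L₂) • π.restrict L₁ + (1 - π L₁) • π.restrict L₂ +
    (((π.restrict L₁).prod (π.restrict L₂)).map (fun z => (z.1.1, z.2.2)) +
      ((π.restrict L₁).prod (π.restrict L₂)).map (fun z => (z.2.1, z.1.2)))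

lemma lintegral_swapMeasure (π : Measure (A × B)) {L₁ L₂ : Set (A × B)} {g : A × B → ℝ≥0∞}
    (hg : Measurable g) :
    ∫⁻ z, g z ∂swapMeasure π L₁ L₂ =
      ∫⁻ z in (L₁ ∪ L₂)ᶜ, g z ∂π + (1 - π L₂) * ∫⁻ z in L₁, g z ∂π +
        (1 - π L₁) * ∫⁻ z in L₂, g z ∂π +
        ∫⁻ z, (g (z.1.1, z.2.2) + g (z.2.1, z.1.2)) ∂((π.restrict L₁).prod (π.restrict L₂)) := by
  rw [swapMeasure, lintegral_add_measure, lintegral_add_measure, lintegral_add_measure,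
    lintegral_add_measure, lintegral_smul_measure, lintegral_smul_measure,
    lintegral_map hg (by fun_prop), lintegral_map hg (by fun_prop),
    lintegral_add_left (by fun_prop)]
  rfl

lemma lintegral_prod_restrict_add (π : Measure (A × B)) [IsProbabilityMeasure π]
    {L₁ L₂ : Set (A × B)} {g : A × B → ℝ≥0∞} (hg : Measurable g) :
    ∫⁻ z, (g z.1 + g z.2) ∂((π.restrict L₁).prod (π.restrict L₂)) =
      π L₂ * ∫⁻ z in L₁, g z ∂π + π L₁ * ∫⁻ z in L₂, g z ∂π := by
  rw [lintegral_add_left (by fun_prop)]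
  congr 1
  · rw [← lintegral_map (g := Prod.fst) hg measurable_fst, Measure.map_fst_prod,
      lintegral_smul_measure]
    simp
  · rw [← lintegral_map (g := Prod.snd) hg measurable_snd, Measure.map_snd_prod,
      lintegral_smul_measure]
    simp

lemma lintegral_split_two (π : Measure (A × B)) [IsProbabilityMeasure π]
    {L₁ L₂ : Set (A × B)} (h₁ : MeasurableSet L₁) (h₂ : MeasurableSet L₂) (hd : Disjoint L₁ L₂)
    {g : A × B → ℝ≥0∞} (hg : Measurable g) :
    ∫⁻ z, g z ∂π = ∫⁻ z in (L₁ ∪ L₂)ᶜ, g z ∂π + (1 - π L₂) * ∫⁻ z in L₁, g z ∂π +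
        (1 - π L₁) * ∫⁻ z in L₂, g z ∂π +
        ∫⁻ z, (g z.1 + g z.2) ∂((π.restrict L₁).prod (π.restrict L₂)) := by
  rw [lintegral_prod_restrict_add π hg]
  have e1 : (1 - π L₂) * ∫⁻ z in L₁, g z ∂π + π L₂ * ∫⁻ z in L₁, g z ∂π = ∫⁻ z in L₁, g z ∂π := by
    rw [← add_mul, tsub_add_cancel_of_le prob_le_one, one_mul]
  have e2 : (1 - π L₁) * ∫⁻ z in L₂, g z ∂π + π L₁ * ∫⁻ z in L₂, g z ∂π = ∫⁻ z in L₂, g z ∂π := by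
    rw [← add_mul, tsub_add_cancel_of_le prob_le_one, one_mul]
  rw [add_add_add_comm (_ + _), e2, add_assoc (∫⁻ z in _, g z ∂π), e1, add_assoc,
    ← lintegral_union h₂ hd, add_comm, lintegral_add_compl _ (h₁.union h₂)]

lemma isCoupling_swapMeasure {π : Measure (A × B)} [IsProbabilityMeasure π] {μ : Measure A}
    {ν : Measure B} (hπ : IsCoupling π μ ν) {L₁ L₂ : Set (A × B)} (h₁ : MeasurableSet L₁)
    (h₂ : MeasurableSet L₂) (hd : Disjoint L₁ L₂) : IsCoupling (swapMeasure π L₁ L₂) μ ν := by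
  have key : ∀ g : A × B → ℝ≥0∞, Measurable g →
      (∀ z w : A × B, g (z.1, w.2) + g (w.1, z.2) = g z + g w) →
      ∫⁻ z, g z ∂swapMeasure π L₁ L₂ = ∫⁻ z, g z ∂π := by
    intro g hg h
    rw [lintegral_swapMeasure π hg, lintegral_split_two π h₁ h₂ hd hg]
    simp only [h]
  constructor
  · rw [← hπ.1]
    refine Measure.ext_of_lintegral _ fun f hf => ?_
    rw [lintegral_map hf measurable_fst, lintegral_map hf measurable_fst]
    exact key (fun z => f z.1) (by fun_prop) fun z w => rfl
  · rw [← hπ.2]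
    refine Measure.ext_of_lintegral _ fun f hf => ?_
    rw [lintegral_map hf measurable_snd, lintegral_map hf measurable_snd]
    exact key (fun z => f z.2) (by fun_prop) fun z w => add_comm _ _

/-- If exchanging the targets of the points of `L₁` and `L₂` decreases the cost, then a coupling
charging both sets is not optimal. -/
lemma exists_coupling_lintegral_lt {π : Measure (A × B)} [IsProbabilityMeasure π] {μ : Measure A}
    {ν : Measure B} (hπ : IsCoupling π μ ν) {L₁ L₂ : Set (A × B)} (h₁ : MeasurableSet L₁)
    (h₂ : MeasurableSet L₂) (hd : Disjoint L₁ L₂) (hp₁ : π L₁ ≠ 0) (hp₂ : π L₂ ≠ 0)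
    {c : A × B → ℝ≥0∞} (hc : Measurable c) (hfin : ∫⁻ z, c z ∂π ≠ ⊤)
    (hlt : ∀ z ∈ L₁, ∀ w ∈ L₂, c (z.1, w.2) + c (w.1, z.2) < c z + c w) :
    ∃ π' : Measure (A × B), IsCoupling π' μ ν ∧ ∫⁻ z, c z ∂π' < ∫⁻ z, c z ∂π := by
  refine ⟨swapMeasure π L₁ L₂, isCoupling_swapMeasure hπ h₁ h₂ hd, ?_⟩
  have hae : ∀ᵐ z ∂((π.restrict L₁).prod (π.restrict L₂)),
      c (z.1.1, z.2.2) + c (z.2.1, z.1.2) < c z.1 + c z.2 := by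
    rw [Measure.prod_restrict]
    filter_upwards [ae_restrict_mem (h₁.prod h₂)] with z hz
    exact hlt _ hz.1 _ hz.2
  have hrest := lintegral_split_two π h₁ h₂ hd hc
  have hne : (π.restrict L₁).prod (π.restrict L₂) ≠ 0 := by
    intro h0
    have h := congrArg (fun m => m univ) h0
    rw [Measure.prod_restrict] at h
    simp [Measure.prod_prod, hp₁, hp₂] at h
  rw [hrest] at hfin
  obtain ⟨hf1, hf2⟩ := ENNReal.add_ne_top.1 hfin
  rw [lintegral_swapMeasure π hc, hrest]
  refine ENNReal.add_lt_add_left hf1 (lintegral_strict_mono hne (by fun_prop) ?_ hae)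
  exact ne_top_of_le_ne_top hf2 (lintegral_mono_ae (hae.mono fun z hz => hz.le))

/-- A coupling does not charge simultaneously `D × Dᶜ` and `Dᶜ × D`. -/
def NonCrossing {C : Type*} [MeasurableSpace C] (π : Measure (C × C)) (D : Set C) : Prop :=
  π (D ×ˢ Dᶜ) = 0 ∨ π (Dᶜ ×ˢ D) = 0

end Swap

/-! ## Existence of couplings without crossings -/

section Existence

variable {X : Type*} [MetricSpace X]

/-- A set of boundary points whose points are closer to each other than to any point outside. -/
def IsCluster (ht : IsRealTree X) (o : X) (S : Set (Boundary X)) : Prop :=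
  ∀ a ∈ S, ∀ a' ∈ S, ∀ b ∉ S, bcost ht o a a' < bcost ht o a b

lemma isCluster_shadow (ht : IsRealTree X) (o y : X) : IsCluster ht o (shadow ht o y) := by
  intro a ha a' ha' b hb
  have h1 : bcost ht o a a' ≤ Real.exp (-(dist o y)) :=
    (bcost_le_iff ht o dist_nonneg).2 (ha.trans ha'.symm)
  refine h1.trans_lt (lt_of_not_ge fun h => hb ?_)
  exact ((bcost_le_iff ht o dist_nonneg).1 h).symm.trans ha

lemma IsCluster.bcost_swap_lt {ht : IsRealTree X} {o : X} {S : Set (Boundary X)}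
    (hS : IsCluster ht o S) {z w : Boundary X × Boundary X} (hz : z ∈ S ×ˢ Sᶜ) (hw : w ∈ Sᶜ ×ˢ S) :
    bcost ht o z.1 w.2 + bcost ht o w.1 z.2 < bcost ht o z.1 z.2 + bcost ht o w.1 w.2 := by
  obtain ⟨a, β⟩ := z
  obtain ⟨α, b⟩ := w
  obtain ⟨ha, hβ⟩ := hz
  obtain ⟨hα, hb⟩ := hw
  simp only at ha hβ hα hb ⊢
  have h1 := hS a ha b hb β hβ
  have h2 := hS b hb a ha α hα
  have h3 := bcost_ultra ht o α b β
  have h4 := bcost_ultra ht o b a β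
  rw [bcost_comm ht o b a] at h2 h4
  rw [bcost_comm ht o b α] at h2
  rcases le_max_iff.1 h3 with h | h
  · linarith
  · rcases le_max_iff.1 h4 with h' | h' <;> linarith

lemma IsCoupling.isProbabilityMeasure {A B : Type*} [MeasurableSpace A] [MeasurableSpace B]
    {π : Measure (A × B)} {μ : Measure A} {ν : Measure B} (hπ : IsCoupling π μ ν)
    [IsProbabilityMeasure μ] : IsProbabilityMeasure π := by
  constructor
  rw [← preimage_univ (f := Prod.fst), ← Measure.map_apply measurable_fst .univ, hπ.1]
  exact measure_univ

lemma exists_nonCrossing_coupling [CompactSpace (Boundary X)] [T2Space (Boundary X)]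
    [SecondCountableTopology (Boundary X)] (ht : IsRealTree X) (o : X)
    (νm νp : Measure (Boundary X)) [hm : IsProbabilityMeasure νm] [hp : IsProbabilityMeasure νp] :
    ∃ π : Measure (Boundary X × Boundary X), IsProbabilityMeasure π ∧ IsCoupling π νm νp ∧
      ∀ S, MeasurableSet S → IsCluster ht o S → NonCrossing π S := by
  let _ := TopologicalSpace.metrizableSpaceMetric (Boundary X)
  set f1 : ProbabilityMeasure (Boundary X × Boundary X) → ProbabilityMeasure (Boundary X) :=
    fun P => P.map (f := Prod.fst) measurable_fst.aemeasurable
  set f2 : ProbabilityMeasure (Boundary X × Boundary X) → ProbabilityMeasure (Boundary X) :=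
    fun P => P.map (f := Prod.snd) measurable_snd.aemeasurable
  have hf1 : Continuous f1 := ProbabilityMeasure.continuous_map continuous_fst
  have hf2 : Continuous f2 := ProbabilityMeasure.continuous_map continuous_snd
  let c : BoundedContinuousFunction (Boundary X × Boundary X) ℝ :=
    BoundedContinuousFunction.mkOfCompact ⟨fun p => bcost ht o p.1 p.2, continuous_bcost ht o⟩
  have hc : Continuous fun P : ProbabilityMeasure (Boundary X × Boundary X) =>
      ∫ p, c p ∂(P : Measure (Boundary X × Boundary X)) :=
    ProbabilityMeasure.continuous_integral_boundedContinuousFunction c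
  have hK : IsCompact {P | f1 P = ⟨νm, hm⟩ ∧ f2 P = ⟨νp, hp⟩} :=
    ((isClosed_singleton.preimage hf1).inter (isClosed_singleton.preimage hf2)).isCompact
  have hKc : ∀ P : ProbabilityMeasure (Boundary X × Boundary X),
      P ∈ {P | f1 P = ⟨νm, hm⟩ ∧ f2 P = ⟨νp, hp⟩} ↔ IsCoupling P.1 νm νp := by
    intro P
    refine and_congr ?_ ?_ <;> exact Subtype.ext_iff
  obtain ⟨P, hP, hmin⟩ := hK.exists_isMinOn ⟨⟨νm.prod νp, inferInstance⟩, (hKc _).2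
    ⟨by simp [Measure.map_fst_prod], by simp [Measure.map_snd_prod]⟩⟩ hc.continuousOn
  have hPc := (hKc P).1 hP
  refine ⟨P, inferInstance, hPc, fun S hS hcl => ?_⟩
  by_contra hcross
  unfold NonCrossing at hcross
  push Not at hcross
  have hmeas : Measurable fun p : Boundary X × Boundary X => bcost ht o p.1 p.2 :=
    (continuous_bcost ht o).measurable
  have hint : ∀ Q : Measure (Boundary X × Boundary X), IsProbabilityMeasure Q →
      Integrable (fun p : Boundary X × Boundary X => bcost ht o p.1 p.2) Q := fun Q _ =>
    c.integrable Q
  have heq : ∀ Q : Measure (Boundary X × Boundary X), IsProbabilityMeasure Q →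
      ENNReal.ofReal (∫ p, bcost ht o p.1 p.2 ∂Q) =
        ∫⁻ p, ENNReal.ofReal (bcost ht o p.1 p.2) ∂Q := fun Q hQ =>
    ofReal_integral_eq_lintegral_ofReal (hint Q hQ) (ae_of_all _ fun p => bcost_nonneg ht o _ _)
  obtain ⟨Q, hQ, hlt⟩ := exists_coupling_lintegral_lt (π := (P : Measure _)) hPc
    (hS.prod hS.compl) (hS.compl.prod hS)
    (Set.disjoint_left.2 fun z h h' => h'.1 h.1) hcross.1 hcross.2
    (c := fun p => ENNReal.ofReal (bcost ht o p.1 p.2)) (by fun_prop)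
    (by rw [← heq P inferInstance]; exact ENNReal.ofReal_ne_top) (fun z hz w hw => by
      simp only [← ENNReal.ofReal_add (bcost_nonneg ht o _ _) (bcost_nonneg ht o _ _)]
      have h := hcl.bcost_swap_lt hz hw
      refine (ENNReal.ofReal_lt_ofReal_iff ?_).2 h
      exact (add_nonneg (bcost_nonneg ht o _ _) (bcost_nonneg ht o _ _)).trans_lt h)
  have hQp : IsProbabilityMeasure Q := hQ.isProbabilityMeasure
  rw [← heq P inferInstance, ← heq Q hQp] at hlt
  have h := hmin ((hKc ⟨Q, hQp⟩).2 hQ)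
  exact absurd (ENNReal.ofReal_le_ofReal h) (not_le.2 hlt)

end Existence

/-! ## Couplings without crossings are optimal -/

section Optimality

lemma IsCoupling.measure_prod_univ {A B : Type*} [MeasurableSpace A] [MeasurableSpace B]
    {π : Measure (A × B)} {μ : Measure A} {ν : Measure B} (hπ : IsCoupling π μ ν) {S : Set A}
    (hS : MeasurableSet S) : π (S ×ˢ univ) = μ S := by
  rw [← hπ.1, Measure.map_apply measurable_fst hS, prod_univ]

lemma IsCoupling.measure_univ_prod {A B : Type*} [MeasurableSpace A] [MeasurableSpace B]
    {π : Measure (A × B)} {μ : Measure A} {ν : Measure B} (hπ : IsCoupling π μ ν) {S : Set B}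
    (hS : MeasurableSet S) : π (univ ×ˢ S) = ν S := by
  rw [← hπ.2, Measure.map_apply measurable_snd hS, univ_prod]

lemma measure_prod_eq_add_right {A B : Type*} [MeasurableSpace A] [MeasurableSpace B]
    (π : Measure (A × B)) {S : Set A} {T : Set B} (hT : MeasurableSet T) :
    π (S ×ˢ univ) = π (S ×ˢ T) + π (S ×ˢ Tᶜ) := by
  rw [← measure_inter_add_sdiff (S ×ˢ univ) (MeasurableSet.univ.prod hT)]
  congr 2 <;> ext ⟨a, b⟩ <;> simp

lemma measure_prod_eq_add_left {A B : Type*} [MeasurableSpace A] [MeasurableSpace B]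
    (π : Measure (A × B)) {S : Set A} {T : Set B} (hS : MeasurableSet S) :
    π (univ ×ˢ T) = π (S ×ˢ T) + π (Sᶜ ×ˢ T) := by
  rw [← measure_inter_add_sdiff (univ ×ˢ T) (hS.prod MeasurableSet.univ)]
  congr 2 <;> ext ⟨a, b⟩ <;> simp [and_comm]

section

variable {C : Type*} [MeasurableSpace C] {π : Measure (C × C)} {μ ν : Measure C} {S : Set C}

lemma IsCoupling.left_eq_add (hπ : IsCoupling π μ ν) (hS : MeasurableSet S) :
    μ S = π (S ×ˢ S) + π (S ×ˢ Sᶜ) := by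
  rw [← hπ.measure_prod_univ hS, measure_prod_eq_add_right π hS]

lemma IsCoupling.right_eq_add (hπ : IsCoupling π μ ν) (hS : MeasurableSet S) :
    ν S = π (S ×ˢ S) + π (Sᶜ ×ˢ S) := by
  rw [← hπ.measure_univ_prod hS, measure_prod_eq_add_left π hS]

lemma IsCoupling.measure_prod_self_le (hπ : IsCoupling π μ ν) (hS : MeasurableSet S) :
    π (S ×ˢ S) ≤ min (μ S) (ν S) := by
  rw [hπ.left_eq_add hS, hπ.right_eq_add hS]
  exact le_min le_self_add le_self_add

lemma NonCrossing.min_le (h : NonCrossing π S) (hπ : IsCoupling π μ ν) (hS : MeasurableSet S) :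
    min (μ S) (ν S) ≤ π (S ×ˢ S) := by
  rw [hπ.left_eq_add hS, hπ.right_eq_add hS]
  rcases h with h | h <;> rw [h]
  · exact (min_le_left _ _).trans (by rw [add_zero])
  · exact (min_le_right _ _).trans (by rw [add_zero])

end

variable {X : Type*} [MetricSpace X]

lemma AntipodalMeasures.ae_ne (ht : IsRealTree X) (o : X) {νm νp : Measure (Boundary X)}
    [IsProbabilityMeasure νm] [IsProbabilityMeasure νp] (h : AntipodalMeasures νm νp)
    {π : Measure (Boundary X × Boundary X)} (hπ : IsCoupling π νm νp) : ∀ᵐ p ∂π, p.1 ≠ p.2 := by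
  obtain ⟨A, B, hA, hB, h1, h2, hAB⟩ := h
  have hA' : ∀ᵐ p ∂π, p.1 ∈ A := by
    have : ∀ᵐ ξ ∂νm, ξ ∈ A := mem_ae_iff_prob_eq_one hA |>.2 h1
    rw [← hπ.1] at this
    exact ae_of_ae_map measurable_fst.aemeasurable this
  have hB' : ∀ᵐ p ∂π, p.2 ∈ B := by
    have : ∀ᵐ ξ ∂νp, ξ ∈ B := mem_ae_iff_prob_eq_one hB |>.2 h2
    rw [← hπ.2] at this
    exact ae_of_ae_map measurable_snd.aemeasurable this
  filter_upwards [hA', hB'] with p hpA hpB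
  exact (antipodal_iff ht o _ _).1 (hAB _ hpA _ hpB)

/-- The set of pairs whose rays from `o` agree up to time `r`. -/
lemma measure_bray_eq [CompactSpace (Boundary X)] (ht : IsRealTree X) (o : X) {r : ℝ}
    (hr : 0 ≤ r) (π : Measure (Boundary X × Boundary X)) :
    π {p | bray ht o p.1 r = bray ht o p.2 r} =
      ∑ y ∈ (finite_range_bray ht o hr).toFinset, π (shadow ht o y ×ˢ shadow ht o y) := by
  have hy : ∀ y ∈ (finite_range_bray ht o hr).toFinset, ∀ ξ, ξ ∈ shadow ht o y ↔
      bray ht o ξ r = y := by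
    intro y hy ξ
    obtain ⟨ζ, rfl⟩ := (finite_range_bray ht o hr).mem_toFinset.1 hy
    exact mem_shadow_bray ht o hr
  rw [← measure_biUnion_finset]
  · congr 1
    ext p
    simp only [mem_ofPred_eq, mem_iUnion, exists_prop, mem_prod]
    constructor
    · intro h
      refine ⟨bray ht o p.1 r, by simp, mem_shadow_bray ht o hr |>.2 rfl,
        mem_shadow_bray ht o hr |>.2 h.symm⟩
    · rintro ⟨y, hyr, h1, h2⟩
      exact ((hy y hyr _).1 h1).trans ((hy y hyr _).1 h2).symm
  · intro y hy1 z hz1 hne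
    refine Set.disjoint_left.2 fun p h1 h2 => hne ?_
    exact ((hy y hy1 _).1 h1.1).symm.trans ((hy z hz1 _).1 h2.1)
  · intro y _
    exact (measurableSet_shadow ht o y).prod (measurableSet_shadow ht o y)

lemma D0cost_eq_lintegral_bgp (ht : IsRealTree X) (o : X)
    (π : Measure (Boundary X × Boundary X)) :
    D0cost o π = ∫⁻ p, ENNReal.ofReal (bgp ht o p.1 p.2 ^ 2) ∂π := by
  unfold D0cost
  congr 1 with p
  rw [D0_eq_bgp ht, ENNReal.ofReal_pow (bgp_nonneg ht o _ _)]

lemma D0cost_eq_layers [SecondCountableTopology (Boundary X)] (ht : IsRealTree X) (o : X)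
    {π : Measure (Boundary X × Boundary X)} (hne : ∀ᵐ p ∂π, p.1 ≠ p.2) :
    D0cost o π = ∫⁻ t in Ioi (0 : ℝ), π {p | bray ht o p.1 √t = bray ht o p.2 √t} := by
  have hb := measurable_bgp ht o
  rw [D0cost_eq_lintegral_bgp ht,
    lintegral_eq_lintegral_meas_le π (ae_of_all _ fun p => sq_nonneg _)
    (hb.pow_const 2).aemeasurable]
  refine setLIntegral_congr_fun measurableSet_Ioi fun t htt => measure_congr ?_
  filter_upwards [hne] with p hp
  refine propext ((Iff.trans ?_ (bray_eq_iff ht o hp (Real.sqrt_nonneg t)).symm))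
  exact (Real.sqrt_le_left (bgp_nonneg ht o _ _)).symm

/-- Couplings without crossings along shadows maximize `∫ D₀²`. -/
lemma D0cost_le_of_nonCrossing [CompactSpace (Boundary X)] [SecondCountableTopology (Boundary X)]
    (ht : IsRealTree X) (o : X) {νm νp : Measure (Boundary X)}
    [IsProbabilityMeasure νm] [IsProbabilityMeasure νp] (h : AntipodalMeasures νm νp)
    {π π' : Measure (Boundary X × Boundary X)} (hπ : IsCoupling π νm νp)
    (hπ' : IsCoupling π' νm νp) (hnc : ∀ y, NonCrossing π (shadow ht o y)) :
    D0cost o π' ≤ D0cost o π := by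
  rw [D0cost_eq_layers ht o (h.ae_ne ht o hπ), D0cost_eq_layers ht o (h.ae_ne ht o hπ')]
  refine lintegral_mono fun t => ?_
  rw [measure_bray_eq ht o (Real.sqrt_nonneg t), measure_bray_eq ht o (Real.sqrt_nonneg t)]
  exact Finset.sum_le_sum fun y _ => (hπ'.measure_prod_self_le (measurableSet_shadow ht o y)).trans
    ((hnc y).min_le hπ (measurableSet_shadow ht o y))

lemma D0supCost_eq_of_nonCrossing [CompactSpace (Boundary X)]
    [SecondCountableTopology (Boundary X)]
    (ht : IsRealTree X) (o : X) {νm νp : Measure (Boundary X)}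
    [IsProbabilityMeasure νm] [IsProbabilityMeasure νp] (h : AntipodalMeasures νm νp)
    {π : Measure (Boundary X × Boundary X)} (hπ : IsCoupling π νm νp)
    (hnc : ∀ y, NonCrossing π (shadow ht o y)) : D0supCost o νm νp = D0cost o π :=
  le_antisymm (iSup₂_le fun _ hπ' => D0cost_le_of_nonCrossing ht o h hπ hπ' hnc)
    (le_iSup₂ (f := fun π _ => D0cost o π) π hπ)

end Optimality

/-! ## Directions at a point -/

section Directions

variable {X : Type*} [MetricSpace X]

lemma bray_eq_treePt_bray (ht : IsRealTree X) (o x : X) (ξ : Boundary X) {s t : ℝ} (hs : 0 ≤ s)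
    (h : s + dist x o ≤ t) : bray ht x ξ s = treePt ht x s (bray ht o ξ t) := by
  have h0 : 0 ≤ t := (add_nonneg hs dist_nonneg).trans h
  have e : ((baseRay ht o ξ).1 0 : X) = o := bray_zero ht o ξ
  have := bray_eq_treePt ht x (baseRay ht o ξ) hs (t := ⟨t, h0⟩) (by rw [e]; exact h)
  rwa [mk_baseRay] at this

lemma bray_of_mem_shadow (ht : IsRealTree X) {o x : X} {ξ : Boundary X} (h : ξ ∈ shadow ht o x)
    {t : ℝ} (h0 : 0 ≤ t) : bray ht x ξ t = bray ht o ξ (dist o x + t) := by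
  have hx : bray ht o ξ (dist o x) = x := h
  have hd : 0 ≤ dist o x := dist_nonneg
  have hdist : ∀ s, 0 ≤ s → dist x (bray ht o ξ (dist o x + s)) = s := by
    intro s hs
    have h1 := dist_bray_bray ht o ξ hd (add_nonneg hd hs)
    rwa [hx, sub_add_cancel_left, abs_neg, abs_of_nonneg hs] at h1
  rw [bray_eq_treePt_bray ht o x ξ h0 (t := dist o x + (t + dist o x))
    (by rw [dist_comm x o]; linarith)]
  have hseg : OnSeg x (bray ht o ξ (dist o x + t)) (bray ht o ξ (dist o x + (t + dist o x))) := by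
    unfold OnSeg
    rw [hdist t h0, hdist _ (by linarith), dist_bray_bray ht o ξ (by linarith) (by linarith)]
    rw [add_sub_add_left_eq_sub, sub_add_cancel_left, abs_neg, abs_of_nonneg hd]
  have h := treePt_eq_of_onSeg ht hseg
  rwa [hdist t h0] at h

lemma gpr_bray_bray (ht : IsRealTree X) (x : X) (ξ : Boundary X) {s t : ℝ} (hs : 0 ≤ s)
    (hst : s ≤ t) : gpr x (bray ht x ξ s) (bray ht x ξ t) = s := by
  rw [(onSeg_bray ht x ξ hs hst).gpr_eq, dist_bray ht x ξ hs]

/-- The shadow of `x` seen from `o`, in terms of directions at `x`. -/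
lemma mem_shadow_iff_gpr (ht : IsRealTree X) (o x : X) (ξ : Boundary X) :
    ξ ∈ shadow ht o x ↔ gpr x o (bray ht x ξ 1) = 0 := by
  constructor
  · intro h
    have hx : bray ht o ξ (dist o x) = x := h
    have h1 := onSeg_bray ht o ξ (r := dist o x) (s := dist o x + 1) dist_nonneg (by linarith)
    rw [hx, ← bray_of_mem_shadow ht h zero_le_one] at h1
    unfold OnSeg at h1
    unfold gpr
    rw [dist_comm x o]
    linarith
  · intro h
    have hd : 0 ≤ dist o x := dist_nonneg
    set T := 1 + dist o x + dist o x with hT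
    have h1 : 0 < gpr x (bray ht x ξ 1) (bray ht x ξ T) := by
      rw [gpr_bray_bray ht x ξ zero_le_one (by linarith)]; exact one_pos
    have h2 : gpr x o (bray ht x ξ T) = 0 := by
      refine le_antisymm (not_lt.1 fun hlt => ?_) (gpr_nonneg _ _ _)
      exact absurd (ht.gpr_pos _ hlt (by rw [gpr_comm]; exact h1)) h.not_gt
    have h3 : OnSeg o x (bray ht x ξ T) := by
      unfold gpr at h2
      unfold OnSeg
      rw [dist_comm x o] at h2
      linarith
    have h4 := treePt_eq_of_onSeg ht h3
    rw [← bray_eq_treePt_bray ht x o ξ dist_nonneg (by linarith)] at h4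
    exact h4

/-- The boundary points lying in the same direction at `x` as `ξ`. -/
def dirClass (ht : IsRealTree X) (x : X) (ξ : Boundary X) : Set (Boundary X) :=
  {ζ | 0 < gpr x (bray ht x ξ 1) (bray ht x ζ 1)}

lemma mem_dirClass_self (ht : IsRealTree X) (x : X) (ξ : Boundary X) : ξ ∈ dirClass ht x ξ := by
  change 0 < gpr x _ _
  rw [gpr_bray_bray ht x ξ zero_le_one le_rfl]
  exact one_pos

lemma dirClass_eq (ht : IsRealTree X) {x : X} {ξ ζ : Boundary X} (h : ζ ∈ dirClass ht x ξ) :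
    dirClass ht x ζ = dirClass ht x ξ := by
  have h' : 0 < gpr x (bray ht x ξ 1) (bray ht x ζ 1) := h
  ext η
  exact ⟨fun hη => ht.gpr_pos _ h' hη, fun hη => ht.gpr_pos _ (by rwa [gpr_comm]) hη⟩

lemma mem_dirClass_iff (ht : IsRealTree X) (x : X) (ξ ζ : Boundary X) :
    ζ ∈ dirClass ht x ξ ↔ ξ = ζ ∨ 0 < bgp ht x ξ ζ := by
  by_cases h : ξ = ζ
  · subst h; simp [mem_dirClass_self]
  · change 0 < gpr x _ _ ↔ _
    rw [gpr_bray ht x h zero_le_one]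
    simp [h]

lemma isOpen_dirClass (ht : IsRealTree X) (x : X) (ξ : Boundary X) :
    IsOpen (dirClass ht x ξ) := by
  refine isOpen_lt continuous_const ?_
  have := continuous_bray ht x (s := 1) zero_le_one
  unfold gpr
  fun_prop

lemma mem_shadow_of_mem_dirClass (ht : IsRealTree X) {o x : X} {ξ ζ : Boundary X}
    (hξ : ξ ∈ shadow ht o x) (h : ζ ∈ dirClass ht x ξ) : ζ ∈ shadow ht o x := by
  rw [mem_shadow_iff_gpr] at hξ ⊢
  refine le_antisymm (not_lt.1 fun hlt => ?_) (gpr_nonneg _ _ _)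
  exact absurd (ht.gpr_pos _ hlt (by rw [gpr_comm]; exact h)) hξ.not_gt

lemma bgp_of_mem_shadow (ht : IsRealTree X) {o x : X} {ξ ζ : Boundary X} (hne : ξ ≠ ζ)
    (hξ : ξ ∈ shadow ht o x) (hζ : ζ ∈ shadow ht o x) :
    bgp ht o ξ ζ = dist o x + bgp ht x ξ ζ := by
  have hd : 0 ≤ dist o x := dist_nonneg
  have h1 : dist o x ≤ bgp ht o ξ ζ :=
    (bray_eq_iff ht o hne hd).1 (Eq.trans hξ (Eq.symm hζ))
  have key : ∀ t, 0 ≤ t → (t ≤ bgp ht x ξ ζ ↔ dist o x + t ≤ bgp ht o ξ ζ) := by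
    intro t h0
    rw [← bray_eq_iff ht x hne h0, ← bray_eq_iff ht o hne (by linarith),
      bray_of_mem_shadow ht hξ h0, bray_of_mem_shadow ht hζ h0]
  have h2 := (key _ (bgp_nonneg ht x ξ ζ)).1 le_rfl
  have h3 := (key (bgp ht o ξ ζ - dist o x) (by linarith)).2 (by linarith)
  linarith

lemma mem_dirClass_iff_of_mem_shadow (ht : IsRealTree X) {o x : X} {ξ ζ : Boundary X}
    (hξ : ξ ∈ shadow ht o x) : ζ ∈ dirClass ht x ξ ↔ ξ = ζ ∨ dist o x < bgp ht o ξ ζ := by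
  have hd : 0 ≤ dist o x := dist_nonneg
  by_cases h : ξ = ζ
  · subst h; simp [mem_dirClass_self]
  constructor
  · intro hζ
    rw [bgp_of_mem_shadow ht h hξ (mem_shadow_of_mem_dirClass ht hξ hζ)]
    rcases (mem_dirClass_iff ht x ξ ζ).1 hζ with h' | h'
    · exact Or.inl h'
    · right; linarith
  · rintro (h' | h')
    · exact absurd h' h
    · have hζ : ζ ∈ shadow ht o x :=
        ((bray_eq_iff ht o h hd).2 h'.le).symm.trans hξ
      rw [bgp_of_mem_shadow ht h hξ hζ] at h'
      exact (mem_dirClass_iff ht x ξ ζ).2 (Or.inr (by linarith))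

lemma isCluster_dirClass (ht : IsRealTree X) {o x : X} {ξ : Boundary X} (hξ : ξ ∈ shadow ht o x) :
    IsCluster ht o (dirClass ht x ξ) := by
  intro a ha a' ha' b hb
  rw [← dirClass_eq ht ha] at ha' hb
  have haS := mem_shadow_of_mem_dirClass ht hξ ha
  rw [mem_dirClass_iff_of_mem_shadow ht haS] at ha' hb
  push Not at hb
  rw [bcost_of_ne ht o hb.1]
  rcases ha' with rfl | h
  · rw [bcost_self]; exact Real.exp_pos _
  · refine lt_of_le_of_lt ?_ (Real.exp_lt_exp.2 (neg_lt_neg (hb.2.trans_lt h)))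
    by_cases h : a = a'
    · subst h; rw [bcost_self]; exact (Real.exp_pos _).le
    · rw [bcost_of_ne ht o h]

/-- The connected components of the complement of a point of a tree. -/
lemma mem_connectedComponentIn_compl_singleton (ht : IsRealTree X) {x y : X} (hy : y ≠ x) (z : X) :
    z ∈ connectedComponentIn {x}ᶜ y ↔ 0 < gpr x y z := by
  have hself : ∀ w, w ≠ x → 0 < gpr x w w := fun w hw => by
    unfold gpr
    rw [dist_self]
    have : 0 < dist x w := dist_pos.2 hw.symm
    linarith
  constructor
  · intro hz
    have hopen : ∀ w, IsOpen {z | 0 < gpr x w z} := fun w => by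
      refine isOpen_lt continuous_const ?_
      unfold gpr
      fun_prop
    refine isPreconnected_connectedComponentIn.subset_left_of_subset_union (hopen y)
      (isOpen_biUnion (s := {w | w ≠ x ∧ ¬ 0 < gpr x y w}) fun w _ => hopen w) ?_ ?_ ?_ hz
    · refine Set.disjoint_left.2 fun z hz hz' => ?_
      simp only [mem_iUnion] at hz'
      obtain ⟨w, hw, hzw⟩ := hz'
      exact hw.2 (ht.gpr_pos z hz (by rw [gpr_comm]; exact hzw))
    · intro w hw
      have hw' := connectedComponentIn_subset _ _ hw
      by_cases h : 0 < gpr x y w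
      · exact Or.inl h
      · exact Or.inr (mem_biUnion (show w ∈ {w | w ≠ x ∧ ¬ 0 < gpr x y w} from ⟨hw', h⟩)
          (hself w hw'))
    · exact ⟨y, mem_connectedComponentIn hy, hself y hy⟩
  · intro hz
    obtain ⟨γ, h0, h1, hγ⟩ := ht.1 y z
    have hcont : ContinuousOn γ (Icc 0 1) := by
      have : LipschitzOnWith (nndist y z) γ (Icc 0 1) :=
        LipschitzOnWith.of_dist_le_mul fun s hs t hst => by
          rw [hγ s hs t hst, Real.dist_eq, coe_nndist]
      exact this.continuousOn
    have hconn := isPreconnected_Icc.image γ hcont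
    refine (hconn.subset_connectedComponentIn ⟨0, by simp, h0⟩ ?_) ⟨1, by simp, h1⟩
    rintro _ ⟨t, hts, rfl⟩ hx
    have e1 := hγ 0 (by simp) t hts
    have e2 := hγ t hts 1 (by simp)
    rw [h0, zero_sub, abs_neg, abs_of_nonneg hts.1, show γ t = x from hx] at e1
    rw [h1, abs_sub_comm, abs_of_nonneg (by linarith [hts.2]), show γ t = x from hx] at e2
    unfold gpr at hz
    rw [dist_comm x y] at hz
    nlinarith

lemma mem_compBdry_iff (ht : IsRealTree X) {x y : X} (hy : y ≠ x) (ξ : Boundary X) :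
    ξ ∈ compBdry (connectedComponentIn {x}ᶜ y) ↔ 0 < gpr x y (bray ht x ξ 1) := by
  have key : ∀ t, 1 ≤ t → (bray ht x ξ t ∈ connectedComponentIn {x}ᶜ y ↔
      0 < gpr x y (bray ht x ξ 1)) := by
    intro t h1
    have h2 : 0 < gpr x (bray ht x ξ 1) (bray ht x ξ t) := by
      rw [gpr_bray_bray ht x ξ zero_le_one h1]; exact one_pos
    rw [mem_connectedComponentIn_compl_singleton ht hy]
    exact ⟨fun h => ht.gpr_pos _ h (by rwa [gpr_comm]), fun h => ht.gpr_pos _ h h2⟩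
  constructor
  · intro h
    obtain ⟨T, hT⟩ := h (baseRay ht x ξ) (mk_baseRay ht x ξ)
    exact (key _ (by push_cast; exact le_max_right _ _)).1 (hT (max T 1) (le_max_left _ _))
  · rintro h γ rfl
    obtain ⟨a, ha⟩ := exists_eq_bray_tail ht x γ
    refine ⟨nndist x (γ.1 0) + Real.toNNReal (1 - a), fun t htt => ?_⟩
    have h1 : (nndist x (γ.1 0) : ℝ) + Real.toNNReal (1 - a) ≤ t := by exact_mod_cast htt
    rw [coe_nndist] at h1
    have h2 := (ha t ((le_add_of_nonneg_right (NNReal.coe_nonneg _)).trans h1)).2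
    rw [h2, key]
    · exact h
    · linarith [Real.le_coe_toNNReal (1 - a), dist_nonneg (x := x) (y := γ.1 0)]

lemma compBdry_eq_dirClass (ht : IsRealTree X) {x : X} {C : Set X} (hC : C ∈ treeComps x)
    {ξ : Boundary X} (hξ : ξ ∈ compBdry C) : compBdry C = dirClass ht x ξ := by
  obtain ⟨y, hy, rfl⟩ := hC
  rw [mem_compBdry_iff ht hy] at hξ
  ext ζ
  rw [mem_compBdry_iff ht hy]
  exact ⟨fun h => ht.gpr_pos y (by rwa [gpr_comm]) h, fun h => ht.gpr_pos _ hξ h⟩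

lemma exists_treeComp (ht : IsRealTree X) (x : X) (ξ : Boundary X) :
    ∃ C ∈ treeComps x, compBdry C = dirClass ht x ξ := by
  have hne : bray ht x ξ 1 ≠ x := fun h => by
    have := dist_bray ht x ξ zero_le_one
    rw [h, dist_self] at this
    exact zero_ne_one this
  refine ⟨_, ⟨_, hne, rfl⟩, ?_⟩
  ext ζ
  rw [mem_compBdry_iff ht hne]
  rfl

lemma compBdry_component_base (ht : IsRealTree X) {o x : X} (h : x ≠ o) :
    compBdry (connectedComponentIn {x}ᶜ o) = (shadow ht o x)ᶜ := by
  ext ξ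
  rw [mem_compBdry_iff ht h.symm, mem_compl_iff, mem_shadow_iff_gpr]
  exact ⟨fun h => h.ne', fun h => lt_of_le_of_ne (gpr_nonneg _ _ _) (Ne.symm h)⟩

lemma posBdrySet_eq (ht : IsRealTree X) (νm νp : Measure (Boundary X)) (x : X) :
    posBdrySet νm νp x = {ξ | 0 < sflow νm νp (dirClass ht x ξ)} := by
  ext ξ
  simp only [posBdrySet, mem_iUnion, exists_prop]
  constructor
  · rintro ⟨C, hC, hpos, hξ⟩
    rwa [compBdry_eq_dirClass ht hC hξ] at hpos
  · intro h
    obtain ⟨C, hC, e⟩ := exists_treeComp ht x ξ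
    refine ⟨C, hC, ?_, ?_⟩
    · rw [e]; exact h
    · rw [e]; exact mem_dirClass_self ht x ξ

lemma sflow_comm (νm νp : Measure (Boundary X)) (S : Set (Boundary X)) :
    sflow νp νm S = -sflow νm νp S := by
  unfold sflow; ring

lemma negBdrySet_eq (νm νp : Measure (Boundary X)) (x : X) :
    negBdrySet νm νp x = posBdrySet νp νm x := by
  unfold negBdrySet posBdrySet
  simp only [sflow_comm νm νp, Left.neg_pos_iff]

/-- The pairs of boundary points whose rays from `o` separate exactly at `x`. -/
def branchSet (ht : IsRealTree X) (o x : X) : Set (Boundary X × Boundary X) :=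
  {p | p.1 ∈ shadow ht o x ∧ p.2 ∈ shadow ht o x ∧ p.2 ∉ dirClass ht x p.1}

lemma bgp_of_mem_branchSet (ht : IsRealTree X) {o x : X} {p : Boundary X × Boundary X}
    (h : p ∈ branchSet ht o x) : p.1 ≠ p.2 ∧ bgp ht o p.1 p.2 = dist o x ∧
      bray ht o p.1 (bgp ht o p.1 p.2) = x := by
  obtain ⟨h1, h2, h3⟩ := h
  rw [mem_dirClass_iff_of_mem_shadow ht h1] at h3
  push Not at h3
  have h4 := (bray_eq_iff ht o h3.1 dist_nonneg).1 (Eq.trans h1 (Eq.symm h2))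
  have e := le_antisymm h3.2 h4
  exact ⟨h3.1, e, by rw [e]; exact h1⟩

lemma mem_branchSet (ht : IsRealTree X) (o : X) {p : Boundary X × Boundary X} (h : p.1 ≠ p.2) :
    p ∈ branchSet ht o (bray ht o p.1 (bgp ht o p.1 p.2)) := by
  have hb := bgp_nonneg ht o p.1 p.2
  have h1 : p.1 ∈ shadow ht o (bray ht o p.1 (bgp ht o p.1 p.2)) :=
    (mem_shadow_bray ht o hb).2 rfl
  refine ⟨h1, (mem_shadow_bray ht o hb).2 (bray_bgp_eq ht o _ _).symm, ?_⟩
  rw [mem_dirClass_iff_of_mem_shadow ht h1, dist_bray ht o _ hb]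
  simp [h]

lemma isOpen_branchSet (ht : IsRealTree X) (o x : X) : IsOpen (branchSet ht o x) := by
  rw [isOpen_iff_forall_mem_open]
  rintro ⟨ξ, ζ⟩ ⟨h1, h2, h3⟩
  refine ⟨dirClass ht x ξ ×ˢ dirClass ht x ζ, ?_,
    (isOpen_dirClass ht x ξ).prod (isOpen_dirClass ht x ζ),
    ⟨mem_dirClass_self ht x ξ, mem_dirClass_self ht x ζ⟩⟩
  rintro ⟨α, β⟩ ⟨hα, hβ⟩
  refine ⟨mem_shadow_of_mem_dirClass ht h1 hα, mem_shadow_of_mem_dirClass ht h2 hβ, ?_⟩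
  rw [dirClass_eq ht hα]
  intro h
  refine h3 ?_
  rw [← dirClass_eq ht h, dirClass_eq ht hβ]
  exact mem_dirClass_self ht x ζ

lemma isTreeVertex_of_branchSet (ht : IsRealTree X) {o x : X} (hx : x ≠ o)
    (h : (branchSet ht o x).Nonempty) : IsTreeVertex x := by
  obtain ⟨⟨ξ, ζ⟩, h1, h2, h3⟩ := h
  simp only at h1 h2 h3
  have hne : ∀ ξ, bray ht x ξ 1 ≠ x := fun ξ h => by
    have := dist_bray ht x ξ zero_le_one
    rw [h, dist_self] at this
    exact zero_ne_one this
  have key : ∀ y z, y ≠ x → z ≠ x → ¬ 0 < gpr x y z →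
      connectedComponentIn {x}ᶜ y ≠ connectedComponentIn {x}ᶜ z := by
    intro y z hy hz h e
    rw [← mem_connectedComponentIn_compl_singleton ht hy, e] at h
    exact h (mem_connectedComponentIn hz)
  refine ⟨_, _, _, ⟨_, hx.symm, rfl⟩, ⟨_, hne ξ, rfl⟩, ⟨_, hne ζ, rfl⟩, key _ _ hx.symm (hne ξ) ?_,
    key _ _ (hne ξ) (hne ζ) h3, key _ _ hx.symm (hne ζ) ?_⟩
  · rw [(mem_shadow_iff_gpr ht o x ξ).1 h1]; exact lt_irrefl _
  · rw [(mem_shadow_iff_gpr ht o x ζ).1 h2]; exact lt_irrefl _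

end Directions

/-! ## The specific flow measures branching pairs -/

section Flow

/-- For a coupling without crossings along the classes of a partition of `S`, the mass of the pairs
joining different classes is the total flow through the classes of positive flow. -/
lemma toReal_measure_ne_class {C : Type*} [MeasurableSpace C] {π : Measure (C × C)}
    {μ ν : Measure C} [IsProbabilityMeasure π] (hπ : IsCoupling π μ ν) {S : Set C}
    {cls : C → Set C} (hself : ∀ ξ, ξ ∈ cls ξ) (hsub : ∀ ξ ∈ S, cls ξ ⊆ S)
    (heq : ∀ ξ, ∀ ζ ∈ cls ξ, cls ζ = cls ξ) (hmeas : ∀ ξ, MeasurableSet (cls ξ))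
    (hcount : (cls '' S).Countable) (hnc : ∀ ξ ∈ S, NonCrossing π (cls ξ))
    (h0 : π (Sᶜ ×ˢ S) = 0) :
    (π {p | p.1 ∈ S ∧ p.2 ∈ S ∧ p.2 ∉ cls p.1}).toReal =
      (ν {ξ ∈ S | 0 < (ν (cls ξ)).toReal - (μ (cls ξ)).toReal}).toReal -
        (μ {ξ ∈ S | 0 < (ν (cls ξ)).toReal - (μ (cls ξ)).toReal}).toReal := by
  set P := {ξ ∈ S | 0 < (ν (cls ξ)).toReal - (μ (cls ξ)).toReal} with hP
  have hPm : MeasurableSet P := by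
    have e : P = ⋃₀ {D ∈ cls '' S | 0 < (ν D).toReal - (μ D).toReal} := by
      ext ξ
      constructor
      · rintro ⟨h1, h2⟩
        exact ⟨cls ξ, ⟨⟨ξ, h1, rfl⟩, h2⟩, hself ξ⟩
      · rintro ⟨_, ⟨⟨ζ, h1, rfl⟩, h2⟩, h3⟩
        exact ⟨hsub ζ h1 h3, by rw [heq ζ ξ h3]; exact h2⟩
    rw [e]
    refine MeasurableSet.sUnion (hcount.mono (sep_subset _ _)) ?_
    rintro _ ⟨⟨ζ, h1, rfl⟩, h2⟩
    exact hmeas ζ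
  have hdiff : ∀ D, MeasurableSet D →
      (ν D).toReal - (μ D).toReal = (π (Dᶜ ×ˢ D)).toReal - (π (D ×ˢ Dᶜ)).toReal := by
    intro D hD
    rw [hπ.left_eq_add hD, hπ.right_eq_add hD, ENNReal.toReal_add (by finiteness) (by finiteness),
      ENNReal.toReal_add (by finiteness) (by finiteness)]
    ring
  have hAE : ∀ᵐ p ∂π, ∀ D ∈ cls '' S, (0 < (ν D).toReal - (μ D).toReal → p.1 ∈ D → p.2 ∈ D) ∧
      (¬ 0 < (ν D).toReal - (μ D).toReal → p.2 ∈ D → p.1 ∈ D) := by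
    rw [ae_ball_iff hcount]
    rintro _ ⟨ξ, hξ, rfl⟩
    rw [hdiff _ (hmeas ξ)]
    by_cases hpos : 0 < (π ((cls ξ)ᶜ ×ˢ cls ξ)).toReal - (π (cls ξ ×ˢ (cls ξ)ᶜ)).toReal
    · have hz : π (cls ξ ×ˢ (cls ξ)ᶜ) = 0 := by
        refine (hnc ξ hξ).resolve_right fun h => ?_
        rw [h] at hpos
        simp only [ENNReal.toReal_zero, zero_sub, Left.neg_pos_iff] at hpos
        exact absurd hpos (not_lt.2 ENNReal.toReal_nonneg)
      filter_upwards [measure_eq_zero_iff_ae_notMem.1 hz] with p hp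
      refine ⟨fun _ h1 => ?_, fun h => absurd hpos h⟩
      by_contra h2
      exact hp ⟨h1, h2⟩
    · have hz : π ((cls ξ)ᶜ ×ˢ cls ξ) = 0 := by
        refine (hnc ξ hξ).elim (fun h => ?_) id
        rw [h, ENNReal.toReal_zero, sub_zero] at hpos
        by_contra hne
        exact hpos (ENNReal.toReal_pos hne (by finiteness))
      filter_upwards [measure_eq_zero_iff_ae_notMem.1 hz] with p hp
      refine ⟨fun h => absurd h hpos, fun _ h1 => ?_⟩
      by_contra h2
      exact hp ⟨h2, h1⟩
  have hS : ∀ᵐ p ∂π, p.2 ∈ S → p.1 ∈ S := by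
    filter_upwards [measure_eq_zero_iff_ae_notMem.1 h0] with p hp h2
    by_contra h1
    exact hp ⟨h1, h2⟩
  have e1 : π {p | p.1 ∈ S ∧ p.2 ∈ S ∧ p.2 ∉ cls p.1} = π (Pᶜ ×ˢ P) := by
    refine measure_congr ?_
    filter_upwards [hAE, hS] with p hp hpS
    refine propext ⟨?_, ?_⟩
    · rintro ⟨h1, h2, h3⟩
      refine ⟨fun h => h3 ?_, h2, ?_⟩
      · exact (hp _ ⟨p.1, h1, rfl⟩).1 h.2 (hself _)
      · by_contra h
        have := (hp _ ⟨p.2, h2, rfl⟩).2 h (hself _)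
        exact h3 (by rw [heq _ _ this]; exact hself _)
    · rintro ⟨h1, h2⟩
      refine ⟨hpS h2.1, h2.1, fun h => h1 ⟨hpS h2.1, ?_⟩⟩
      rw [← heq _ _ h]
      exact h2.2
  have e2 : π (P ×ˢ Pᶜ) = 0 := by
    refine measure_eq_zero_iff_ae_notMem.2 ?_
    filter_upwards [hAE] with p hp
    rintro ⟨h1, h2⟩
    have h3 := (hp _ ⟨p.1, h1.1, rfl⟩).1 h1.2 (hself _)
    exact h2 ⟨hsub _ h1.1 h3, by rw [heq _ _ h3]; exact h1.2⟩
  rw [hdiff P hPm, e1, e2]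
  simp

lemma IsCoupling.swap {A B : Type*} [MeasurableSpace A] [MeasurableSpace B]
    {π : Measure (A × B)} {μ : Measure A} {ν : Measure B} (hπ : IsCoupling π μ ν) :
    IsCoupling (π.map Prod.swap) ν μ := by
  constructor
  · rw [Measure.map_map measurable_fst measurable_swap]
    exact hπ.2
  · rw [Measure.map_map measurable_snd measurable_swap]
    exact hπ.1

lemma NonCrossing.swap {C : Type*} [MeasurableSpace C] {π : Measure (C × C)} {D : Set C}
    (h : NonCrossing π D) (hD : MeasurableSet D) : NonCrossing (π.map Prod.swap) D := by
  unfold NonCrossing at h ⊢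
  rw [Measure.map_apply measurable_swap (hD.prod hD.compl),
    Measure.map_apply measurable_swap (hD.compl.prod hD), preimage_swap_prod, preimage_swap_prod]
  exact h.symm

variable {X : Type*} [MetricSpace X]

lemma countable_image_dirClass [SecondCountableTopology (Boundary X)] (ht : IsRealTree X) (x : X)
    (S : Set (Boundary X)) : (dirClass ht x '' S).Countable := by
  refine Set.PairwiseDisjoint.countable_of_isOpen (s := id) ?_ ?_ ?_
  · rintro _ ⟨ξ, -, rfl⟩ _ ⟨ζ, -, rfl⟩ hne
    refine Set.disjoint_left.2 fun η h1 h2 => hne ?_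
    exact (dirClass_eq ht h1).symm.trans (dirClass_eq ht h2)
  · rintro _ ⟨ξ, -, rfl⟩
    exact isOpen_dirClass ht x ξ
  · rintro _ ⟨ξ, -, rfl⟩
    exact ⟨ξ, mem_dirClass_self ht x ξ⟩

lemma toReal_measure_branchSet [SecondCountableTopology (Boundary X)] (ht : IsRealTree X) (o : X)
    {νm νp : Measure (Boundary X)} {π : Measure (Boundary X × Boundary X)}
    [IsProbabilityMeasure π] (hπ : IsCoupling π νm νp)
    (hnc : ∀ S, MeasurableSet S → IsCluster ht o S → NonCrossing π S) (x : X)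
    (h0 : π ((shadow ht o x)ᶜ ×ˢ shadow ht o x) = 0) :
    (π (branchSet ht o x)).toReal = sflow νm νp (posBdrySet νm νp x ∩ shadow ht o x) := by
  have h := toReal_measure_ne_class hπ (S := shadow ht o x) (cls := dirClass ht x)
    (mem_dirClass_self ht x) (fun ξ hξ ζ hζ => mem_shadow_of_mem_dirClass ht hξ hζ)
    (fun ξ ζ h => dirClass_eq ht h) (fun ξ => (isOpen_dirClass ht x ξ).measurableSet)
    (countable_image_dirClass ht x _)
    (fun ξ hξ => hnc _ (isOpen_dirClass ht x ξ).measurableSet (isCluster_dirClass ht hξ)) h0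
  rw [posBdrySet_eq ht, inter_comm]
  exact h

lemma specificFlow_eq [SecondCountableTopology (Boundary X)] (ht : IsRealTree X) (o : X)
    {νm νp : Measure (Boundary X)} {π : Measure (Boundary X × Boundary X)}
    [IsProbabilityMeasure π] (hπ : IsCoupling π νm νp)
    (hnc : ∀ S, MeasurableSet S → IsCluster ht o S → NonCrossing π S) (x : X) :
    specificFlow νm νp o x = (π (branchSet ht o x)).toReal := by
  have hSm := measurableSet_shadow ht o x
  unfold specificFlow
  split_ifs with hx hpos hneg
  · subst hx
    have hu : shadow ht x x = univ := by
      refine eq_univ_of_forall fun ξ => ?_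
      change bray ht x ξ (dist x x) = x
      rw [dist_self, bray_zero]
    rw [toReal_measure_branchSet ht x hπ hnc x (by rw [hu]; simp), hu, inter_univ]
    rfl
  all_goals
    rw [compBdry_component_base ht hx] at *
    have hfl : sflow νm νp (shadow ht o x)ᶜ =
        (π (shadow ht o x ×ˢ (shadow ht o x)ᶜ)).toReal -
          (π ((shadow ht o x)ᶜ ×ˢ shadow ht o x)).toReal := by
      unfold sflow
      rw [hπ.left_eq_add hSm.compl, hπ.right_eq_add hSm.compl, compl_compl,
        ENNReal.toReal_add (by finiteness) (by finiteness),
        ENNReal.toReal_add (by finiteness) (by finiteness)]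
      ring
    have hncS := hnc _ hSm (isCluster_shadow ht o x)
  · rw [sdiff_compl, toReal_measure_branchSet ht o hπ hnc x]
    refine hncS.resolve_left fun h => ?_
    rw [hfl, h, ENNReal.toReal_zero, zero_sub, Left.neg_pos_iff] at hpos
    exact absurd hpos (not_lt.2 ENNReal.toReal_nonneg)
  · have hz : π (shadow ht o x ×ˢ (shadow ht o x)ᶜ) = 0 := by
      refine hncS.resolve_right fun h => ?_
      rw [hfl, h, ENNReal.toReal_zero, sub_zero] at hneg
      exact absurd hneg (not_lt.2 ENNReal.toReal_nonneg)
    have : IsProbabilityMeasure (π.map Prod.swap) :=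
      Measure.isProbabilityMeasure_map measurable_swap.aemeasurable
    have h := toReal_measure_branchSet ht o hπ.swap (fun S hS hc => (hnc S hS hc).swap hS) x (by
      rw [Measure.map_apply measurable_swap (hSm.compl.prod hSm), preimage_swap_prod]
      exact hz)
    rw [Measure.map_apply measurable_swap (isOpen_branchSet ht o x).measurableSet] at h
    rw [← sflow_comm, negBdrySet_eq, sdiff_compl, ← h]
    congr 2
    ext p
    have hs : p.2 ∉ dirClass ht x p.1 ↔ p.1 ∉ dirClass ht x p.2 :=
      not_congr ⟨fun h => by rw [dirClass_eq ht h]; exact mem_dirClass_self ht x _,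
        fun h => by rw [dirClass_eq ht h]; exact mem_dirClass_self ht x _⟩
    simp only [branchSet, mem_preimage, mem_ofPred_eq, Prod.fst_swap, Prod.snd_swap]
    rw [hs]
    tauto
  · have hz : sflow νm νp (shadow ht o x)ᶜ = 0 := le_antisymm (not_lt.1 hpos) (not_lt.1 hneg)
    rw [toReal_measure_branchSet ht o hπ hnc x]
    · unfold flowAt
      congr 1
      refine (inter_eq_left.2 fun ξ hξ => ?_).symm
      by_contra hξS
      rw [posBdrySet_eq ht] at hξ
      have hξ' : ξ ∈ compBdry (connectedComponentIn {x}ᶜ o) := by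
        rw [compBdry_component_base ht hx]; exact hξS
      have e := compBdry_eq_dirClass ht ⟨o, Ne.symm hx, rfl⟩ hξ'
      rw [compBdry_component_base ht hx] at e
      rw [mem_ofPred_eq, ← e, hz] at hξ
      exact lt_irrefl _ hξ
    · refine hncS.elim (fun h => ?_) id
      rw [hfl, h, ENNReal.toReal_zero, zero_sub, neg_eq_zero, ENNReal.toReal_eq_zero_iff] at hz
      exact hz.resolve_right (by finiteness)

lemma D0cost_eq_tsum [SecondCountableTopology (Boundary X)] (ht : IsRealTree X) (o : X)
    {π : Measure (Boundary X × Boundary X)} (hne : ∀ᵐ p ∂π, p.1 ≠ p.2) :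
    D0cost o π = ∑' x : {x : X // IsTreeVertex x},
      π (branchSet ht o x.1) * ENNReal.ofReal (dist x.1 o ^ 2) := by
  set f : X → ℝ≥0∞ := fun x => π (branchSet ht o x) * ENNReal.ofReal (dist x o ^ 2) with hf
  set T : Set X := {x | (branchSet ht o x).Nonempty ∧ x ≠ o} with hT
  have hTc : T.Countable := by
    refine Set.PairwiseDisjoint.countable_of_isOpen (s := branchSet ht o) ?_
      (fun x _ => isOpen_branchSet ht o x) fun x hx => hx.1
    intro x _ y _ hxy
    refine Set.disjoint_left.2 fun p h1 h2 => hxy ?_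
    rw [← (bgp_of_mem_branchSet ht h1).2.2, (bgp_of_mem_branchSet ht h2).2.2]
  have hsum : ∑' x : {x : X // IsTreeVertex x}, f x.1 = ∑' x : T, f x := by
    refine ((tsum_subtype {x | IsTreeVertex x} f).trans ?_).trans (tsum_subtype T f).symm
    congr 1
    ext x
    by_cases hx : x ∈ T
    · rw [indicator_of_mem hx, indicator_of_mem (s := {x | IsTreeVertex x})
        (isTreeVertex_of_branchSet ht hx.2 hx.1)]
    · rw [indicator_of_notMem hx]
      have : f x = 0 := by
        by_cases hxo : x = o
        · simp [hf, hxo]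
        · have : branchSet ht o x = ∅ := not_nonempty_iff_eq_empty.1 fun h => hx ⟨h, hxo⟩
          simp [hf, this]
      simp [indicator, this]
  have := hTc.to_subtype
  rw [hsum, D0cost_eq_lintegral_bgp ht]
  calc ∫⁻ p, ENNReal.ofReal (bgp ht o p.1 p.2 ^ 2) ∂π
      = ∫⁻ p, ∑' x : T, (branchSet ht o x.1).indicator
          (fun _ => ENNReal.ofReal (dist x.1 o ^ 2)) p ∂π := by
        refine lintegral_congr_ae ?_
        filter_upwards [hne] with p hp
        have hmem := mem_branchSet ht o hp
        have hdist := dist_bray ht o p.1 (bgp_nonneg ht o p.1 p.2)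
        by_cases hb : bray ht o p.1 (bgp ht o p.1 p.2) = o
        · rw [hb, dist_self] at hdist
          rw [← hdist]
          refine Eq.symm ?_
          rw [zero_pow two_ne_zero, ENNReal.ofReal_zero, ENNReal.tsum_eq_zero]
          rintro ⟨x, hx⟩
          refine indicator_of_notMem (fun h => hx.2 ?_) _
          exact (bgp_of_mem_branchSet ht h).2.2.symm.trans hb
        · rw [tsum_eq_single ⟨_, ⟨p, hmem⟩, hb⟩]
          · rw [indicator_of_mem hmem, dist_comm, hdist]
          · rintro ⟨x, hx⟩ hne'
            refine indicator_of_notMem (fun h => hne' (Subtype.ext ?_)) _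
            exact (bgp_of_mem_branchSet (x := x) ht h).2.2.symm
    _ = ∑' x : T, f x := by
        have hmeas : ∀ x : T, AEMeasurable ((branchSet ht o x.1).indicator
            (fun _ => ENNReal.ofReal (dist x.1 o ^ 2))) π := fun x =>
          (measurable_const.indicator (isOpen_branchSet ht o x.1).measurableSet).aemeasurable
        rw [lintegral_tsum hmeas]
        refine tsum_congr fun x => ?_
        rw [lintegral_indicator (isOpen_branchSet ht o x.1).measurableSet, setLIntegral_const,
          mul_comm]

lemma D0cost_lt_top_iff_summable [SecondCountableTopology (Boundary X)] (ht : IsRealTree X) (o : X)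
    {νm νp : Measure (Boundary X)} {π : Measure (Boundary X × Boundary X)}
    [IsProbabilityMeasure π] (hπ : IsCoupling π νm νp) (hne : ∀ᵐ p ∂π, p.1 ≠ p.2)
    (hnc : ∀ S, MeasurableSet S → IsCluster ht o S → NonCrossing π S) :
    D0cost o π < ⊤ ↔ Summable (fun x : {x : X // IsTreeVertex x} =>
        specificFlow νm νp o x.1 * dist x.1 o ^ 2) := by
  set g : {x : X // IsTreeVertex x} → ℝ≥0 := fun x =>
    (π (branchSet ht o x.1)).toNNReal * Real.toNNReal (dist x.1 o ^ 2) with hg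
  have e1 : D0cost o π = ∑' x, (g x : ℝ≥0∞) := by
    rw [D0cost_eq_tsum ht o hne]
    refine tsum_congr fun x => ?_
    rw [hg, ENNReal.coe_mul, ENNReal.coe_toNNReal (by finiteness)]
    rfl
  have e2 : (fun x : {x : X // IsTreeVertex x} => specificFlow νm νp o x.1 * dist x.1 o ^ 2) =
      fun x => (g x : ℝ) := by
    ext x
    rw [specificFlow_eq ht o hπ hnc, hg, NNReal.coe_mul, Real.coe_toNNReal _ (sq_nonneg _)]
    rfl
  rw [e1, e2, NNReal.summable_coe, lt_top_iff_ne_top, ENNReal.tsum_coe_ne_top_iff_summable]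

end Flow

/-! ## Ends of unit speed lines, as measurable maps -/

section Ends

variable {X : Type*} [MetricSpace X]

lemma GeoLine.dist_eq_of_unit (γ : GeoLine X) (h : dist (γ.1 0) (γ.1 1) = 1) (s t : ℝ) :
    dist (γ.1 s) (γ.1 t) = |s - t| := by
  obtain ⟨v, -, hv⟩ := γ.2
  have hv1 : v = 1 := by rw [hv] at h; simpa using h
  rw [hv, hv1, one_mul]

open Classical in
/-- The point at infinity reached by a unit speed line at `+∞` (`b` for other geodesics). -/
def plusEnd (b : Boundary X) (γ : GeoLine X) : Boundary X :=
  if h : dist (γ.1 0) (γ.1 1) = 1 then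
    Quotient.mk (unitRaySetoid X) (fwdRay ⟨γ.1, γ.dist_eq_of_unit h⟩) else b

open Classical in
/-- The point at infinity reached by a unit speed line at `-∞` (`b` for other geodesics). -/
def minusEnd (b : Boundary X) (γ : GeoLine X) : Boundary X :=
  if h : dist (γ.1 0) (γ.1 1) = 1 then
    Quotient.mk (unitRaySetoid X) (bwdRay ⟨γ.1, γ.dist_eq_of_unit h⟩) else b

lemma lineConnects_ends (b : Boundary X) {γ : GeoLine X} (h : dist (γ.1 0) (γ.1 1) = 1) :
    LineConnects γ.1 (minusEnd b γ) (plusEnd b γ) := by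
  unfold minusEnd plusEnd
  rw [dif_pos h, dif_pos h]
  exact lineConnects_unitLine ⟨γ.1, γ.dist_eq_of_unit h⟩

lemma LineConnects.plusEnd_eq (b : Boundary X) {γ : GeoLine X} {ξ ζ : Boundary X}
    (h : LineConnects γ.1 ξ ζ) : plusEnd b γ = ζ := by
  have h1 : dist (γ.1 0) (γ.1 1) = 1 := by rw [h.1]; simp
  unfold plusEnd
  rw [dif_pos h1]
  exact LineConnects.mk_fwdRay (g := ⟨γ.1, γ.dist_eq_of_unit h1⟩) h

lemma LineConnects.minusEnd_eq (b : Boundary X) {γ : GeoLine X} {ξ ζ : Boundary X}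
    (h : LineConnects γ.1 ξ ζ) : minusEnd b γ = ξ := by
  have h1 : dist (γ.1 0) (γ.1 1) = 1 := by rw [h.1]; simp
  unfold minusEnd
  rw [dif_pos h1]
  exact LineConnects.mk_bwdRay (g := ⟨γ.1, γ.dist_eq_of_unit h1⟩) h

lemma rayEnd_of_unit (γ : RaySpace X) (β : UnitRay X) (h : γ.1 = β.1) :
    rayEnd γ = coneMk (Quotient.mk (unitRaySetoid X) β) 1 := by
  have h1 : raySpeed γ = 1 := by
    ext
    rw [raySpeed, coe_nndist, h, β.2, NNReal.dist_eq]
    simp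
  have h0 : raySpeed γ ≠ 0 := by rw [h1]; exact one_ne_zero
  have e : rayUnit γ h0 = β := by
    apply Subtype.ext
    funext t
    change γ.1 (t / raySpeed γ) = β.1 t
    rw [h1, div_one, h]
  rw [rayEnd, dif_neg h0, h1, e]

lemma lineEndPlus_eq (b : Boundary X) {γ : GeoLine X} (h : dist (γ.1 0) (γ.1 1) = 1) :
    lineEndPlus γ = coneMk (plusEnd b γ) 1 := by
  unfold plusEnd lineEndPlus
  rw [dif_pos h]
  exact rayEnd_of_unit _ _ rfl

lemma lineEndMinus_eq (b : Boundary X) {γ : GeoLine X} (h : dist (γ.1 0) (γ.1 1) = 1) :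
    lineEndMinus γ = coneMk (minusEnd b γ) 1 := by
  unfold minusEnd lineEndMinus
  rw [dif_pos h]
  exact rayEnd_of_unit _ _ rfl

lemma coneSpeed_rayEnd (γ : RaySpace X) : coneSpeed (rayEnd γ) = raySpeed γ := by
  unfold rayEnd
  split_ifs with h
  · rw [h]; rfl
  · rfl

lemma continuous_coneSpeed (B : Type*) [TopologicalSpace B] :
    Continuous (coneSpeed : Cone B → ℝ≥0) := by
  refine continuous_coinduced_dom.2 (continuous_sum_dom.2 ⟨?_, ?_⟩)
  · exact continuous_snd
  · exact continuous_const

lemma continuous_coneMk_one (B : Type*) [TopologicalSpace B] :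
    Continuous (fun b : B => coneMk b 1) :=
  continuous_coinduced_rng.comp (continuous_inl.comp (by fun_prop))

lemma coneMk_eq_iff {B : Type*} {b b' : B} {s s' : ℝ≥0} (h : s' ≠ 0) :
    coneMk b s = coneMk b' s' ↔ b = b' ∧ s = s' := by
  constructor
  · intro e
    rcases Quotient.exact e with e | ⟨-, e⟩
    · simpa using e
    · exact absurd e h
  · rintro ⟨rfl, rfl⟩
    rfl

lemma isOpen_openCone {B : Type*} [TopologicalSpace B] {U : Set B} (hU : IsOpen U) :
    IsOpen {c : Cone B | ∃ b ∈ U, ∃ s, s ≠ 0 ∧ c = coneMk b s} := by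
  refine isOpen_coinduced.2 (isOpen_sum_iff.2 ⟨?_, ?_⟩)
  · convert hU.prod (isOpen_ne (x := (0 : ℝ≥0))) using 1
    ext ⟨b, s⟩
    constructor
    · rintro ⟨b', hb', s', hs', e⟩
      obtain ⟨rfl, rfl⟩ := (coneMk_eq_iff hs').1 e
      exact ⟨hb', hs'⟩
    · rintro ⟨h1, h2⟩
      exact ⟨b, h1, s, h2, rfl⟩
  · convert isOpen_empty using 1
    ext u
    simp only [mem_preimage, mem_ofPred_eq, mem_empty_iff_false, iff_false]
    rintro ⟨b, -, s, hs, e⟩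
    rcases Quotient.exact e with e | ⟨-, e⟩
    · cases e
    · exact hs e

lemma eq_of_map_coneMk_eq {μ ν : Measure (Boundary X)} [IsProbabilityMeasure μ]
    [IsProbabilityMeasure ν]
    (h : μ.map (fun b => coneMk b 1) = ν.map (fun b => coneMk b 1)) : μ = ν := by
  have hmeas := (continuous_coneMk_one (Boundary X)).measurable
  refine ext_of_generate_finite {s | IsOpen s} BorelSpace.measurable_eq isPiSystem_isOpen
    (fun U hU => ?_) (by simp)
  have e := congrArg (fun κ => κ {c : Cone (Boundary X) | ∃ b ∈ U, ∃ s, s ≠ 0 ∧ c = coneMk b s}) h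
  have hO := (isOpen_openCone (B := Boundary X) hU).measurableSet
  simp only [Measure.map_apply hmeas hO] at e
  convert e using 2 <;>
  · ext b
    constructor
    · intro hb
      exact ⟨b, hb, 1, one_ne_zero, rfl⟩
    · rintro ⟨b', hb', s, hs, e⟩
      rwa [((coneMk_eq_iff hs).1 e).1]

lemma mk_mem_shadow_iff (ht : IsRealTree X) (o y : X) (γ : UnitRay X) :
    Quotient.mk (unitRaySetoid X) γ ∈ shadow ht o y ↔
      ∃ n : ℕ, ∀ m : ℕ, n ≤ m → OnSeg o y (γ.1 m) := by
  set ξ : Boundary X := Quotient.mk (unitRaySetoid X) γ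
  obtain ⟨a, ha⟩ := exists_eq_bray_tail ht o γ
  obtain ⟨n, hn⟩ := exists_nat_ge (dist o (γ.1 0) + |a| + dist o y)
  have key : ∀ m : ℕ, n ≤ m → dist o y ≤ m + a ∧ γ.1 m = bray ht o ξ (m + a) := by
    intro m hm
    have hm' : (n : ℝ) ≤ m := by exact_mod_cast hm
    have h1 := dist_nonneg (x := o) (y := γ.1 0)
    have h2 := neg_abs_le a
    have h3 := dist_nonneg (x := o) (y := y)
    refine ⟨by linarith, ?_⟩
    have := (ha m (by rw [NNReal.coe_natCast]; linarith [abs_nonneg a])).2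
    rwa [NNReal.coe_natCast] at this
  constructor
  · intro h
    refine ⟨n, fun m hm => ?_⟩
    obtain ⟨h1, h2⟩ := key m hm
    have := onSeg_bray ht o ξ dist_nonneg h1
    rwa [show bray ht o ξ (dist o y) = y from h, ← h2] at this
  · rintro ⟨n', h⟩
    have h' := h (max n n') (le_max_right _ _)
    obtain ⟨h1, h2⟩ := key (max n n') (le_max_left _ _)
    rw [h2] at h'
    refine ht.eq_of_onSeg (onSeg_bray ht o ξ dist_nonneg h1) h' (dist_bray ht o ξ dist_nonneg) ?_
    rw [dist_bray ht o ξ dist_nonneg]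
    unfold gpr
    rw [dist_self, dist_bray ht o ξ (dist_nonneg.trans h1)]
    linarith

lemma measurable_boundary_of_shadow [CompactSpace (Boundary X)] (ht : IsRealTree X) (o : X)
    {A : Type*} [MeasurableSpace A] {f : A → Boundary X}
    (h : ∀ y, MeasurableSet (f ⁻¹' shadow ht o y)) : Measurable f := by
  have e := borel_boundary_eq_generateFrom ht o
  intro S hS
  change MeasurableSet[inferInstance] S at hS
  rw [e] at hS
  refine measurable_generateFrom (f := f) ?_ hS
  intro t htt
  obtain ⟨n, y, -, rfl⟩ := mem_iUnion.1 htt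
  exact h y

lemma measurable_geoLine_eval [MeasurableSpace X] (t : ℝ) :
    Measurable (fun γ : GeoLine X => γ.1 t) :=
  (measurable_pi_apply t).comp measurable_subtype_coe

lemma ae_unitSpeed_of_map_lineEndPlus [MeasurableSpace X] {m : Measure (GeoLine X)}
    {ν : Measure (Boundary X)} [IsProbabilityMeasure ν]
    (h : m.map lineEndPlus = ν.map (fun ξ => coneMk ξ 1)) :
    ∀ᵐ γ ∂m, dist (γ.1 0) (γ.1 1) = 1 := by
  have hmeas := (continuous_coneMk_one (Boundary X)).measurable
  have hae : AEMeasurable lineEndPlus m := by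
    refine AEMeasurable.of_map_ne_zero ?_
    rw [h]
    intro h0
    have := congrArg (fun κ => κ univ) h0
    simp [Measure.map_apply hmeas] at this
  have hS : MeasurableSet {c : Cone (Boundary X) | coneSpeed c = 1} :=
    (isClosed_eq (continuous_coneSpeed _) continuous_const).measurableSet
  have h1 : ∀ᵐ c ∂(m.map lineEndPlus), coneSpeed c = 1 := by
    rw [h]
    exact (ae_map_iff hmeas.aemeasurable hS).2 (ae_of_all _ fun _ => rfl)
  filter_upwards [ae_of_ae_map hae h1] with γ hγ
  rw [lineEndPlus, coneSpeed_rayEnd] at hγ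
  have := congrArg NNReal.toReal hγ
  simpa [raySpeed, lineForward] using this

variable [MeasurableSpace X] [BorelSpace X] [SecondCountableTopology X]

lemma measurableSet_onSeg (o y : X) : MeasurableSet {z | OnSeg o y z} :=
  measurableSet_eq_fun (by fun_prop) (by fun_prop)

lemma measurableSet_unitSpeed : MeasurableSet {γ : GeoLine X | dist (γ.1 0) (γ.1 1) = 1} :=
  measurableSet_eq_fun ((measurable_geoLine_eval 0).dist (measurable_geoLine_eval 1))
    measurable_const

lemma measurable_plusEnd [CompactSpace (Boundary X)] (ht : IsRealTree X) (b : Boundary X) :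
    Measurable (plusEnd b : GeoLine X → Boundary X) := by
  obtain ⟨γ₀, -⟩ := exists_rep b
  let o := γ₀.1 0
  refine measurable_boundary_of_shadow ht o fun y => ?_
  have hM : MeasurableSet {γ : GeoLine X | ∃ n : ℕ, ∀ m : ℕ, n ≤ m → OnSeg o y (γ.1 m)} := by
    have := MeasurableSet.iUnion fun n : ℕ => MeasurableSet.iInter fun m : ℕ =>
      MeasurableSet.iInter fun _ : n ≤ m =>
        measurable_geoLine_eval (m : ℝ) (measurableSet_onSeg o y)
    convert this using 1
    ext γ
    simp
  convert measurableSet_unitSpeed.ite hM (MeasurableSet.const (b ∈ shadow ht o y)) using 1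
  ext γ
  by_cases h : dist (γ.1 0) (γ.1 1) = 1
  · simp only [mem_preimage, plusEnd, dif_pos h, mk_mem_shadow_iff]
    simp [Set.ite, h, fwdRay]
  · simp [plusEnd, h, Set.ite]

lemma measurable_minusEnd [CompactSpace (Boundary X)] (ht : IsRealTree X) (b : Boundary X) :
    Measurable (minusEnd b : GeoLine X → Boundary X) := by
  obtain ⟨γ₀, -⟩ := exists_rep b
  let o := γ₀.1 0
  refine measurable_boundary_of_shadow ht o fun y => ?_
  have hM : MeasurableSet {γ : GeoLine X | ∃ n : ℕ, ∀ m : ℕ, n ≤ m → OnSeg o y (γ.1 (-m))} := by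
    have := MeasurableSet.iUnion fun n : ℕ => MeasurableSet.iInter fun m : ℕ =>
      MeasurableSet.iInter fun _ : n ≤ m =>
        measurable_geoLine_eval (-m : ℝ) (measurableSet_onSeg o y)
    convert this using 1
    ext γ
    simp
  convert measurableSet_unitSpeed.ite hM (MeasurableSet.const (b ∈ shadow ht o y)) using 1
  ext γ
  by_cases h : dist (γ.1 0) (γ.1 1) = 1
  · simp only [mem_preimage, minusEnd, dif_pos h, mk_mem_shadow_iff]
    simp [Set.ite, h, bwdRay]
  · simp [minusEnd, h, Set.ite]

/-- The ends of a measure concentrated on unit speed lines. -/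
lemma map_lineEndPlus_of_ae [CompactSpace (Boundary X)] (ht : IsRealTree X) (b : Boundary X)
    {m : Measure (GeoLine X)} (h : ∀ᵐ γ ∂m, dist (γ.1 0) (γ.1 1) = 1) :
    m.map lineEndPlus = (m.map (plusEnd b)).map (fun ξ => coneMk ξ 1) := by
  rw [Measure.map_map (continuous_coneMk_one _).measurable (measurable_plusEnd ht b)]
  exact Measure.map_congr (h.mono fun γ hγ => lineEndPlus_eq b hγ)

lemma map_lineEndMinus_of_ae [CompactSpace (Boundary X)] (ht : IsRealTree X) (b : Boundary X)
    {m : Measure (GeoLine X)} (h : ∀ᵐ γ ∂m, dist (γ.1 0) (γ.1 1) = 1) :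
    m.map lineEndMinus = (m.map (minusEnd b)).map (fun ξ => coneMk ξ 1) := by
  rw [Measure.map_map (continuous_coneMk_one _).measurable (measurable_minusEnd ht b)]
  exact Measure.map_congr (h.mono fun γ hγ => lineEndMinus_eq b hγ)

end Ends

/-! ## Ends of geodesics of the Wasserstein space -/

section Necessity

lemma sq_add_sq_lt_of_le {u v T k ε : ℝ} (hu : 0 ≤ u) (hv : 0 ≤ v) (huk : u ≤ T + 2 * k)
    (hvk : v ≤ T + 2 * k) (huv : u + v ≤ 2 * T - 2 * ε) (hk : 0 ≤ k) (hT : 0 < T) (hkT : 6 * k ≤ T)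
    (hεT : (2 * k + 2 * ε) ^ 2 + 4 * k ^ 2 < 4 * ε * T) : u ^ 2 + v ^ 2 < T ^ 2 + T ^ 2 := by
  rcases le_total (u + v) (T + 2 * k) with h | h
  · have h1 : (u + v) ^ 2 ≤ (T + 2 * k) ^ 2 := by gcongr
    have h2 : (T + 2 * k) ^ 2 ≤ (4 / 3 * T) ^ 2 := by gcongr; linarith
    nlinarith [mul_nonneg hu hv, mul_pos hT hT]
  · have h1 : 0 ≤ (T + 2 * k - u) * (T + 2 * k - v) :=
      mul_nonneg (sub_nonneg.2 huk) (sub_nonneg.2 hvk)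
    have h2 : (u + v - (T + 2 * k)) ^ 2 ≤ (2 * T - 2 * ε - (T + 2 * k)) ^ 2 := by
      have : 0 ≤ u + v - (T + 2 * k) := sub_nonneg.2 h
      gcongr
    nlinarith

variable {X : Type*} [MetricSpace X]

/-- Pairs at distance `T` whose first point lies beyond `p` and whose second point branches off the
segment from `o` to `p` at depth at least `ε` below `p`. -/
def leavingPairs (o p : X) (T k ε : ℝ) : Set (X × X) :=
  {z | dist z.1 z.2 = T ∧ OnSeg o p z.1 ∧ dist o z.1 ≤ T / 2 + k ∧ dist o z.2 ≤ T / 2 + k ∧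
    gpr o p z.2 ≤ dist o p - ε}

lemma leavingPairs_swap_lt (ht : IsRealTree X) {o p : X} {T k ε : ℝ} (hε : 0 < ε) (hk : 0 ≤ k)
    (hT : 0 < T) (hkT : 6 * k ≤ T) (hεT : (2 * k + 2 * ε) ^ 2 + 4 * k ^ 2 < 4 * ε * T)
    {z w : X × X} (hz : z ∈ leavingPairs o p T k ε) (hw : w.swap ∈ leavingPairs o p T k ε) :
    dist z.1 w.2 ^ 2 + dist w.1 z.2 ^ 2 < dist z.1 z.2 ^ 2 + dist w.1 w.2 ^ 2 := by
  obtain ⟨x, y⟩ := z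
  obtain ⟨x', y'⟩ := w
  obtain ⟨h1, h2, h3, h4, h5⟩ := hz
  obtain ⟨k1, k2, k3, k4, k5⟩ := hw
  simp only [Prod.fst_swap, Prod.snd_swap] at *
  rw [dist_comm] at k1
  rw [h1, k1]
  refine sq_add_sq_lt_of_le dist_nonneg dist_nonneg ?_ ?_ ?_ hk hT hkT hεT
  · linarith [dist_triangle_left x y' o]
  · linarith [dist_triangle_left x' y o]
  · have e1 := h2.gpr_eq
    have e2 := k2.gpr_eq
    have c1 := dist_eq_gpr o x y
    have c2 := dist_eq_gpr o x' y'
    have c3 := dist_eq_gpr o x y'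
    have c4 := dist_eq_gpr o x' y
    have g1 := ht.gpr_ultra o p x y
    have g2 := ht.gpr_ultra o p y' x'
    have g3 := ht.gpr_ultra o x p y'
    have g4 := ht.gpr_ultra o x' p y
    rw [gpr_comm o x p] at g3
    rw [gpr_comm o x' p] at g4
    rw [gpr_comm o y' x'] at g2
    rw [e1] at g1 g3
    rw [e2] at g2 g3
    rw [min_self] at g3
    rcases min_le_iff.1 g1 with g1 | g1
    · linarith
    rcases min_le_iff.1 g2 with g2 | g2
    · linarith
    rcases min_le_iff.1 g4 with g4 | g4 <;> linarith

lemma leavingPairs_mono {o p : X} {T k k' ε ε' : ℝ} (hk : k ≤ k') (hε : ε' ≤ ε) :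
    leavingPairs o p T k ε ⊆ leavingPairs o p T k' ε' := by
  rintro z ⟨h1, h2, h3, h4, h5⟩
  exact ⟨h1, h2, h3.trans (by linarith), h4.trans (by linarith), h5.trans (by linarith)⟩

lemma measurableSet_leavingPairs [MeasurableSpace X] [BorelSpace X] [SecondCountableTopology X]
    (o p : X) (T k ε : ℝ) : MeasurableSet (leavingPairs o p T k ε) := by
  have h1 : IsClosed {z : X × X | dist z.1 z.2 = T} := isClosed_eq (by fun_prop) (by fun_prop)
  have h2 : IsClosed {z : X × X | OnSeg o p z.1} := isClosed_eq (by fun_prop) (by fun_prop)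
  have h3 : IsClosed {z : X × X | dist o z.1 ≤ T / 2 + k} :=
    isClosed_le (by fun_prop) (by fun_prop)
  have h4 : IsClosed {z : X × X | dist o z.2 ≤ T / 2 + k} :=
    isClosed_le (by fun_prop) (by fun_prop)
  have h5 : IsClosed {z : X × X | gpr o p z.2 ≤ dist o p - ε} :=
    isClosed_le (by unfold gpr; fun_prop) (by fun_prop)
  exact (h1.inter (h2.inter (h3.inter (h4.inter h5)))).measurableSet

/-- A unit speed line going from the shadow of `p` to its complement eventually produces leaving
pairs. -/
lemma exists_mem_leavingPairs (ht : IsRealTree X) (o p : X) {g : ℝ → X} {ξ ζ : Boundary X}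
    (h : LineConnects g ξ ζ) (hξ : ξ ∈ shadow ht o p) (hζ : ζ ∉ shadow ht o p) :
    ∃ k : ℕ, ∀ n : ℕ, k ≤ n → (g (-n), g n) ∈ leavingPairs o p (2 * n) k (1 / (k + 1)) := by
  let l : UnitLine X := ⟨g, h.1⟩
  have hξ' := hξ
  rw [← LineConnects.mk_bwdRay (g := l) h, mk_mem_shadow_iff] at hξ'
  obtain ⟨n₁, hn₁⟩ := hξ'
  obtain ⟨a, ha⟩ := exists_eq_bray_tail ht o (fwdRay l)
  rw [LineConnects.mk_fwdRay (g := l) h] at ha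
  set q := bray ht o ζ (dist o p) with hq
  have hdq : dist o q = dist o p := dist_bray ht o ζ dist_nonneg
  have hlt : gpr o p q < dist o p := by
    by_contra hcon
    push Not at hcon
    have := onSeg_of_dist_le_gpr hcon
    unfold OnSeg at this
    rw [hdq] at this
    have : p = q := dist_le_zero.1 (by linarith)
    exact hζ this.symm
  obtain ⟨n₂, hn₂⟩ := exists_nat_ge (dist o (g 0) + |a| + dist o p)
  obtain ⟨n₃, hn₃⟩ := exists_nat_one_div_lt (sub_pos.2 hlt)
  set k := max n₁ (max n₂ n₃)
  have hk1 : n₁ ≤ k := le_max_left _ _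
  have hk2 : n₂ ≤ k := (le_max_left _ _).trans (le_max_right _ _)
  have hk3 : n₃ ≤ k := (le_max_right _ _).trans (le_max_right _ _)
  have d0 := dist_nonneg (x := o) (y := g 0)
  have d1 := dist_nonneg (x := o) (y := p)
  refine ⟨k, fun n hn => ?_⟩
  have hkn : (n₂ : ℝ) ≤ n := by exact_mod_cast hk2.trans hn
  have hk2' : (n₂ : ℝ) ≤ k := by exact_mod_cast hk2
  have hn0 : (0 : ℝ) ≤ n := n.cast_nonneg
  have ha0 := abs_nonneg a
  have ha1 := neg_abs_le a
  refine ⟨?_, ?_, ?_, ?_, ?_⟩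
  · change dist (g (-n)) (g n) = 2 * n
    rw [h.1, abs_of_nonpos (by linarith)]
    ring
  · have := hn₁ n (hk1.trans hn)
    simpa [bwdRay, l] using this
  · change dist o (g (-n)) ≤ 2 * n / 2 + k
    have h1 := dist_triangle o (g 0) (g (-n))
    rw [h.1, abs_of_nonneg (by linarith)] at h1
    linarith
  · change dist o (g n) ≤ 2 * n / 2 + k
    have h1 := dist_triangle o (g 0) (g n)
    rw [h.1, abs_of_nonpos (by linarith)] at h1
    linarith
  · change gpr o p (g n) ≤ dist o p - 1 / (k + 1)
    have e := (ha n (by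
      rw [NNReal.coe_natCast]
      change dist o (g ((0 : ℝ≥0) : ℝ)) ≤ n
      rw [NNReal.coe_zero]; linarith)).2
    rw [NNReal.coe_natCast] at e
    change g n = _ at e
    have h2 : gpr o q (g n) = dist o p := by
      rw [e]
      exact gpr_bray_bray ht o ζ dist_nonneg (by linarith)
    have h3 := ht.gpr_ultra o p (g n) q
    rw [gpr_comm o (g n) q, h2, min_eq_left (gpr_le_left o p _)] at h3
    have h4 : (1 : ℝ) / (k + 1) ≤ 1 / (n₃ + 1) := by
      have : (n₃ : ℝ) ≤ k := by exact_mod_cast hk3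
      gcongr
    linarith

variable [MeasurableSpace X]

lemma W2cost_eq_of_Wdist_eq {μ ν : W2Space X} {T : ℝ} (hT : 0 < T) (h : Wdist μ ν = T) :
    W2cost μ.1 ν.1 = ENNReal.ofReal (T ^ 2) := by
  unfold Wdist at h
  have h1 : (W2cost μ.1 ν.1).toReal = T ^ 2 := by
    rw [← h, Real.sq_sqrt ENNReal.toReal_nonneg]
  rw [← h1, ENNReal.ofReal_toReal]
  intro h2
  rw [h2] at h1
  simp at h1
  exact (pow_pos hT 2).ne h1

variable [BorelSpace X] [SecondCountableTopology X]

lemma lintegral_dist_sq_lt_top {μ : Measure X} [IsProbabilityMeasure μ] {x o : X}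
    (h : ∫⁻ y, ENNReal.ofReal (dist x y) ^ 2 ∂μ < ⊤) :
    ∫⁻ y, ENNReal.ofReal (dist o y) ^ 2 ∂μ < ⊤ := by
  refine (lintegral_mono (g := fun y => ENNReal.ofReal (2 * dist o x ^ 2) +
    2 * ENNReal.ofReal (dist x y) ^ 2) fun y => ?_).trans_lt ?_
  · have e : (2 : ℝ≥0∞) = ENNReal.ofReal 2 := by simp
    change _ ≤ _ + 2 * ENNReal.ofReal (dist x y) ^ 2
    rw [e, ← ENNReal.ofReal_pow dist_nonneg, ← ENNReal.ofReal_pow dist_nonneg,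
      ← ENNReal.ofReal_mul (by norm_num), ← ENNReal.ofReal_add (by positivity) (by positivity)]
    refine ENNReal.ofReal_le_ofReal ?_
    have h1 := dist_triangle o x y
    have h2 : dist o y ^ 2 ≤ (dist o x + dist x y) ^ 2 := by gcongr
    nlinarith [sq_nonneg (dist o x - dist x y)]
  · rw [lintegral_add_left measurable_const, lintegral_const_mul _ (by fun_prop), lintegral_const]
    simp only [measure_univ, mul_one]
    exact ENNReal.add_lt_top.2 ⟨ENNReal.ofReal_lt_top, ENNReal.mul_lt_top (by simp) h⟩

lemma exists_nat_measure_ne_zero {A : Type*} [MeasurableSpace A] {m : Measure A} {S : Set A}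
    (hS : m S ≠ 0) {P : ℕ → A → Prop} (h : ∀ a ∈ S, ∃ k, P k a) : ∃ k, m {a | P k a} ≠ 0 := by
  by_contra hcon
  push Not at hcon
  refine hS (measure_mono_null (t := ⋃ k, {a | P k a}) (fun a ha => ?_)
    (measure_iUnion_null hcon))
  simpa using h a ha

/-- The coupling of the ends of a displacement interpolation of a Wasserstein geodesic has no
crossings. -/
lemma nonCrossing_of_geodesic [CompactSpace (Boundary X)] (ht : IsRealTree X) (b : Boundary X)
    {μt : ℝ → W2Space X} {m : Measure (GeoLine X)} [IsProbabilityMeasure m]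
    (hW : ∀ s t, Wdist (μt s) (μt t) = |s - t|)
    (hmt : ∀ t, m.map (fun γ : GeoLine X => γ.1 t) = (μt t).1)
    (hu : ∀ᵐ γ ∂m, dist (γ.1 0) (γ.1 1) = 1) (o p : X) :
    NonCrossing (m.map fun γ => (minusEnd b γ, plusEnd b γ)) (shadow ht o p) := by
  have hE : Measurable fun γ : GeoLine X => (minusEnd b γ, plusEnd b γ) :=
    (measurable_minusEnd ht b).prodMk (measurable_plusEnd ht b)
  have hS := measurableSet_shadow ht o p
  by_contra hcon
  unfold NonCrossing at hcon
  rw [not_or, Measure.map_apply hE (hS.prod hS.compl), Measure.map_apply hE (hS.compl.prod hS)]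
    at hcon
  obtain ⟨hA, hB⟩ := hcon
  set U : Set (GeoLine X) := {γ | dist (γ.1 0) (γ.1 1) = 1}
  have hU : m Uᶜ = 0 := hu
  rw [← measure_inter_conull hU] at hA hB
  obtain ⟨k₁, hk₁⟩ := exists_nat_measure_ne_zero hA fun γ hγ =>
    exists_mem_leavingPairs ht o p (lineConnects_ends b hγ.2) hγ.1.1 hγ.1.2
  obtain ⟨k₂, hk₂⟩ := exists_nat_measure_ne_zero hB
    (P := fun k γ => ∀ n : ℕ, k ≤ n → (γ.1 n, γ.1 (-n)) ∈ leavingPairs o p (2 * n) k (1 / (k + 1)))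
    fun γ hγ => by
      have hc := lineConnects_ends b hγ.2
      have hrev : LineConnects (fun t => γ.1 (-t)) (plusEnd b γ) (minusEnd b γ) := by
        refine ⟨fun s t => ?_, ?_, hc.2.1⟩
        · rw [hc.1, abs_sub_comm]; congr 1; ring
        · simpa using hc.2.2
      simpa using exists_mem_leavingPairs ht o p hrev hγ.1.2 hγ.1.1
  set k := max k₁ k₂
  set ε : ℝ := 1 / (k + 1)
  have hε : 0 < ε := by positivity
  have hk0 : (0 : ℝ) ≤ k := k.cast_nonneg
  obtain ⟨n, hn⟩ := exists_nat_gt (max (6 * k : ℝ) (((2 * k + 2 * ε) ^ 2 + 4 * k ^ 2) / (4 * ε)))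
  have hn1 := (le_max_left _ _).trans_lt hn
  have hn2 := (le_max_right _ _).trans_lt hn
  rw [div_lt_iff₀ (by positivity)] at hn2
  have hn0 : (0 : ℝ) < n := by linarith
  have hkn : k ≤ n := by
    have : (k : ℝ) ≤ n := by linarith
    exact_mod_cast this
  set T : ℝ := 2 * n with hTdef
  have hT : 0 < T := by positivity
  have e1 : Measurable fun γ : GeoLine X => (γ.1 (-n), γ.1 n) :=
    (measurable_geoLine_eval _).prodMk (measurable_geoLine_eval _)
  set κ := m.map fun γ : GeoLine X => (γ.1 (-n), γ.1 n)
  have hκ : IsProbabilityMeasure κ := Measure.isProbabilityMeasure_map e1.aemeasurable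
  have hcoup : IsCoupling κ (μt (-n)).1 (μt n).1 := by
    constructor
    · rw [← hmt, Measure.map_map measurable_fst e1]; rfl
    · rw [← hmt, Measure.map_map measurable_snd e1]; rfl
  set L₁ := leavingPairs o p T k ε
  set L₂ := Prod.swap ⁻¹' leavingPairs o p T k ε
  have hL₁ : MeasurableSet L₁ := measurableSet_leavingPairs o p T k ε
  have hL₂ : MeasurableSet L₂ := measurable_swap (measurableSet_leavingPairs o p T k ε)
  have hεk : ∀ j : ℕ, j ≤ k → ε ≤ 1 / (j + 1) := fun j hj => by
    have : (j : ℝ) ≤ k := by exact_mod_cast hj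
    simp only [ε]
    gcongr
  have hp₁ : κ L₁ ≠ 0 := by
    rw [Measure.map_apply e1 hL₁]
    refine fun h0 => hk₁ (measure_mono_null (fun γ hγ => ?_) h0)
    have hj : k₁ ≤ k := le_max_left _ _
    exact leavingPairs_mono (by exact_mod_cast hj) (hεk _ hj) (hγ n (hj.trans hkn))
  have hp₂ : κ L₂ ≠ 0 := by
    rw [Measure.map_apply e1 hL₂]
    refine fun h0 => hk₂ (measure_mono_null (fun γ hγ => ?_) h0)
    have hj : k₂ ≤ k := le_max_right _ _
    exact leavingPairs_mono (by exact_mod_cast hj) (hεk _ hj) (hγ n (hj.trans hkn))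
  have hd : Disjoint L₁ L₂ := by
    refine disjoint_left.2 fun z hz hw => ?_
    have h1 := hz.2.1.gpr_eq
    have h2 : gpr o p z.1 ≤ dist o p - ε := hw.2.2.2.2
    linarith
  have hcost : ∫⁻ z, ENNReal.ofReal (dist z.1 z.2) ^ 2 ∂κ = ENNReal.ofReal (T ^ 2) := by
    rw [lintegral_map (by fun_prop) e1]
    have : ∀ᵐ γ ∂m, ENNReal.ofReal (dist (γ.1 (-n)) (γ.1 n)) ^ 2 = ENNReal.ofReal (T ^ 2) := by
      filter_upwards [hu] with γ hγ
      rw [γ.dist_eq_of_unit hγ, abs_of_nonpos (by linarith), ← ENNReal.ofReal_pow (by linarith)]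
      congr 2
      rw [hTdef]; ring
    rw [lintegral_congr_ae this, lintegral_const, measure_univ, mul_one]
  have hopt : W2cost (μt (-n)).1 (μt n).1 = ENNReal.ofReal (T ^ 2) := by
    refine W2cost_eq_of_Wdist_eq hT ?_
    rw [hW, abs_of_nonpos (by linarith)]
    rw [hTdef]; ring
  obtain ⟨π', hπ', hlt⟩ := exists_coupling_lintegral_lt hcoup hL₁ hL₂ hd hp₁ hp₂
    (c := fun z => ENNReal.ofReal (dist z.1 z.2) ^ 2) (by fun_prop)
    (by rw [hcost]; exact ENNReal.ofReal_ne_top) fun z hz w hw => by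
      simp only [← ENNReal.ofReal_pow dist_nonneg]
      rw [← ENNReal.ofReal_add (by positivity) (by positivity),
        ← ENNReal.ofReal_add (by positivity) (by positivity)]
      have := leavingPairs_swap_lt ht hε hk0 hT (by linarith) (by nlinarith) hz hw
      exact (ENNReal.ofReal_lt_ofReal_iff_of_nonneg (by positivity)).2 this
  rw [hcost, ← hopt] at hlt
  exact absurd (iInf₂_le π' hπ') (not_le.2 hlt)

lemma D0supCost_lt_top_of_realizableEnds [CompactSpace (Boundary X)]
    [SecondCountableTopology (Boundary X)] (ht : IsRealTree X) (o : X)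
    {νm νp : Measure (Boundary X)} [IsProbabilityMeasure νm] [IsProbabilityMeasure νp]
    (hanti : AntipodalMeasures νm νp) (h : RealizableEnds (X := X) νm νp) :
    D0supCost o νm νp < ⊤ := by
  obtain ⟨μt, m, hm, hW, hmt, hminus, hplus⟩ := h
  have hu := ae_unitSpeed_of_map_lineEndPlus hplus
  obtain ⟨b⟩ : Nonempty (Boundary X) := by
    by_contra hcon
    rw [not_nonempty_iff] at hcon
    exact IsProbabilityMeasure.ne_zero νm (Measure.eq_zero_of_isEmpty νm)
  have hmm := measurable_minusEnd ht b
  have hmp := measurable_plusEnd ht b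
  have hE : Measurable fun γ : GeoLine X => (minusEnd b γ, plusEnd b γ) := hmm.prodMk hmp
  set π := m.map fun γ : GeoLine X => (minusEnd b γ, plusEnd b γ)
  have hπ : IsCoupling π νm νp := by
    have i1 := Measure.isProbabilityMeasure_map (μ := m) hmm.aemeasurable
    have i2 := Measure.isProbabilityMeasure_map (μ := m) hmp.aemeasurable
    constructor
    · rw [Measure.map_map measurable_fst hE]
      change m.map (minusEnd b) = νm
      exact eq_of_map_coneMk_eq (by rw [← hminus, map_lineEndMinus_of_ae ht b hu])
    · rw [Measure.map_map measurable_snd hE]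
      change m.map (plusEnd b) = νp
      exact eq_of_map_coneMk_eq (by rw [← hplus, map_lineEndPlus_of_ae ht b hu])
  rw [D0supCost_eq_of_nonCrossing ht o hanti hπ fun p =>
    nonCrossing_of_geodesic ht b hW hmt hu o p, D0cost_eq_lintegral_bgp ht,
    lintegral_map (((measurable_bgp ht o).pow_const 2).ennreal_ofReal) hE]
  obtain ⟨hμ, x, hx⟩ := (μt 0).2
  have hfin := lintegral_dist_sq_lt_top (o := o) hx
  rw [← hmt, lintegral_map (by fun_prop) (measurable_geoLine_eval 0)] at hfin
  refine (lintegral_mono_ae ?_).trans_lt hfin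
  filter_upwards [hu] with γ hγ
  rw [← ENNReal.ofReal_pow dist_nonneg]
  refine ENNReal.ofReal_le_ofReal ?_
  have := bgp_nonneg ht o (minusEnd b γ) (plusEnd b γ)
  have := bgp_le_dist_of_lineConnects ht o (lineConnects_ends b hγ) 0
  gcongr

end Necessity

/-! ## A Kantorovich potential -/

section Potential

variable {X : Type*} [MetricSpace X]

lemma ae_mem_msupport {A : Type*} [TopologicalSpace A] [SecondCountableTopology A]
    [MeasurableSpace A] (μ : Measure A) : ∀ᵐ x ∂μ, x ∈ msupport μ := by
  refine measure_null_of_locally_null _ fun x hx => ?_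
  have hx' : x ∉ msupport μ := hx
  simp only [msupport, mem_ofPred_eq, not_forall, not_lt, nonpos_iff_eq_zero] at hx'
  obtain ⟨U, hxU, hU, h0⟩ := hx'
  exact ⟨U, mem_nhdsWithin_of_mem_nhds (hU.mem_nhds hxU), h0⟩

lemma shadow_anti (ht : IsRealTree X) {o y z : X} (h : OnSeg o y z) :
    shadow ht o z ⊆ shadow ht o y := by
  intro ξ hξ
  have hξ' : bray ht o ξ (dist o z) = z := hξ
  have h1 := onSeg_bray ht o ξ dist_nonneg h.dist_le
  rw [hξ'] at h1
  refine ht.eq_of_onSeg h1 h (dist_bray ht o ξ dist_nonneg) ?_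
  rw [dist_bray ht o ξ dist_nonneg]
  refine h.dist_le.trans (le_of_eq ?_)
  unfold gpr
  rw [dist_self]
  ring

open Classical in
/-- The sign of the flow through the point `y`, oriented away from `o`. -/
def flowSign (ht : IsRealTree X) (o : X) (νm νp : Measure (Boundary X)) (y : X) : ℝ :=
  if (νm (shadow ht o y)).toReal < (νp (shadow ht o y)).toReal then 1
  else if (νp (shadow ht o y)).toReal < (νm (shadow ht o y)).toReal then -1 else 0

variable (ht : IsRealTree X) (o : X) (νm νp : Measure (Boundary X))

lemma abs_flowSign_le (y : X) : |flowSign ht o νm νp y| ≤ 1 := by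
  unfold flowSign
  split_ifs <;> simp

lemma measurable_flowSign_treePt [IsProbabilityMeasure νm] [IsProbabilityMeasure νp] (x : X) :
    Measurable fun r => flowSign ht o νm νp (treePt ht o r x) := by
  have hanti : ∀ ν : Measure (Boundary X), IsProbabilityMeasure ν →
      Measurable fun r => (ν (shadow ht o (treePt ht o r x))).toReal := by
    intro ν _
    refine Antitone.measurable fun r s hrs => ENNReal.toReal_mono (measure_ne_top _ _)
      (measure_mono (shadow_anti ht ?_))
    refine ht.onSeg_of_dist_le (onSeg_treePt ht o r x) (onSeg_treePt ht o s x) ?_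
    rw [dist_treePt, dist_treePt]
    gcongr
  unfold flowSign
  exact Measurable.ite (measurableSet_lt (hanti νm ‹_›) (hanti νp ‹_›)) measurable_const
    (Measurable.ite (measurableSet_lt (hanti νp ‹_›) (hanti νm ‹_›)) measurable_const
      measurable_const)

lemma intervalIntegrable_flowSign [IsProbabilityMeasure νm] [IsProbabilityMeasure νp] (x : X)
    (a b : ℝ) :
    IntervalIntegrable (fun r => flowSign ht o νm νp (treePt ht o r x)) volume a b :=
  (intervalIntegrable_const (c := (1 : ℝ))).mono_fun'
    (measurable_flowSign_treePt ht o νm νp x).aestronglyMeasurable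
    (ae_of_all _ fun _ => abs_flowSign_le ht o νm νp _)

/-- The Kantorovich potential of the flow: the signed length of the segment from `o` to `x`. -/
def flowPotential (x : X) : ℝ :=
  ∫ r in (0 : ℝ)..dist o x, flowSign ht o νm νp (treePt ht o r x)

variable [IsProbabilityMeasure νm] [IsProbabilityMeasure νp]

lemma flowPotential_sub {y x : X} (h : OnSeg o y x) :
    flowPotential ht o νm νp x - flowPotential ht o νm νp y =
      ∫ r in dist o y..dist o x, flowSign ht o νm νp (treePt ht o r x) := by
  have e : flowPotential ht o νm νp y =
      ∫ r in (0 : ℝ)..dist o y, flowSign ht o νm νp (treePt ht o r x) := by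
    refine intervalIntegral.integral_congr fun r hr => ?_
    rw [uIcc_of_le dist_nonneg] at hr
    rw [treePt_congr ht hr.1 (hr.2.trans h.gpr_eq.ge)]
  rw [e, flowPotential, intervalIntegral.integral_interval_sub_left] <;>
  exact intervalIntegrable_flowSign ht o νm νp x _ _

lemma abs_flowPotential_sub_le (x y : X) :
    |flowPotential ht o νm νp x - flowPotential ht o νm νp y| ≤ dist x y := by
  have key : ∀ {q z : X}, OnSeg o q z →
      |flowPotential ht o νm νp z - flowPotential ht o νm νp q| ≤ dist o z - dist o q := by
    intro q z h
    rw [flowPotential_sub ht o νm νp h]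
    have := intervalIntegral.norm_integral_le_of_norm_le_const (a := dist o q) (b := dist o z)
      (C := 1) (f := fun r => flowSign ht o νm νp (treePt ht o r z))
      fun r _ => abs_flowSign_le ht o νm νp _
    rwa [one_mul, abs_of_nonneg (sub_nonneg.2 h.dist_le)] at this
  have h0 := gpr_nonneg o x y
  have e := treePt_congr ht h0 le_rfl
  have h1 := key (onSeg_treePt ht o (gpr o x y) x)
  have h2 := key (onSeg_treePt ht o (gpr o x y) y)
  rw [dist_treePt_of_le ht h0 (gpr_le_left o x y)] at h1
  rw [dist_treePt_of_le ht h0 (gpr_le_right o x y), ← e, abs_sub_comm] at h2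
  have h3 := abs_sub_le (flowPotential ht o νm νp x)
    (flowPotential ht o νm νp (treePt ht o (gpr o x y) x)) (flowPotential ht o νm νp y)
  linarith [dist_eq_gpr o x y]

lemma continuous_flowPotential : Continuous (flowPotential ht o νm νp) :=
  (LipschitzWith.of_dist_le_mul (K := 1) fun x y => by
    rw [NNReal.coe_one, one_mul, Real.dist_eq]
    exact abs_flowPotential_sub_le ht o νm νp x y).continuous

lemma flowPotential_bray (ξ : Boundary X) {D t c : ℝ} (hD : 0 ≤ D) (hDt : 0 ≤ t)
    (h : ∀ r, D < r → flowSign ht o νm νp (bray ht o ξ r) = c) :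
    flowPotential ht o νm νp (bray ht o ξ (D + t)) =
      flowPotential ht o νm νp (bray ht o ξ D) + c * t := by
  have hs := onSeg_bray ht o ξ hD (le_add_of_nonneg_right hDt)
  have e := flowPotential_sub ht o νm νp hs
  rw [dist_bray ht o ξ hD, dist_bray ht o ξ (add_nonneg hD hDt)] at e
  have e2 : ∫ r in D..D + t, flowSign ht o νm νp (treePt ht o r (bray ht o ξ (D + t))) =
      ∫ _ in D..D + t, c := by
    refine intervalIntegral.integral_congr_ae (ae_of_all _ fun r hr => ?_)
    rw [uIoc_of_le (le_add_of_nonneg_right hDt)] at hr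
    have hr0 := hD.trans hr.1.le
    have := treePt_eq_of_onSeg ht (onSeg_bray ht o ξ hr0 hr.2)
    rw [dist_bray ht o ξ hr0] at this
    rw [this, h r hr.1]
  rw [e2, intervalIntegral.integral_const, smul_eq_mul] at e
  linarith

/-- Along the lines charged by a coupling without crossings, the potential grows at unit speed. -/
lemma flowPotential_bline {π : Measure (Boundary X × Boundary X)} [IsProbabilityMeasure π]
    (hπ : IsCoupling π νm νp) (hnc : ∀ y, NonCrossing π (shadow ht o y))
    {p : Boundary X × Boundary X} (hne : p.1 ≠ p.2) (hp : p ∈ msupport π) (t : ℝ) :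
    flowPotential ht o νm νp (bline ht o p.1 p.2 t) =
      flowPotential ht o νm νp (bline ht o p.1 p.2 0) + t := by
  have hD := bgp_nonneg ht o p.1 p.2
  have hdiff : ∀ {r}, bgp ht o p.1 p.2 < r → bray ht o p.1 r ≠ bray ht o p.2 r := fun {r} hr h =>
    absurd ((bray_eq_iff ht o hne (hD.trans hr.le)).1 h) (not_le.2 hr)
  have hpos : ∀ r, bgp ht o p.1 p.2 < r → flowSign ht o νm νp (bray ht o p.2 r) = 1 := by
    intro r hr
    have hr0 := hD.trans hr.le
    set S := shadow ht o (bray ht o p.2 r) with hS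
    have hSm : MeasurableSet S := measurableSet_shadow ht o _
    have h1 : 0 < π (Sᶜ ×ˢ S) := hp _
      ⟨fun h => hdiff hr ((mem_shadow_bray ht o hr0).1 h), (mem_shadow_bray ht o hr0).2 rfl⟩
      ((isClosed_shadow ht o _).isOpen_compl.prod (isOpen_shadow ht o _))
    have h2 : π (S ×ˢ Sᶜ) = 0 := (hnc _).resolve_right h1.ne'
    have h3 : (νm S).toReal < (νp S).toReal := by
      rw [hπ.left_eq_add hSm, hπ.right_eq_add hSm, h2, add_zero,
        ENNReal.toReal_add (measure_ne_top _ _) (measure_ne_top _ _)]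
      exact lt_add_of_pos_right _ (ENNReal.toReal_pos h1.ne' (measure_ne_top _ _))
    unfold flowSign
    rw [if_pos h3]
  have hneg : ∀ r, bgp ht o p.1 p.2 < r → flowSign ht o νm νp (bray ht o p.1 r) = -1 := by
    intro r hr
    have hr0 := hD.trans hr.le
    set S := shadow ht o (bray ht o p.1 r) with hS
    have hSm : MeasurableSet S := measurableSet_shadow ht o _
    have h1 : 0 < π (S ×ˢ Sᶜ) := hp _
      ⟨(mem_shadow_bray ht o hr0).2 rfl, fun h => hdiff hr ((mem_shadow_bray ht o hr0).1 h).symm⟩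
      ((isOpen_shadow ht o _).prod (isClosed_shadow ht o _).isOpen_compl)
    have h2 : π (Sᶜ ×ˢ S) = 0 := (hnc _).resolve_left h1.ne'
    have h3 : (νp S).toReal < (νm S).toReal := by
      rw [hπ.left_eq_add hSm, hπ.right_eq_add hSm, h2, add_zero,
        ENNReal.toReal_add (measure_ne_top _ _) (measure_ne_top _ _)]
      exact lt_add_of_pos_right _ (ENNReal.toReal_pos h1.ne' (measure_ne_top _ _))
    unfold flowSign
    rw [if_neg h3.le.not_gt, if_pos h3]
  rcases le_total 0 t with h | h
  · rw [bline_of_nonneg ht o _ _ h, bline_of_nonneg ht o _ _ le_rfl, add_zero,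
      flowPotential_bray ht o νm νp _ hD h hpos, one_mul]
  · rw [bline_of_nonpos ht o _ _ h, bline_of_nonpos ht o _ _ le_rfl, sub_zero, sub_eq_add_neg,
      flowPotential_bray ht o νm νp _ hD (neg_nonneg.2 h) hneg, neg_one_mul, neg_neg]

end Potential

/-! ## Geodesics of the Wasserstein space from couplings of the ends -/

section Sufficiency

variable {X : Type*} [MetricSpace X]

open Classical in
/-- The line with ends `p.1` and `p.2`, parametrized from the point closest to `o`, as a complete
geodesic (constant when the ends coincide). -/
def geoLineOfEnds (ht : IsRealTree X) (o : X) (p : Boundary X × Boundary X) : GeoLine X :=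
  if h : p.1 ≠ p.2 then
    ⟨bline ht o p.1 p.2, 1, zero_le_one, fun s t => by rw [dist_bline_bline ht o h, one_mul]⟩
  else ⟨fun _ => o, 0, le_rfl, fun s t => by simp⟩

lemma geoLineOfEnds_of_ne (ht : IsRealTree X) (o : X) {p : Boundary X × Boundary X}
    (h : p.1 ≠ p.2) : (geoLineOfEnds ht o p).1 = bline ht o p.1 p.2 := by
  unfold geoLineOfEnds
  rw [dif_pos h]

variable [MeasurableSpace X] [BorelSpace X]

lemma measurable_uncurry_bray [SecondCountableTopology (Boundary X)] (ht : IsRealTree X) (o : X) :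
    Measurable fun q : ℝ × Boundary X => bray ht o q.2 (max q.1 0) := by
  refine measurable_uncurry_of_continuous_of_measurable
    (u := fun r ξ => bray ht o ξ (max r 0)) (fun ξ => ?_) fun r =>
    (continuous_bray ht o (le_max_right _ _)).measurable
  refine (LipschitzWith.of_dist_le_mul (K := 1) fun r s => ?_).continuous
  rw [dist_bray_bray ht o ξ (le_max_right _ _) (le_max_right _ _), NNReal.coe_one, one_mul,
    Real.dist_eq]
  exact abs_max_sub_max_le_abs _ _ _

lemma measurable_bline [SecondCountableTopology (Boundary X)] (ht : IsRealTree X) (o : X) (t : ℝ) :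
    Measurable fun p : Boundary X × Boundary X => bline ht o p.1 p.2 t := by
  have hb := measurable_bgp ht o
  have hB := measurable_uncurry_bray ht o
  rcases le_total 0 t with h | h
  · convert hB.comp ((hb.add_const t).prodMk measurable_snd) using 2 with p
    have := bgp_nonneg ht o p.1 p.2
    rw [bline_of_nonneg ht o _ _ h]
    simp only [Function.comp_apply]
    rw [max_eq_left (by linarith)]
  · convert hB.comp ((hb.sub_const t).prodMk measurable_fst) using 2 with p
    have := bgp_nonneg ht o p.1 p.2
    rw [bline_of_nonpos ht o _ _ h]
    simp only [Function.comp_apply]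
    rw [max_eq_left (by linarith)]

lemma measurable_geoLineOfEnds [SecondCountableTopology (Boundary X)] [T2Space (Boundary X)]
    (ht : IsRealTree X) (o : X) : Measurable (geoLineOfEnds ht o) := by
  classical
  have : Measurable fun p : Boundary X × Boundary X => (geoLineOfEnds ht o p).1 := by
    refine measurable_pi_iff.2 fun t => ?_
    have hne : MeasurableSet {p : Boundary X × Boundary X | p.1 ≠ p.2} :=
      isClosed_diagonal.measurableSet.compl
    have hite : Measurable fun p : Boundary X × Boundary X =>
        if p.1 ≠ p.2 then bline ht o p.1 p.2 t else o :=
      Measurable.ite hne (measurable_bline ht o t) measurable_const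
    convert hite using 2 with p
    split_ifs with h
    · rw [geoLineOfEnds_of_ne ht o h]
    · unfold geoLineOfEnds
      rw [dif_neg h]
  exact this.subtype_mk

/-- Weak Kantorovich duality for a `1`-Lipschitz potential. -/
lemma ofReal_sq_integral_sub_le_W2cost {μ ν : Measure X} [IsProbabilityMeasure μ] {f : X → ℝ}
    (hf : Continuous f) (hlip : ∀ x y, |f x - f y| ≤ dist x y) (hμ : Integrable f μ)
    (hν : Integrable f ν) :
    ENNReal.ofReal ((∫ x, f x ∂ν - ∫ x, f x ∂μ) ^ 2) ≤ W2cost μ ν := by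
  refine le_iInf₂ fun κ hκ => ?_
  have hκ1 : κ.map Prod.fst = μ := hκ.1
  have hκ2 : κ.map Prod.snd = ν := hκ.2
  have hκp : IsProbabilityMeasure κ := hκ.isProbabilityMeasure
  set a := ∫ x, f x ∂ν - ∫ x, f x ∂μ with ha
  have i1 : Integrable (fun p : X × X => f p.1) κ := by
    rw [← hκ1] at hμ
    exact hμ.comp_measurable measurable_fst
  have i2 : Integrable (fun p : X × X => f p.2) κ := by
    rw [← hκ2] at hν
    exact hν.comp_measurable measurable_snd
  have e1 : ∫ p : X × X, f p.1 ∂κ = ∫ x, f x ∂μ := by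
    rw [← hκ1, integral_map measurable_fst.aemeasurable hf.aestronglyMeasurable]
  have e2 : ∫ p : X × X, f p.2 ∂κ = ∫ x, f x ∂ν := by
    rw [← hκ2, integral_map measurable_snd.aemeasurable hf.aestronglyMeasurable]
  have i3 : Integrable (fun p : X × X => 2 * a * (f p.2 - f p.1) - a ^ 2) κ :=
    ((i2.sub i1).const_mul _).sub (integrable_const _)
  have e3 : ∫ p : X × X, (2 * a * (f p.2 - f p.1) - a ^ 2) ∂κ = a ^ 2 := by
    have e4 := integral_sub ((i2.sub i1).const_mul (2 * a)) (integrable_const (a ^ 2))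
    simp only [Pi.sub_apply] at e4
    rw [e4, integral_const_mul,
      integral_sub i2 i1, e1, e2, ← ha]
    simp
    ring
  rw [← e3]
  refine (ENNReal.ofReal_le_ofReal
    (integral_mono i3 i3.pos_part fun p => le_max_left _ _)).trans ?_
  rw [ofReal_integral_eq_lintegral_ofReal i3.pos_part (ae_of_all _ fun p => le_max_right _ _)]
  refine lintegral_mono fun p => ?_
  rw [← ENNReal.ofReal_pow dist_nonneg]
  refine ENNReal.ofReal_le_ofReal (max_le ?_ (sq_nonneg _))
  have h1 : (f p.2 - f p.1) ^ 2 ≤ dist p.1 p.2 ^ 2 := by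
    rw [← sq_abs, abs_sub_comm]
    gcongr
    exact hlip _ _
  nlinarith [sq_nonneg (f p.2 - f p.1 - a)]

variable [SecondCountableTopology X] [CompactSpace (Boundary X)] [T2Space (Boundary X)]
  [SecondCountableTopology (Boundary X)]

/-- A coupling without crossings and with finite cost yields a geodesic of the Wasserstein space. -/
lemma exists_geodesic_of_nonCrossing (ht : IsRealTree X) (o : X) {νm νp : Measure (Boundary X)}
    [IsProbabilityMeasure νm] [IsProbabilityMeasure νp]
    {π : Measure (Boundary X × Boundary X)} [IsProbabilityMeasure π] (hπ : IsCoupling π νm νp)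
    (hne : ∀ᵐ p ∂π, p.1 ≠ p.2) (hnc : ∀ y, NonCrossing π (shadow ht o y))
    (hfin : D0cost o π < ⊤) :
    ∃ (μt : ℝ → W2Space X) (m : Measure (GeoLine X)), IsProbabilityMeasure m ∧
      (∀ s t : ℝ, Wdist (μt s) (μt t) = |s - t|) ∧
      (∀ t : ℝ, m.map (fun γ : GeoLine X => γ.1 t) = (μt t).1) ∧
      m.map lineEndMinus = νm.map (fun ξ : Boundary X => coneMk ξ 1) ∧
      m.map lineEndPlus = νp.map (fun ξ : Boundary X => coneMk ξ 1) ∧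
      m.map (fun γ : GeoLine X => γ.1) =
        π.map (fun p : Boundary X × Boundary X => lineFrom o p.1 p.2) := by
  obtain ⟨b⟩ : Nonempty (Boundary X) := by
    by_contra hcon
    rw [not_nonempty_iff] at hcon
    exact IsProbabilityMeasure.ne_zero νm (Measure.eq_zero_of_isEmpty νm)
  have hL := measurable_geoLineOfEnds ht o
  have hbl := measurable_bline ht o
  set m := π.map (geoLineOfEnds ht o) with hm
  have hmp : IsProbabilityMeasure m := Measure.isProbabilityMeasure_map hL.aemeasurable
  have hmt : ∀ t, m.map (fun γ : GeoLine X => γ.1 t) = π.map fun p => bline ht o p.1 p.2 t := by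
    intro t
    rw [hm, Measure.map_map (measurable_geoLine_eval t) hL]
    refine Measure.map_congr (hne.mono fun p hp => ?_)
    simp only [Function.comp_apply]
    rw [geoLineOfEnds_of_ne ht o hp]
  have hunit : ∀ᵐ γ ∂m, dist (γ.1 0) (γ.1 1) = 1 := by
    rw [hm, ae_map_iff hL.aemeasurable measurableSet_unitSpeed]
    filter_upwards [hne] with p hp
    rw [geoLineOfEnds_of_ne ht o hp, dist_bline_bline ht o hp]
    simp
  have hlc : ∀ {p : Boundary X × Boundary X}, p.1 ≠ p.2 →
      LineConnects (geoLineOfEnds ht o p).1 p.1 p.2 := by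
    intro p hp
    rw [geoLineOfEnds_of_ne ht o hp]
    exact lineConnects_bline ht o hp
  have hD : Measurable fun p : Boundary X × Boundary X => bgp ht o p.1 p.2 := measurable_bgp ht o
  have hD2 : ∀ t : ℝ, Integrable (fun p : Boundary X × Boundary X =>
      dist o (bline ht o p.1 p.2 t) ^ 2) π := by
    intro t
    have i1 : Integrable (fun p : Boundary X × Boundary X => bgp ht o p.1 p.2 ^ 2) π := by
      refine ⟨(hD.pow_const 2).aestronglyMeasurable, ?_⟩
      rw [hasFiniteIntegral_iff_ofReal (ae_of_all _ fun p => sq_nonneg _),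
        ← D0cost_eq_lintegral_bgp ht]
      exact hfin
    refine ((i1.const_mul 2).add (integrable_const (2 * t ^ 2))).mono'
      (((measurable_const (a := o)).dist (hbl t)).pow_const 2).aestronglyMeasurable
      (ae_of_all _ fun p => ?_)
    rw [Real.norm_of_nonneg (sq_nonneg _), dist_bline]
    simp only [Pi.add_apply]
    nlinarith [sq_nonneg (bgp ht o p.1 p.2 - |t|), sq_abs t]
  have hprob : ∀ t, IsProbabilityMeasure (m.map fun γ : GeoLine X => γ.1 t) := fun t =>
    Measure.isProbabilityMeasure_map (measurable_geoLine_eval t).aemeasurable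
  let μt : ℝ → W2Space X := fun t => ⟨m.map fun γ : GeoLine X => γ.1 t, hprob t, o, by
    rw [hmt, lintegral_map (by fun_prop) (hbl t)]
    have := (hD2 t).2
    rw [hasFiniteIntegral_iff_ofReal (ae_of_all _ fun p => sq_nonneg _)] at this
    simpa only [ENNReal.ofReal_pow dist_nonneg] using this⟩
  set f := flowPotential ht o νm νp with hf
  have hfc : Continuous f := continuous_flowPotential ht o νm νp
  have hflip : ∀ x y, |f x - f y| ≤ dist x y := abs_flowPotential_sub_le ht o νm νp
  have hfi : ∀ t, Integrable (fun p : Boundary X × Boundary X => f (bline ht o p.1 p.2 t)) π := by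
    intro t
    refine (((hD2 t).add (integrable_const 1)).add (integrable_const |f o|)).mono'
      (hfc.measurable.comp (hbl t)).aestronglyMeasurable (ae_of_all _ fun p => ?_)
    have h1 := hflip (bline ht o p.1 p.2 t) o
    rw [dist_comm] at h1
    have h2 := abs_sub_abs_le_abs_sub (f (bline ht o p.1 p.2 t)) (f o)
    simp only [Pi.add_apply, Real.norm_eq_abs]
    nlinarith [sq_nonneg (dist o (bline ht o p.1 p.2 t) - 1),
      @dist_nonneg _ _ o (bline ht o p.1 p.2 t)]
  have hfμ : ∀ t, Integrable f (μt t).1 := by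
    intro t
    change Integrable f (m.map fun γ : GeoLine X => γ.1 t)
    rw [hmt, integrable_map_measure hfc.aestronglyMeasurable (hbl t).aemeasurable]
    exact hfi t
  have hfint : ∀ t, ∫ x, f x ∂(μt t).1 = (∫ p, f (bline ht o p.1 p.2 0) ∂π) + t := by
    intro t
    change ∫ x, f x ∂(m.map fun γ : GeoLine X => γ.1 t) = _
    rw [hmt, integral_map (hbl t).aemeasurable hfc.aestronglyMeasurable]
    have e : ∫ p, f (bline ht o p.1 p.2 t) ∂π = ∫ p, (f (bline ht o p.1 p.2 0) + t) ∂π := by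
      refine integral_congr_ae ?_
      filter_upwards [hne, ae_mem_msupport π] with p hp hs
      exact flowPotential_bline ht o νm νp hπ hnc hp hs t
    rw [e, integral_add (hfi 0) (integrable_const _)]
    simp
  have hW : ∀ s t, W2cost (μt s).1 (μt t).1 = ENNReal.ofReal (|s - t| ^ 2) := by
    intro s t
    refine le_antisymm ?_ ?_
    · have hst : Measurable fun γ : GeoLine X => (γ.1 s, γ.1 t) :=
        (measurable_geoLine_eval s).prodMk (measurable_geoLine_eval t)
      refine (iInf₂_le (m.map fun γ : GeoLine X => (γ.1 s, γ.1 t))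
        ⟨Measure.map_map measurable_fst hst, Measure.map_map measurable_snd hst⟩).trans ?_
      rw [lintegral_map (by fun_prop) hst]
      refine (lintegral_mono_ae (g := fun _ => ENNReal.ofReal (|s - t| ^ 2)) ?_).trans (by simp)
      filter_upwards [hunit] with γ hγ
      rw [γ.dist_eq_of_unit hγ, ENNReal.ofReal_pow (abs_nonneg _)]
    · have := hprob s
      have h := ofReal_sq_integral_sub_le_W2cost (μ := (μt s).1) hfc hflip (hfμ s) (hfμ t)
      rw [hfint, hfint, add_sub_add_left_eq_sub, ← sq_abs, abs_sub_comm] at h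
      exact h
  refine ⟨μt, m, hmp, fun s t => ?_, fun t => rfl, ?_, ?_, ?_⟩
  · unfold Wdist
    rw [hW, ENNReal.toReal_ofReal (sq_nonneg _), Real.sqrt_sq (abs_nonneg _)]
  · rw [map_lineEndMinus_of_ae ht b hunit, hm, Measure.map_map (measurable_minusEnd ht b) hL,
      ← hπ.1]
    congr 1
    exact Measure.map_congr (hne.mono fun p hp => (hlc hp).minusEnd_eq b)
  · rw [map_lineEndPlus_of_ae ht b hunit, hm, Measure.map_map (measurable_plusEnd ht b) hL,
      ← hπ.2]
    congr 1
    exact Measure.map_congr (hne.mono fun p hp => (hlc hp).plusEnd_eq b)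
  · rw [hm, Measure.map_map measurable_subtype_coe hL]
    refine Measure.map_congr (hne.mono fun p hp => ?_)
    exact (geoLineOfEnds_of_ne ht o hp).trans (lineFrom_eq_bline ht o hp).symm

end Sufficiency

/-- Uniformly antipodal measures have finite cost. -/
lemma D0cost_lt_top_of_uniformlyAntipodal {X : Type*} [MetricSpace X]
    [CompactSpace (Boundary X)] [SecondCountableTopology (Boundary X)] (ht : IsRealTree X) (o : X)
    {νm νp : Measure (Boundary X)} (h : UniformlyAntipodal νm νp)
    {π : Measure (Boundary X × Boundary X)} [IsProbabilityMeasure π] (hπ : IsCoupling π νm νp) :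
    D0cost o π < ⊤ := by
  have hclosed : ∀ ν : Measure (Boundary X), IsClosed (msupport ν) := by
    intro ν
    refine isOpen_compl_iff.1 (isOpen_iff_forall_mem_open.2 fun x hx => ?_)
    have hx' : ¬ ∀ U : Set (Boundary X), x ∈ U → IsOpen U → 0 < ν U := hx
    push Not at hx'
    obtain ⟨U, hxU, hU, h0⟩ := hx'
    exact ⟨U, fun y hy hs => absurd (hs U hy hU) (not_lt.2 h0), hU, hxU⟩
  have hae : ∀ᵐ p ∂π, p ∈ msupport νm ×ˢ msupport νp := by
    have h1 : ∀ᵐ ξ ∂π.map Prod.fst, ξ ∈ msupport νm := hπ.1 ▸ ae_mem_msupport νm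
    have h2 : ∀ᵐ ξ ∂π.map Prod.snd, ξ ∈ msupport νp := hπ.2 ▸ ae_mem_msupport νp
    filter_upwards [ae_of_ae_map measurable_fst.aemeasurable h1,
      ae_of_ae_map measurable_snd.aemeasurable h2] with p h3 h4
    exact ⟨h3, h4⟩
  obtain ⟨C, hC⟩ : ∃ C, ∀ p ∈ msupport νm ×ˢ msupport νp, bgp ht o p.1 p.2 ≤ C := by
    have hcpt : IsCompact (msupport νm ×ˢ msupport νp) :=
      ((hclosed νm).prod (hclosed νp)).isCompact
    have hcont : ContinuousOn (fun p : Boundary X × Boundary X => bgp ht o p.1 p.2)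
        (msupport νm ×ˢ msupport νp) := by
      simp_rw [bgp_eq_neg_log]
      refine ((continuous_bcost ht o).continuousOn.log fun p hp => ?_).neg
      exact (bcost_pos ht o ((antipodal_iff ht o _ _).1 (h _ hp.1 _ hp.2))).ne'
    obtain ⟨C, hC⟩ := hcpt.bddAbove_image hcont
    exact ⟨C, fun p hp => hC (mem_image_of_mem _ hp)⟩
  rw [D0cost_eq_lintegral_bgp ht]
  refine (lintegral_mono_ae (g := fun _ => ENNReal.ofReal (C ^ 2)) ?_).trans_lt (by simp)
  filter_upwards [hae] with p hp
  have := bgp_nonneg ht o p.1 p.2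
  have := hC p hp
  gcongr

/-- **Statement 11.** On a complete, locally compact, geodesically complete metric tree,
for two antipodal probability measures `ν₋, ν₊` on `∂X`, the following are equivalent:
(1) `(ν₋, ν₊)` is the pair of ends of a complete unit-speed geodesic of `W₂(X)`;
(2) the optimal transport problem for the cost `-D₀²` is finite (equivalently, the
supremum of `∫ D₀² dπ` over couplings is finite);
(3) the specific flow satisfies `Σ_x φ⁰(x) d(x,x₀)² < ∞`.
Moreover, when these hold, the problem (2) has a minimizer `π₀` (a maximizer of
`∫ D₀² dπ`), whose push-forward by `(ξ,ζ) ↦ γ(ξ,ζ)` (the unit geodesic from `ξ` to `ζ`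
whose time-0 point is closest to `x₀`) is a displacement interpolation of a geodesic of
`W₂(X)` with the prescribed ends; and the conditions hold whenever `ν₋, ν₊` are uniformly
antipodal. -/
theorem tree_ends_realizability
    (X : Type*) [MetricSpace X] [MeasurableSpace X] [BorelSpace X]
    [CompleteSpace X] [TopologicalSpace.SeparableSpace X] [LocallyCompactSpace X]
    (htree : IsRealTree X) (hgc : GeodesicallyComplete X)
    (x₀ : X) (νm νp : Measure (Boundary X))
    (hm : IsProbabilityMeasure νm) (hp : IsProbabilityMeasure νp)
    (hanti : AntipodalMeasures νm νp) :
    (RealizableEnds (X := X) νm νp ↔ D0supCost x₀ νm νp < ⊤) ∧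
    (D0supCost x₀ νm νp < ⊤ ↔
      Summable (fun x : {x : X // IsTreeVertex x} =>
        specificFlow νm νp x₀ x.1 * dist x.1 x₀ ^ 2)) ∧
    (D0supCost x₀ νm νp < ⊤ →
      ∃ π₀ : Measure (Boundary X × Boundary X), IsCoupling π₀ νm νp ∧
        (∀ π : Measure (Boundary X × Boundary X), IsCoupling π νm νp →
          D0cost x₀ π ≤ D0cost x₀ π₀) ∧
        ∃ (μt : ℝ → W2Space X) (m : Measure (GeoLine X)), IsProbabilityMeasure m ∧
          (∀ s t : ℝ, Wdist (μt s) (μt t) = |s - t|) ∧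
          (∀ t : ℝ, m.map (fun γ : GeoLine X => γ.1 t) = (μt t).1) ∧
          m.map lineEndMinus = νm.map (fun ξ : Boundary X => coneMk ξ 1) ∧
          m.map lineEndPlus = νp.map (fun ξ : Boundary X => coneMk ξ 1) ∧
          m.map (fun γ : GeoLine X => γ.1) =
            π₀.map (fun p : Boundary X × Boundary X => lineFrom x₀ p.1 p.2)) ∧
    (UniformlyAntipodal νm νp → D0supCost x₀ νm νp < ⊤) := by
  have hcpt := compactSpace_boundary htree x₀
  have hT2 := t2Space_boundary htree x₀
  have hsc := secondCountable_boundary htree x₀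
  have hscX : SecondCountableTopology X := UniformSpace.secondCountable_of_separable X
  obtain ⟨π, hπp, hπ, hncC⟩ := exists_nonCrossing_coupling htree x₀ νm νp
  have hnc : ∀ y, NonCrossing π (shadow htree x₀ y) := fun y =>
    hncC _ (measurableSet_shadow htree x₀ y) (isCluster_shadow htree x₀ y)
  have hne := hanti.ae_ne htree x₀ hπ
  have hsup := D0supCost_eq_of_nonCrossing htree x₀ hanti hπ hnc
  refine ⟨⟨D0supCost_lt_top_of_realizableEnds htree x₀ hanti, fun h => ?_⟩, ?_, fun h => ?_,
    fun h => ?_⟩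
  · obtain ⟨μt, m, h1, h2, h3, h4, h5, -⟩ :=
      exists_geodesic_of_nonCrossing htree x₀ hπ hne hnc (hsup ▸ h)
    exact ⟨μt, m, h1, h2, h3, h4, h5⟩
  · rw [hsup]
    exact D0cost_lt_top_iff_summable htree x₀ hπ hne hncC
  · exact ⟨π, hπ, fun π' hπ' => D0cost_le_of_nonCrossing htree x₀ hanti hπ hπ' hnc,
      exists_geodesic_of_nonCrossing htree x₀ hπ hne hnc (hsup ▸ h)⟩
  · rw [hsup]
    exact D0cost_lt_top_of_uniformlyAntipodal htree x₀ h hπ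

end
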